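/- Let V be an algebroid hypersurface over an algebraically closed field of characteristic zero whose singular locus W is nonsingular of codimension 1 in V, and let P be a point of W. Let π : V' → V be the blowing-up of W and let Q be a general point of W. Then V is of dimensionality type 1 along W at P if and only if: (1) π^{-1}(P) is a finite set of the same cardinality as π^{-1}(Q), and (2) each point P' ∈ π^{-1}(P) is either a nonsingular point of V' or a point of dimensionality type 1. -/

import Mathlib

open Polynomial Finset Set Classical

/-- The monic polynomial `Z^d + Σ aᵢ Z^{d-i}` built from its coefficients. -/
noncomputable def mkPoly (d : ℕ) (a : Fin d → ℂ) : Polynomial ℂ :=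
  X ^ d + ∑ i : Fin d, C (a i) * X ^ (d - (i.val + 1))

/-- The discriminant `∏_{i<j} (ξⱼ - ξᵢ)²` of a (split, monic) complex polynomial, via its
multiset of roots. -/
noncomputable def polyDisc (p : Polynomial ℂ) : ℂ :=
  ∏ q ∈ (Finset.range p.roots.toList.length ×ˢ Finset.range p.roots.toList.length).filter
      (fun q => q.1 < q.2),
    (p.roots.toList.getD q.2 0 - p.roots.toList.getD q.1 0) ^ 2

/-- `S` is, near the origin, the total space of an equisingular family of plane curve
singularities: it is the zero set of a Weierstrass polynomial `F(t,x,y)` whose discriminant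
has the form `x^M · unit(t,x)`. -/
def EqsFamily (q : ℕ) (S : Set ((Fin q → ℂ) × (ℂ × ℂ))) : Prop :=
  ∃ d M : ℕ, 0 < d ∧ ∃ a : Fin d → (Fin q → ℂ) × ℂ → ℂ,
    (∀ i, AnalyticAt ℂ (a i) 0 ∧ a i 0 = 0) ∧
    (∀ᶠ p in nhds (0 : (Fin q → ℂ) × (ℂ × ℂ)),
      (p ∈ S ↔ Polynomial.eval p.2.2 (mkPoly d fun i => a i (p.1, p.2.1)) = 0)) ∧
    ∃ u : (Fin q → ℂ) × ℂ → ℂ, AnalyticAt ℂ u 0 ∧ u 0 ≠ 0 ∧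
      ∀ᶠ z in nhds (0 : (Fin q → ℂ) × ℂ),
        polyDisc (mkPoly d fun i => a i z) = z.2 ^ M * u z

/-- The hypersurface `V'` has dimensionality type 1 along `W'` at `P'`: near `P'` it is
analytically isomorphic, by an isomorphism sending `W'` to `T = {x = y = 0}`, to the total
space of an equisingular family of plane curve singularities. -/
def DimType1Along (q : ℕ) (V' W' : Set ((Fin q → ℂ) × (ℂ × ℂ)))
    (P' : (Fin q → ℂ) × (ℂ × ℂ)) : Prop :=
  ∃ Φ Ψ : ((Fin q → ℂ) × (ℂ × ℂ)) → ((Fin q → ℂ) × (ℂ × ℂ)),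
    AnalyticAt ℂ Φ P' ∧ Φ P' = 0 ∧ AnalyticAt ℂ Ψ 0 ∧
    (∀ᶠ z in nhds P', Ψ (Φ z) = z) ∧
    (∀ᶠ w in nhds (0 : (Fin q → ℂ) × (ℂ × ℂ)), Φ (Ψ w) = w) ∧
    (∀ᶠ z in nhds P', (z ∈ W' ↔ (Φ z).2 = 0)) ∧
    ∃ S, EqsFamily q S ∧ ∀ᶠ z in nhds P', (z ∈ V' ↔ Φ z ∈ S)

/-- `P'` is a nonsingular point of the hypersurface `V'`. -/
def NonsingPt (q : ℕ) (V' : Set ((Fin q → ℂ) × (ℂ × ℂ)))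
    (P' : (Fin q → ℂ) × (ℂ × ℂ)) : Prop :=
  ∃ g : ((Fin q → ℂ) × (ℂ × ℂ)) → ℂ, AnalyticAt ℂ g P' ∧
    (∀ᶠ z in nhds P', (z ∈ V' ↔ g z = 0)) ∧ fderiv ℂ g P' ≠ 0

section ParametricIntegral

variable {X : Type*} [NormedAddCommGroup X] [NormedSpace ℂ X]

theorem exists_bound_changeOrigin (p : FormalMultilinearSeries ℂ X ℂ) (hp : 0 < p.radius) :
    ∃ r : NNReal, 0 < r ∧ (2 * r : ENNReal) < p.radius ∧ ∃ B : ℕ → ℝ,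
      (∀ n, ∀ y : X, ‖y‖ ≤ r → ‖p.changeOrigin y n‖ ≤ B n) ∧
      Summable fun n => B n * (r : ℝ) ^ n := by
  obtain ⟨r2, hr2, hr2'⟩ := ENNReal.lt_iff_exists_nnreal_btwn.1 hp
  have hr2pos : 0 < r2 := by exact_mod_cast hr2
  set r : NNReal := r2 / 2 with hr
  have hrpos : 0 < r := by positivity
  have hlt : (r + r : ENNReal) < p.radius := by
    have : r + r = r2 := by rw [hr]; exact add_halves r2
    calc (r + r : ENNReal) = ((r + r : NNReal) : ENNReal) := by push_cast; rfl
      _ = r2 := by rw [this]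
      _ < _ := hr2'
  have hlt1 : (r : ENNReal) < p.radius := lt_of_le_of_lt (by simp) hlt
  refine ⟨r, hrpos, by rwa [two_mul], fun n =>
    ((∑' s : Σ l : ℕ, { s : Finset (Fin (n + l)) // s.card = l },
      ‖p (n + s.1)‖₊ * r ^ s.1 : NNReal) : ℝ), ?_, ?_⟩
  · intro n y hy
    have hy' : ‖y‖₊ ≤ r := by exact_mod_cast hy
    have h1 := p.nnnorm_changeOrigin_le (x := y) n (lt_of_le_of_lt (by exact_mod_cast hy') hlt1)
    have h2 : (∑' s : Σ l : ℕ, { s : Finset (Fin (n + l)) // s.card = l },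
        ‖p (n + s.1)‖₊ * ‖y‖₊ ^ s.1) ≤ ∑' s : Σ l : ℕ, { s : Finset (Fin (n + l)) // s.card = l },
        ‖p (n + s.1)‖₊ * r ^ s.1 := by
      refine Summable.tsum_le_tsum (fun s => by gcongr) ?_
        (p.changeOriginSeries_summable_aux₂ hlt1 n)
      exact p.changeOriginSeries_summable_aux₂
        (lt_of_le_of_lt (by exact_mod_cast hy') hlt1) n
    exact_mod_cast h1.trans h2
  · have := (NNReal.summable_sigma.1 (p.changeOriginSeries_summable_aux₁ hlt)).2
    simp only [NNReal.tsum_mul_right] at this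
    simpa only [NNReal.coe_mul, NNReal.coe_pow] using NNReal.summable_coe.2 this

theorem analyticAt_integral_local (h : X → ℂ) (x0 : X) (hh : AnalyticAt ℂ h x0) :
    ∃ r : ℝ, 0 < r ∧ ∀ (a b : ℝ) (y : ℝ → X) (g : ℝ → ℂ), Continuous y → Continuous g →
      (∀ θ ∈ Set.uIcc a b, ‖y θ‖ ≤ r) →
      AnalyticAt ℂ (fun v => ∫ θ in a..b, g θ * h (x0 + y θ + v)) 0 := by
  obtain ⟨p, R, hpR⟩ := hh
  have hRp : 0 < R := hpR.r_pos
  obtain ⟨r₁, hr₁, hr₁', B, hB, hBs⟩ := exists_bound_changeOrigin p (hRp.trans_le hpR.r_le)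
  obtain ⟨r2, hr2, hr2'⟩ := ENNReal.lt_iff_exists_nnreal_btwn.1 hRp
  have hr2pos : 0 < r2 := by exact_mod_cast hr2
  set r : NNReal := min r₁ (r2 / 2) with hr
  have hrpos : 0 < r := lt_min hr₁ (by positivity)
  have hr2le : (r : ENNReal) + r ≤ r2 := by
    have : r + r ≤ r2 := by
      calc r + r ≤ r2 / 2 + r2 / 2 := by gcongr <;> exact min_le_right _ _
        _ = r2 := add_halves r2
    exact_mod_cast this
  have hB0 : ∀ n, 0 ≤ B n := fun n => (norm_nonneg _).trans (hB n 0 (by simp))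
  have hBs' : Summable fun n => B n * (r : ℝ) ^ n := by
    refine Summable.of_nonneg_of_le (fun n => by have := hB0 n; positivity) (fun n => ?_) hBs
    have := hB0 n
    gcongr
    exact_mod_cast min_le_left _ _
  refine ⟨r, by exact_mod_cast hrpos, fun a b y g hy hg hyr => ?_⟩
  have hyr' : ∀ θ ∈ Set.uIcc a b, ‖y θ‖ ≤ r₁ := fun θ hθ =>
    (hyr θ hθ).trans (by exact_mod_cast min_le_left _ _)
  obtain ⟨G, hG⟩ := (isCompact_uIcc (a := a) (b := b)).exists_bound_of_continuousOn hg.continuousOn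
  have hcont : ∀ n, ContinuousOn (fun θ => g θ • p.changeOrigin (y θ) n) (Set.uIcc a b) := by
    intro n
    refine hg.continuousOn.smul ?_
    have hf := p.hasFPowerSeriesOnBall_changeOrigin n (hRp.trans_le hpR.r_le)
    refine hf.continuousOn.comp hy.continuousOn fun θ hθ => ?_
    rw [Metric.mem_eball, edist_zero_right]
    refine lt_of_le_of_lt (b := (r₁ : ENNReal)) ?_ (lt_of_le_of_lt ?_ hr₁')
    · have : ‖y θ‖₊ ≤ r₁ := by exact_mod_cast hyr' θ hθ
      rw [enorm_eq_nnnorm]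
      exact_mod_cast this
    · rw [two_mul]; exact le_self_add
  set Q : FormalMultilinearSeries ℂ X ℂ := fun n =>
    ∫ θ in a..b, g θ • p.changeOrigin (y θ) n with hQ
  have hQle : ∀ n, ‖Q n‖ ≤ |G| * B n * |b - a| := by
    intro n
    refine intervalIntegral.norm_integral_le_of_norm_le_const fun θ hθ => ?_
    have hθ' := Set.uIoc_subset_uIcc hθ
    rw [norm_smul]
    gcongr
    · exact (hG θ hθ').trans (le_abs_self _)
    · exact hB n _ (hyr' θ hθ')
  refine ⟨Q, r, ?_, by exact_mod_cast hrpos, ?_⟩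
  · refine FormalMultilinearSeries.le_radius_of_summable _ ?_
    refine Summable.of_nonneg_of_le (fun n => by positivity) (fun n => ?_)
      (hBs'.mul_left (|G| * |b - a|))
    calc ‖Q n‖ * (r : ℝ) ^ n ≤ (|G| * B n * |b - a|) * (r : ℝ) ^ n := by gcongr; exact hQle n
      _ = _ := by ring
  · intro v hv
    have hv' : ‖v‖₊ < r := by
      rw [Metric.mem_eball, edist_zero_right, enorm_eq_nnnorm] at hv
      exact_mod_cast hv
    have key := intervalIntegral.hasSum_integral_of_dominated_convergence (a := a) (b := b)
      (μ := MeasureTheory.volume) (F := fun n θ => g θ * p.changeOrigin (y θ) n (fun _ => v))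
      (f := fun θ => g θ * h (x0 + y θ + v)) (fun n _ => |G| * (B n * (r : ℝ) ^ n)) ?_ ?_ ?_ ?_ ?_
    · convert key using 1
      · ext n
        have := ContinuousLinearMap.intervalIntegral_comp_comm
          (ContinuousMultilinearMap.apply ℂ (fun _ : Fin n => X) ℂ (fun _ => v))
          ((hcont n).intervalIntegrable (μ := MeasureTheory.volume))
        simp only [ContinuousMultilinearMap.apply_apply] at this
        rw [hQ, ← this]
        simp
      · simp
    · intro n
      have : ContinuousOn (fun θ => g θ * p.changeOrigin (y θ) n (fun _ => v)) (Set.uIcc a b) := by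
        have := (ContinuousMultilinearMap.apply ℂ (fun _ : Fin n => X) ℂ
          (fun _ => v)).continuous.comp_continuousOn (hcont n)
        exact this
      exact (this.mono Set.uIoc_subset_uIcc).aestronglyMeasurable measurableSet_uIoc
    · intro n
      refine Filter.Eventually.of_forall fun θ hθ => ?_
      have hθ' := Set.uIoc_subset_uIcc hθ
      rw [norm_mul]
      gcongr
      · exact (hG θ hθ').trans (le_abs_self _)
      · refine (ContinuousMultilinearMap.le_opNorm _ _).trans ?_
        simp only [Finset.prod_const, Finset.card_univ, Fintype.card_fin]
        gcongr
        · exact hB0 n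
        · exact hB n _ (hyr' θ hθ')
        · exact_mod_cast hv'.le
    · exact Filter.Eventually.of_forall fun θ _ => hBs'.mul_left _
    · exact intervalIntegrable_const
    · refine Filter.Eventually.of_forall fun θ hθ => ?_
      have hθ' := Set.uIoc_subset_uIcc hθ
      have hyθ : ‖y θ‖₊ ≤ r := by exact_mod_cast hyr θ hθ'
      have hsum : (‖y θ‖₊ : ENNReal) + ‖v‖₊ < R := by
        calc (‖y θ‖₊ : ENNReal) + ‖v‖₊ ≤ r + r := by
              gcongr
          _ ≤ r2 := hr2le
          _ < R := hr2'
      have h3 := hpR.changeOrigin (y := y θ) (lt_of_le_of_lt le_self_add hsum)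
      refine (h3.hasSum (y := v) ?_).mul_left (g θ)
      rw [Metric.mem_eball, edist_zero_right, enorm_eq_nnnorm]
      exact lt_tsub_iff_left.2 hsum

theorem analyticAt_intervalIntegral {E : Type*} [NormedAddCommGroup E] [NormedSpace ℂ E]
    {Y : Type*} [NormedAddCommGroup Y] [NormedSpace ℂ Y]
    (h : E × Y → ℂ) (z0 : E) (γ : ℝ → Y) (g : ℝ → ℂ) (hγ : Continuous γ) (hg : Continuous g)
    (a b : ℝ) (hab : a ≤ b) (hh : ∀ θ ∈ Set.Icc a b, AnalyticAt ℂ h (z0, γ θ)) :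
    AnalyticAt ℂ (fun z => ∫ θ in a..b, g θ * h (z, γ θ)) z0 := by
  have hloc : ∀ θ₀ ∈ Set.Icc a b, ∃ δ > 0, ∀ c d : ℝ, (∀ θ ∈ Set.uIcc c d, |θ - θ₀| < δ) →
      AnalyticAt ℂ (fun z => ∫ θ in c..d, g θ * h (z, γ θ)) z0 := by
    intro θ₀ hθ₀
    obtain ⟨r, hr, H⟩ := analyticAt_integral_local h (z0, γ θ₀) (hh θ₀ hθ₀)
    obtain ⟨δ, hδ, hδ'⟩ := Metric.continuousAt_iff.1 (hγ.continuousAt (x := θ₀)) r hr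
    refine ⟨δ, hδ, fun c d hcd => ?_⟩
    have h1 := H c d (fun θ => ((0 : E), γ θ - γ θ₀)) g (by fun_prop) hg (fun θ hθ => by
      have := (hδ' (x := θ) (by simpa [Real.dist_eq] using hcd θ hθ)).le
      simpa [Prod.norm_def, dist_eq_norm, hr.le] using this)
    have h2 : AnalyticAt ℂ (fun z : E => ((z - z0, 0) : E × Y)) z0 := by fun_prop
    have h3 := AnalyticAt.comp (x := z0) (f := fun z : E => ((z - z0, 0) : E × Y))
      (g := fun v => ∫ θ in c..d, g θ * h ((z0, γ θ₀) + ((0 : E), γ θ - γ θ₀) + v))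
      (by rw [sub_self, Prod.mk_zero_zero]; exact h1) h2
    refine h3.congr (Filter.Eventually.of_forall fun z => ?_)
    simp
  set s : Set ℝ := {b' | b' ∈ Set.Icc a b ∧
    AnalyticAt ℂ (fun z => ∫ θ in a..b', g θ * h (z, γ θ)) z0} with hs
  have hint : ∀ c ∈ Set.Icc a b, ∀ d ∈ Set.Icc a b, ∀ᶠ z in nhds z0, IntervalIntegrable
      (fun θ => g θ * h (z, γ θ)) MeasureTheory.volume c d := by
    intro c hc d hd
    have : ∀ᶠ z in nhds z0, ∀ θ ∈ Set.Icc a b, AnalyticAt ℂ h (z, γ θ) := by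
      refine (isCompact_Icc (a := a) (b := b)).eventually_forall_of_forall_eventually
        fun θ hθ => ?_
      have h1 := (hh θ hθ).eventually_analyticAt
      have h2 : ContinuousAt (fun w : E × ℝ => (w.1, γ w.2)) (z0, θ) := by fun_prop
      exact h2.eventually h1
    filter_upwards [this] with z hz
    refine ContinuousOn.intervalIntegrable fun θ hθ => ?_
    have hθ' : θ ∈ Set.Icc a b := Set.uIcc_subset_Icc hc hd hθ
    have h2 : ContinuousAt (fun θ : ℝ => (z, γ θ)) θ := by fun_prop
    exact (hg.continuousAt.mul (ContinuousAt.comp (f := fun θ : ℝ => (z, γ θ))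
      (hz θ hθ').continuousAt h2)).continuousWithinAt
  have hadd : ∀ c ∈ Set.Icc a b, ∀ d ∈ Set.Icc a b,
      AnalyticAt ℂ (fun z => ∫ θ in a..c, g θ * h (z, γ θ)) z0 →
      AnalyticAt ℂ (fun z => ∫ θ in c..d, g θ * h (z, γ θ)) z0 →
      AnalyticAt ℂ (fun z => ∫ θ in a..d, g θ * h (z, γ θ)) z0 := by
    intro c hc d hd h1 h2
    refine (h1.add h2).congr ?_
    filter_upwards [hint a (Set.left_mem_Icc.2 hab) c hc, hint c hc d hd] with z hz1 hz2
    exact intervalIntegral.integral_add_adjacent_intervals hz1 hz2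
  have hsub : Set.Icc a b ⊆ s := by
    refine IsClosed.Icc_subset_of_forall_exists_gt ?_ ?_ ?_
    · rw [← isSeqClosed_iff_isClosed]
      intro u x hu hux
      have hx : x ∈ Set.Icc a b := isClosed_Icc.isSeqClosed (fun n => (hu n).2) hux
      obtain ⟨δ, hδ, H⟩ := hloc x hx
      obtain ⟨n, hn⟩ := ((Metric.tendsto_nhds.1 hux) δ hδ).exists
      rw [Real.dist_eq] at hn
      refine ⟨⟨hx, hadd (u n) (hu n).2 x hx (hu n).1.2 (H _ _ fun θ hθ => ?_)⟩, hx⟩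
      have h1 := Set.abs_sub_right_of_mem_uIcc hθ
      rw [abs_sub_comm] at h1
      exact h1.trans_lt (by rwa [abs_sub_comm])
    · refine ⟨Set.left_mem_Icc.2 hab, ?_⟩
      simp only [intervalIntegral.integral_same]
      exact analyticAt_const
    · intro x hx y hy
      have hx' : x ∈ Set.Icc a b := Set.Ico_subset_Icc_self hx.2
      obtain ⟨δ, hδ, H⟩ := hloc x hx'
      have hxb := hx.2.2
      have hxy : x < y := hy
      obtain ⟨m, hm1, hm2⟩ := exists_between (show x < min (x + δ) (min y b) by
        simp [hδ, hxy, hxb])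
      simp only [lt_min_iff] at hm2
      have hm : m ∈ Set.Icc a b := ⟨hx'.1.trans hm1.le, hm2.2.2.le⟩
      refine ⟨m, ⟨hm, hadd x hx' m hm hx.1.2 (H _ _ fun θ hθ => ?_)⟩, hm1, hm2.2.1.le⟩
      rw [Set.uIcc_of_le hm1.le] at hθ
      rw [abs_of_nonneg (by linarith [hθ.1])]
      linarith [hθ.2]
  exact (hsub (Set.right_mem_Icc.2 hab)).2

theorem analyticAt_circleIntegral {E : Type*} [NormedAddCommGroup E] [NormedSpace ℂ E]
    (h : E × ℂ → ℂ) (z0 : E) (c : ℂ) (r : ℝ)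
    (hh : ∀ ζ : ℂ, ‖ζ - c‖ = |r| → AnalyticAt ℂ h (z0, ζ)) :
    AnalyticAt ℂ (fun z => ∮ ζ in C(c, r), h (z, ζ)) z0 := by
  have := analyticAt_intervalIntegral h z0 (circleMap c r) (fun θ => deriv (circleMap c r) θ)
    (continuous_circleMap c r) (by simp only [deriv_circleMap]; fun_prop) 0 (2 * Real.pi)
    (by positivity) (fun θ _ => hh _ (by simp [circleMap]))
  simpa [circleIntegral] using this

end ParametricIntegral

section AnalyticBase

variable {E : Type*} [NormedAddCommGroup E] [NormedSpace ℂ E]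

@[fun_prop]
theorem AnalyticAt.fun_fst {X Y Z : Type*} [NormedAddCommGroup X] [NormedSpace ℂ X]
    [NormedAddCommGroup Y] [NormedSpace ℂ Y] [NormedAddCommGroup Z] [NormedSpace ℂ Z]
    {f : X → Y × Z} {x : X} (hf : AnalyticAt ℂ f x) : AnalyticAt ℂ (fun z => (f z).1) x :=
  AnalyticAt.comp (g := Prod.fst) analyticAt_fst hf

@[fun_prop]
theorem AnalyticAt.fun_snd {X Y Z : Type*} [NormedAddCommGroup X] [NormedSpace ℂ X]
    [NormedAddCommGroup Y] [NormedSpace ℂ Y] [NormedAddCommGroup Z] [NormedSpace ℂ Z]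
    {f : X → Y × Z} {x : X} (hf : AnalyticAt ℂ f x) : AnalyticAt ℂ (fun z => (f z).2) x :=
  AnalyticAt.comp (g := Prod.snd) analyticAt_snd hf

theorem eventually_prod_nhds_zero_iff {Y : Type*} [NormedAddCommGroup Y] {P : E × Y → Prop} :
    (∀ᶠ p in nhds (0 : E × Y), P p) ↔
      ∃ r : ℝ, 0 < r ∧ ∀ t x, ‖t‖ < r → ‖x‖ < r → P (t, x) := by
  rw [Metric.eventually_nhds_iff]
  simp only [dist_zero_right, Prod.norm_def, max_lt_iff, Prod.forall]
  exact ⟨fun ⟨r, hr, h⟩ => ⟨r, hr, fun t x h1 h2 => h t x ⟨h1, h2⟩⟩,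
    fun ⟨r, hr, h⟩ => ⟨r, hr, fun t x h1 => h t x h1.1 h1.2⟩⟩

theorem differentiableOn_slice {f : E × ℂ → ℂ} {t : E} {s : Set ℂ}
    (h : ∀ x ∈ s, AnalyticAt ℂ f (t, x)) : DifferentiableOn ℂ (fun x => f (t, x)) s := fun x hx =>
  ((h x hx).comp (f := fun x : ℂ => (t, x)) (by fun_prop)).differentiableAt.differentiableWithinAt

/-- Riemann's removable singularity theorem along a hyperplane. -/
theorem exists_analyticAt_of_bounded {f : E × ℂ → ℂ} {B : ℝ}
    (hf : ∀ᶠ p in nhds (0 : E × ℂ), p.2 ≠ 0 → AnalyticAt ℂ f p)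
    (hB : ∀ᶠ p in nhds (0 : E × ℂ), p.2 ≠ 0 → ‖f p‖ ≤ B) :
    ∃ g, AnalyticAt ℂ g (0 : E × ℂ) ∧ ∀ᶠ p in nhds (0 : E × ℂ), p.2 ≠ 0 → g p = f p := by
  obtain ⟨R, hR, H⟩ := eventually_prod_nhds_zero_iff.1 (hf.and hB)
  set r := R / 2 with hr
  have hr0 : 0 < r := by positivity
  have hrR : r < R := by rw [hr]; linarith
  refine ⟨fun p => (2 * Real.pi * Complex.I)⁻¹ *
    ∮ ζ in C(0, r), (ζ - p.2)⁻¹ * f (p.1, ζ), ?_, ?_⟩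
  · refine analyticAt_const.mul ?_
    refine analyticAt_circleIntegral (fun w : (E × ℂ) × ℂ => (w.2 - w.1.2)⁻¹ * f (w.1.1, w.2))
      (0 : E × ℂ) 0 r fun ζ hζ => ?_
    rw [sub_zero, abs_of_pos hr0] at hζ
    have hζ0 : ζ ≠ 0 := by rintro rfl; simp at hζ; linarith
    have h1 : AnalyticAt ℂ f ((fun w : (E × ℂ) × ℂ => (w.1.1, w.2)) ((0 : E × ℂ), ζ)) :=
      (H 0 ζ (by simpa using hR) (by rw [hζ]; exact hrR)).1 hζ0
    refine AnalyticAt.mul (AnalyticAt.inv (by fun_prop) (by simpa using hζ0))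
      (h1.comp (f := fun w : (E × ℂ) × ℂ => (w.1.1, w.2)) (by fun_prop))
  · refine eventually_prod_nhds_zero_iff.2 ⟨r, hr0, fun t x ht hx hx0 => ?_⟩
    have hd : DifferentiableOn ℂ (fun x => f (t, x)) (Metric.ball 0 R \ {0}) :=
      differentiableOn_slice fun y hy => (H t y (ht.trans hrR) (by simpa using hy.1)).1 hy.2
    have hd2 := Complex.differentiableOn_update_limUnder_of_bddAbove
      (Metric.ball_mem_nhds (0 : ℂ) hR) hd ⟨B, by
        rintro _ ⟨y, hy, rfl⟩
        exact (H t y (ht.trans hrR) (by simpa using hy.1)).2 hy.2⟩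
    have h3 := DifferentiableOn.circleIntegral_sub_inv_smul (R := r) (c := 0) (w := x)
      (hd2.mono (Metric.closedBall_subset_ball hrR)) (by simpa using hx)
    rw [Function.update_of_ne hx0] at h3
    have h4 : (∮ ζ in C(0, r), (ζ - x)⁻¹ * f (t, ζ)) = (2 * Real.pi * Complex.I) * f (t, x) := by
      rw [← smul_eq_mul, ← h3]
      refine circleIntegral.integral_congr hr0.le fun ζ hζ => ?_
      have hζ0 : ζ ≠ 0 := by rintro rfl; simp at hζ; linarith
      simp [Function.update_of_ne hζ0]
    simp only
    rw [h4, inv_mul_cancel_left₀]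
    simp [Real.pi_ne_zero]

theorem eventuallyEq_of_eventuallyEq_off {f g : E × ℂ → ℂ} (hf : ∀ᶠ p in nhds (0 : E × ℂ),
      ContinuousAt f p)
    (hg : ∀ᶠ p in nhds (0 : E × ℂ), ContinuousAt g p)
    (h : ∀ᶠ p in nhds (0 : E × ℂ), p.2 ≠ 0 → f p = g p) : f =ᶠ[nhds 0] g := by
  filter_upwards [hf, hg, h.eventually_nhds] with p h1 h2 h3
  by_contra hne
  have : ∀ᶠ z in nhds p, f z ≠ g z :=
    (ContinuousAt.ne_iff_eventually_ne h1 h2).1 hne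
  have h4 : ∀ᶠ z in nhds p, z.2 = 0 := by
    filter_upwards [h3, this] with z hz hz'
    by_contra hz0
    exact hz' (hz hz0)
  have h5 : Filter.Tendsto (fun x : ℂ => (p.1, p.2 + x)) (nhds 0) (nhds p) := by
    have : Continuous (fun x : ℂ => (p.1, p.2 + x)) := by fun_prop
    simpa using this.tendsto 0
  have h6 := h5.eventually h4
  simp only at h6
  have h7 : ∀ᶠ x : ℂ in nhdsWithin 0 {0}ᶜ, p.2 + x = 0 := h6.filter_mono nhdsWithin_le_nhds
  have h8 : p.2 = 0 := by simpa using h4.self_of_nhds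
  obtain ⟨x, hx, hx'⟩ := (h7.and self_mem_nhdsWithin).exists
  simp [h8] at hx
  exact hx' hx

theorem AnalyticAt.eventuallyEq_of_off {f g : E × ℂ → ℂ} (hf : AnalyticAt ℂ f 0)
    (hg : AnalyticAt ℂ g 0) (h : ∀ᶠ p in nhds (0 : E × ℂ), p.2 ≠ 0 → f p = g p) :
    f =ᶠ[nhds 0] g :=
  eventuallyEq_of_eventuallyEq_off (hf.eventually_analyticAt.mono fun _ h => h.continuousAt)
    (hg.eventually_analyticAt.mono fun _ h => h.continuousAt) h

theorem tendsto_prodMk_zero {Y : Type*} [NormedAddCommGroup Y] :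
    Filter.Tendsto (fun t : E => ((t, 0) : E × Y)) (nhds 0) (nhds 0) := by
  have : Continuous (fun t : E => ((t, 0) : E × Y)) := by fun_prop
  exact this.tendsto' 0 0 rfl

/-- An analytic function vanishing on a hyperplane is divisible by its equation. -/
theorem AnalyticAt.exists_eq_snd_mul {f : E × ℂ → ℂ} (hf : AnalyticAt ℂ f 0)
    (h0 : ∀ᶠ t in nhds (0 : E), f (t, 0) = 0) :
    ∃ g, AnalyticAt ℂ g (0 : E × ℂ) ∧ ∀ᶠ p in nhds (0 : E × ℂ), f p = p.2 * g p := by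
  obtain ⟨K, s, hs, hL⟩ := (hf.contDiffAt (n := 1)).exists_lipschitzOnWith
  obtain ⟨r, hr, H⟩ := eventually_prod_nhds_zero_iff.1
    (show ∀ᶠ p in nhds (0 : E × ℂ), p ∈ s from hs)
  have h0' : ∀ᶠ p in nhds (0 : E × ℂ), f (p.1, 0) = 0 :=
    (continuous_fst.tendsto (0 : E × ℂ)).eventually h0
  have hB : ∀ᶠ p in nhds (0 : E × ℂ), p.2 ≠ 0 → ‖f p / p.2‖ ≤ K := by
    filter_upwards [h0', eventually_prod_nhds_zero_iff.2 ⟨r, hr, H⟩,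
      (eventually_prod_nhds_zero_iff (P := fun p : E × ℂ => (p.1, (0 : ℂ)) ∈ s)).2
        ⟨r, hr, fun t x ht hx => H t 0 ht (by simpa using hr)⟩]
      with p hp h1 h2 hp0
    have := hL.dist_le_mul p h1 (p.1, 0) h2
    rw [dist_eq_norm, hp, sub_zero, dist_eq_norm] at this
    rw [norm_div, div_le_iff₀ (by simpa using hp0)]
    simpa [Prod.norm_def] using this
  obtain ⟨g, hg, hg'⟩ := exists_analyticAt_of_bounded (f := fun p => f p / p.2)
    (hf.eventually_analyticAt.mono fun p hp hp0 => hp.div analyticAt_snd hp0) hB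
  refine ⟨g, hg, hf.eventuallyEq_of_off (by fun_prop) ?_⟩
  filter_upwards [hg'] with p hp hp0
  rw [hp hp0, mul_div_cancel₀ _ hp0]

/-- Persistence of zeros (Hurwitz). -/
theorem AnalyticAt.eventually_exists_zero {h : E × ℂ → ℂ} (hh : AnalyticAt ℂ h 0) (h0 : h 0 = 0)
    (hne : ¬ ∀ᶠ s in nhds (0 : ℂ), h (0, s) = 0) {r : ℝ} (hr : 0 < r) :
    ∀ᶠ t in nhds (0 : E), ∃ s : ℂ, ‖s‖ < r ∧ h (t, s) = 0 := by
  have ha : AnalyticAt ℂ (fun s : ℂ => h (0, s)) 0 :=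
    AnalyticAt.comp (f := fun s : ℂ => ((0 : E), s)) (x := 0) hh (by fun_prop)
  have h1 := (ha.eventually_eq_zero_or_eventually_ne_zero).resolve_left hne
  rw [eventually_nhdsWithin_iff, Metric.eventually_nhds_iff] at h1
  obtain ⟨r1, hr1, h1⟩ := h1
  obtain ⟨r2, hr2, h2⟩ := eventually_prod_nhds_zero_iff.1 hh.eventually_analyticAt
  obtain ⟨ρ, hρ, hρ'⟩ := exists_between (show 0 < min r (min r1 r2) by positivity)
  simp only [lt_min_iff] at hρ'
  have hcs : IsCompact (Metric.sphere (0 : ℂ) ρ) := isCompact_sphere _ _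
  have hcont : ContinuousOn (fun s : ℂ => ‖h (0, s)‖) (Metric.sphere (0 : ℂ) ρ) :=
    ((differentiableOn_slice fun x hx => h2 0 x (by simpa using hr2) (by
      rw [mem_sphere_zero_iff_norm.1 hx]; exact hρ'.2.2)).continuousOn).norm
  obtain ⟨s0, hs0, hmin⟩ := hcs.exists_isMinOn (NormedSpace.sphere_nonempty.2 hρ.le) hcont
  set m := ‖h (0, s0)‖ with hm
  have hm0 : 0 < m := by
    rw [hm, norm_pos_iff]
    rw [mem_sphere_zero_iff_norm] at hs0
    exact h1 (by rw [dist_zero_right, hs0]; exact hρ'.2.1) (by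
      rintro (rfl : s0 = 0); simp at hs0; linarith)
  have hev1 : ∀ᶠ t in nhds (0 : E), ∀ s ∈ Metric.sphere (0 : ℂ) ρ, m / 2 < ‖h (t, s)‖ := by
    refine hcs.eventually_forall_of_forall_eventually fun s hs => ?_
    have hc : ContinuousAt (fun p => ‖h p‖) ((0 : E), s) := (h2 0 s (by simpa using hr2) (by
      rw [mem_sphere_zero_iff_norm.1 hs]; exact hρ'.2.2)).continuousAt.norm
    have hms : m / 2 < ‖h (0, s)‖ := by
      have : m ≤ ‖h (0, s)‖ := hmin hs
      linarith
    exact hc.eventually (lt_mem_nhds hms)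
  have hev2 : ∀ᶠ t in nhds (0 : E), ‖h (t, 0)‖ < m / 2 := by
    have hc : ContinuousAt (fun t => ‖h (t, 0)‖) (0 : E) :=
      (ContinuousAt.comp (f := fun t : E => (t, (0 : ℂ))) (x := 0) hh.continuousAt
        (by fun_prop)).norm
    refine hc.eventually (gt_mem_nhds ?_)
    have : h (0, 0) = 0 := h0
    simp only [this]; simpa using hm0
  filter_upwards [hev1, hev2, Metric.ball_mem_nhds (0 : E) hr2] with t ht1 ht2 ht3
  by_contra hcon
  push Not at hcon
  have hnz : ∀ s ∈ Metric.closedBall (0 : ℂ) ρ, h (t, s) ≠ 0 := fun s hs =>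
    hcon s ((mem_closedBall_zero_iff.1 hs).trans_lt hρ'.1)
  have hd : DifferentiableOn ℂ (fun s => (h (t, s))⁻¹) (Metric.closedBall (0 : ℂ) ρ) :=
    (differentiableOn_slice fun x hx => h2 t x (by simpa using ht3)
      ((mem_closedBall_zero_iff.1 hx).trans_lt hρ'.2.2)).inv hnz
  have hbd := Complex.norm_le_of_forall_mem_frontier_norm_le (U := Metric.ball (0 : ℂ) ρ)
    Metric.isBounded_ball (hd.diffContOnCl_ball Subset.rfl) (C := 2 / m) (fun z hz => by
      rw [frontier_ball _ hρ.ne'] at hz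
      rw [norm_inv, inv_le_comm₀ (by linarith [ht1 z hz]) (by positivity)]
      have := ht1 z hz
      rw [inv_div]; exact this.le) (z := 0) (subset_closure (by simpa using hρ))
  have h00 : h (t, 0) ≠ 0 := hnz 0 (by simpa using hρ.le)
  rw [norm_inv, inv_le_comm₀ (norm_pos_iff.2 h00) (by positivity), inv_div] at hbd
  linarith

/-- A function whose zeros lie on a hyperplane is a power of its equation times a unit. -/
theorem AnalyticAt.exists_eq_pow_mul_unit {f : E × ℂ → ℂ} (hf : AnalyticAt ℂ f 0)
    (hne : ∀ᶠ p in nhds (0 : E × ℂ), p.2 ≠ 0 → f p ≠ 0) :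
    ∃ (k : ℕ) (u : E × ℂ → ℂ), AnalyticAt ℂ u 0 ∧ u 0 ≠ 0 ∧
      ∀ᶠ p in nhds (0 : E × ℂ), f p = p.2 ^ k * u p := by
  have hs : Filter.Tendsto (fun x : ℂ => ((0 : E), x)) (nhds 0) (nhds 0) := by
    have : Continuous (fun x : ℂ => ((0 : E), x)) := by fun_prop
    exact this.tendsto' 0 0 rfl
  have hnz : ∀ {f : E × ℂ → ℂ}, (∀ᶠ p in nhds (0 : E × ℂ), p.2 ≠ 0 → f p ≠ 0) →
      ¬ ∀ᶠ s in nhds (0 : ℂ), f (0, s) = 0 := by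
    intro f hne hz
    have h1 := (hz.and (hs.eventually hne)).filter_mono
      (nhdsWithin_le_nhds (s := ({0}ᶜ : Set ℂ)))
    obtain ⟨x, hx, hx'⟩ := (h1.and self_mem_nhdsWithin).exists
    exact hx.2 hx' hx.1
  have key : ∀ (n : ℕ) (f : E × ℂ → ℂ), AnalyticAt ℂ f 0 →
      (∀ᶠ p in nhds (0 : E × ℂ), p.2 ≠ 0 → f p ≠ 0) →
      (∃ g : ℂ → ℂ, AnalyticAt ℂ g 0 ∧ g 0 ≠ 0 ∧ ∀ᶠ s in nhds (0 : ℂ), f (0, s) = s ^ n * g s) →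
      ∃ (k : ℕ) (u : E × ℂ → ℂ), AnalyticAt ℂ u 0 ∧ u 0 ≠ 0 ∧
      ∀ᶠ p in nhds (0 : E × ℂ), f p = p.2 ^ k * u p := by
    intro n
    induction n with
    | zero =>
      rintro f hf hne ⟨g, hg, hg0, hfg⟩
      refine ⟨0, f, hf, ?_, by simp⟩
      have := hfg.self_of_nhds
      rw [pow_zero, one_mul] at this
      change f (0, 0) ≠ 0
      rwa [this]
    | succ n ih =>
      rintro f hf hne ⟨g, hg, hg0, hfg⟩
      have hf0 : f 0 = 0 := by
        have : f (0, 0) = 0 := by simpa using hfg.self_of_nhds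
        exact this
      obtain ⟨r, hr, hr'⟩ := eventually_prod_nhds_zero_iff.1 hne
      have hz : ∀ᶠ t in nhds (0 : E), f (t, 0) = 0 := by
        filter_upwards [hf.eventually_exists_zero hf0 (hnz hne) hr, Metric.ball_mem_nhds _ hr]
          with t ⟨s, hs, hs'⟩ ht
        by_cases h : s = 0
        · rwa [h] at hs'
        · exact absurd hs' (hr' t s (by simpa using ht) hs h)
      obtain ⟨f1, hf1, hff1⟩ := hf.exists_eq_snd_mul hz
      obtain ⟨k, u, hu, hu0, hfu⟩ := ih f1 hf1 (by
        filter_upwards [hne, hff1] with p h1 h2 h3 h4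
        exact h1 h3 (by rw [h2, h4, mul_zero])) ⟨g, hg, hg0, by
          have ha : AnalyticAt ℂ (fun s : ℂ => f1 (0, s)) 0 :=
            AnalyticAt.comp (f := fun s : ℂ => ((0 : E), s)) (x := 0) hf1 (by fun_prop)
          have hb : AnalyticAt ℂ (fun s : ℂ => s ^ n * g s) 0 := by fun_prop
          refine (ha.frequently_eq_iff_eventually_eq hb).1 ?_
          refine Filter.Eventually.frequently ?_
          rw [eventually_nhdsWithin_iff]
          filter_upwards [hfg, hs.eventually hff1] with s h1 h2 h3
          have h3' : s ≠ 0 := h3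
          rw [h1] at h2
          refine mul_left_cancel₀ h3' ?_
          rw [← h2]; ring⟩
      refine ⟨k + 1, u, hu, hu0, ?_⟩
      filter_upwards [hfu, hff1] with p h1 h2
      rw [h2, h1]; ring
  have ha : AnalyticAt ℂ (fun s : ℂ => f (0, s)) 0 :=
    AnalyticAt.comp (f := fun s : ℂ => ((0 : E), s)) (x := 0) hf (by fun_prop)
  obtain ⟨n, g, hg, hg0, hfg⟩ := ha.exists_eventuallyEq_pow_smul_nonzero_iff.2 (hnz hne)
  exact key n f hf hne ⟨g, hg, hg0, by simpa using hfg⟩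

/-- Analytic roots of units. -/
theorem AnalyticAt.exists_pow_eq {X : Type*} [NormedAddCommGroup X] [NormedSpace ℂ X]
    {u : X → ℂ} {x : X} (hu : AnalyticAt ℂ u x) (h0 : u x ≠ 0) {n : ℕ} (hn : 0 < n) :
    ∃ v, AnalyticAt ℂ v x ∧ v x ≠ 0 ∧ ∀ z, v z ^ n = u z := by
  obtain ⟨c, hc⟩ := IsAlgClosed.exists_pow_nat_eq (u x) hn
  refine ⟨fun z => c * (u z / u x) ^ ((1 : ℂ) / n), ?_, ?_, fun z => ?_⟩
  · refine analyticAt_const.mul (AnalyticAt.cpow (hu.div analyticAt_const h0) analyticAt_const ?_)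
    rw [div_self h0]
    exact Complex.one_mem_slitPlane
  · simp only [div_self h0, Complex.one_cpow, mul_one]
    rintro rfl
    exact h0 (by rw [← hc, zero_pow hn.ne'])
  · rw [mul_pow, hc, one_div, Complex.cpow_nat_inv_pow _ hn.ne', mul_div_cancel₀ _ h0]

end AnalyticBase

section InverseFunction

theorem AnalyticAt.exists_inverse {X Y : Type*} [NormedAddCommGroup X] [NormedSpace ℂ X]
    [NormedAddCommGroup Y] [NormedSpace ℂ Y] [CompleteSpace X] {f : X → Y} {x : X}
    (hf : AnalyticAt ℂ f x) (i : X ≃L[ℂ] Y) (hi : fderiv ℂ f x = i) :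
    ∃ g : Y → X, AnalyticAt ℂ g (f x) ∧ g (f x) = x ∧ (∀ᶠ z in nhds x, g (f z) = z) ∧
      ∀ᶠ w in nhds (f x), f (g w) = w := by
  have h : HasStrictFDerivAt f (i : X →L[ℂ] Y) x := hi ▸ hf.hasStrictFDerivAt
  set R := h.toOpenPartialHomeomorph f with hR
  have hx : x ∈ R.source := h.mem_toOpenPartialHomeomorph_source
  refine ⟨R.symm, ?_, ?_, ?_, ?_⟩
  · exact R.analyticAt_symm' (a := x) (i := i) hx hf hi
  · exact R.left_inv hx
  · exact R.eventually_left_inverse hx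
  · exact R.eventually_right_inverse (R.map_source hx)

theorem AnalyticAt.exists_inverse_of_injective {X Y : Type*} [NormedAddCommGroup X]
    [NormedSpace ℂ X] [NormedAddCommGroup Y] [NormedSpace ℂ Y] [FiniteDimensional ℂ X]
    [FiniteDimensional ℂ Y] {f : X → Y} {x : X}
    (hf : AnalyticAt ℂ f x) (hd : Module.finrank ℂ X = Module.finrank ℂ Y)
    (hi : ∀ v, fderiv ℂ f x v = 0 → v = 0) :
    ∃ g : Y → X, AnalyticAt ℂ g (f x) ∧ g (f x) = x ∧ (∀ᶠ z in nhds x, g (f z) = z) ∧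
      ∀ᶠ w in nhds (f x), f (g w) = w := by
  have := FiniteDimensional.complete ℂ X
  have hinj : Function.Injective (fderiv ℂ f x : X →ₗ[ℂ] Y) :=
    (injective_iff_map_eq_zero _).2 hi
  set e := (LinearEquiv.ofInjectiveOfFinrankEq (fderiv ℂ f x : X →ₗ[ℂ] Y) hinj hd) with he
  exact hf.exists_inverse e.toContinuousLinearEquiv (by ext v; rfl)

variable {E : Type*} [NormedAddCommGroup E] [NormedSpace ℂ E] [FiniteDimensional ℂ E]

theorem AnalyticAt.exists_inverse_left {T : E × ℂ → E} (hT : AnalyticAt ℂ T 0) (h0 : T 0 = 0)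
    (hi : ∀ v, fderiv ℂ T 0 (v, 0) = 0 → v = 0) :
    ∃ θ : E × ℂ → E, AnalyticAt ℂ θ 0 ∧ θ 0 = 0 ∧
      (∀ᶠ p in nhds (0 : E × ℂ), T (θ p, p.2) = p.1) ∧
      ∀ᶠ p in nhds (0 : E × ℂ), θ (T p, p.2) = p.1 := by
  have hG : AnalyticAt ℂ (fun p : E × ℂ => (T p, p.2)) 0 := by fun_prop
  have hd : fderiv ℂ (fun p : E × ℂ => (T p, p.2)) 0 =
      (fderiv ℂ T 0).prod (ContinuousLinearMap.snd ℂ E ℂ) :=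
    (hT.differentiableAt.hasFDerivAt.prodMk hasFDerivAt_snd).fderiv
  obtain ⟨g, hg, hg0, h1, h2⟩ := hG.exists_inverse_of_injective rfl (by
    rw [hd]
    rintro ⟨v, s⟩ hv
    simp only [ContinuousLinearMap.prod_apply, ContinuousLinearMap.coe_snd', Prod.mk_eq_zero] at hv
    obtain ⟨hv1, rfl⟩ := hv
    rw [hi v hv1]; rfl)
  have e : (T 0, (0 : E × ℂ).2) = (0 : E × ℂ) := by rw [h0]; rfl
  rw [e] at hg h2 hg0
  refine ⟨fun p => (g p).1, by fun_prop, by simp [hg0], ?_, ?_⟩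
  · filter_upwards [h2] with p hp
    have h3 : (g p).2 = p.2 := (Prod.ext_iff.1 hp).2
    have h4 : T (g p) = p.1 := (Prod.ext_iff.1 hp).1
    rw [← h3]; exact h4
  · filter_upwards [h1] with p hp
    rw [hp]

theorem AnalyticAt.exists_inverse_mul {v : E × ℂ → ℂ} (hv : AnalyticAt ℂ v 0) (h0 : v 0 ≠ 0) :
    ∃ θ : E × ℂ → ℂ, AnalyticAt ℂ θ 0 ∧ θ 0 = 0 ∧
      (∀ᶠ p in nhds (0 : E × ℂ), θ p * v (p.1, θ p) = p.2) ∧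
      (∀ᶠ p in nhds (0 : E × ℂ), θ (p.1, p.2 * v p) = p.2) ∧
      (∀ᶠ p in nhds (0 : E × ℂ), (θ p = 0 ↔ p.2 = 0)) := by
  have hG : AnalyticAt ℂ (fun p : E × ℂ => (p.1, p.2 * v p)) 0 := by fun_prop
  have hd : fderiv ℂ (fun p : E × ℂ => (p.1, p.2 * v p)) 0 =
      (ContinuousLinearMap.fst ℂ E ℂ).prod (v 0 • ContinuousLinearMap.snd ℂ E ℂ) := by
    have := (hasFDerivAt_fst (𝕜 := ℂ) (p := (0 : E × ℂ))).prodMk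
      ((hasFDerivAt_snd (𝕜 := ℂ) (p := (0 : E × ℂ))).mul hv.differentiableAt.hasFDerivAt)
    exact HasFDerivAt.fderiv (this.congr_fderiv (by ext <;> simp))
  obtain ⟨g, hg, hg0, h1, h2⟩ := hG.exists_inverse_of_injective rfl (by
    rw [hd]
    rintro ⟨v, s⟩ hv
    simp only [ContinuousLinearMap.prod_apply, ContinuousLinearMap.coe_fst', Prod.mk_eq_zero,
      smul_apply, ContinuousLinearMap.coe_snd', smul_eq_mul, mul_eq_zero, h0,
      false_or] at hv
    rw [hv.1, hv.2]; rfl)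
  have e : ((0 : E × ℂ).1, (0 : E × ℂ).2 * v 0) = (0 : E × ℂ) := by simp
  rw [e] at hg h2 hg0
  have h3 : ∀ᶠ p in nhds (0 : E × ℂ), (g p).2 * v (p.1, (g p).2) = p.2 := by
    filter_upwards [h2] with p hp
    have h3 : (g p).1 = p.1 := (Prod.ext_iff.1 hp).1
    have h4 : (g p).2 * v (g p) = p.2 := (Prod.ext_iff.1 hp).2
    rw [← h3]; exact h4
  have h4 : ∀ᶠ p in nhds (0 : E × ℂ), (g (p.1, p.2 * v p)).2 = p.2 := by
    filter_upwards [h1] with p hp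
    rw [hp]
  have h5 : ∀ᶠ p in nhds (0 : E × ℂ), (g (p.1, 0)).2 = 0 := by
    have hc : Filter.Tendsto (fun p : E × ℂ => (p.1, (0 : ℂ))) (nhds 0) (nhds 0) := by
      have : Continuous (fun p : E × ℂ => (p.1, (0 : ℂ))) := by fun_prop
      exact this.tendsto' 0 0 rfl
    filter_upwards [hc.eventually h4] with p hp
    simpa using hp
  refine ⟨fun p => (g p).2, by fun_prop, by simp [hg0], h3, h4, ?_⟩
  filter_upwards [h3, h5] with p h3 h5
  refine ⟨fun h => ?_, fun h => ?_⟩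
  · rw [← h3, h, zero_mul]
  · have : p = (p.1, 0) := by rw [← h]
    rw [this]; exact h5

end InverseFunction

section Discriminant

/-- The product of squared differences of the entries of a list. -/
noncomputable def listDisc : List ℂ → ℂ
  | [] => 1
  | a :: l => (l.map fun b => (b - a) ^ 2).prod * listDisc l

theorem listDisc_perm {l l' : List ℂ} (h : l.Perm l') : listDisc l = listDisc l' := by
  induction h with
  | nil => rfl
  | cons a h ih => simp only [listDisc, ih, (h.map _).prod_eq]
  | swap a b l =>
    simp only [listDisc, List.map_cons, List.prod_cons]
    ring
  | trans _ _ h1 h2 => rw [h1, h2]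

theorem listDisc_ne_zero_iff {l : List ℂ} : listDisc l ≠ 0 ↔ l.Nodup := by
  induction l with
  | nil => simp [listDisc]
  | cons a l ih =>
    rw [listDisc, mul_ne_zero_iff, ih, List.nodup_cons]
    refine and_congr_left fun _ => ?_
    rw [Ne, List.prod_eq_zero_iff]
    simp [sub_eq_zero]

theorem prod_map_eq_prod_range (l : List ℂ) (f : ℂ → ℂ) :
    (l.map f).prod = ∏ i ∈ Finset.range l.length, f (l.getD i 0) := by
  induction l with
  | nil => simp
  | cons a l ih => simp [Finset.prod_range_succ', ih, mul_comm]

theorem listDisc_eq_prod (l : List ℂ) :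
    listDisc l = ∏ j ∈ Finset.range l.length, ∏ i ∈ Finset.range j,
      (l.getD j 0 - l.getD i 0) ^ 2 := by
  induction l with
  | nil => simp [listDisc]
  | cons a l ih =>
    rw [listDisc, ih, List.length_cons, Finset.prod_range_succ']
    simp only [Finset.prod_range_succ', List.getD_cons_succ, List.getD_cons_zero,
      Finset.prod_mul_distrib, Finset.range_zero, Finset.prod_empty, mul_one]
    rw [mul_comm]
    congr 1
    exact prod_map_eq_prod_range l fun b => (b - a) ^ 2

theorem polyDisc_eq (p : Polynomial ℂ) : polyDisc p = listDisc p.roots.toList := by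
  rw [polyDisc, listDisc_eq_prod, Finset.prod_filter, Finset.prod_product, Finset.prod_comm]
  refine Finset.prod_congr rfl fun j hj => ?_
  rw [← Finset.prod_filter]
  refine Finset.prod_congr ?_ fun _ _ => rfl
  ext i
  simp only [Finset.mem_filter, Finset.mem_range] at hj ⊢
  exact ⟨fun h => h.2, fun h => ⟨h.trans hj, h⟩⟩

theorem polyDisc_ne_zero_iff {p : Polynomial ℂ} : polyDisc p ≠ 0 ↔ p.roots.Nodup := by
  rw [polyDisc_eq, listDisc_ne_zero_iff, ← Multiset.coe_nodup, Multiset.coe_toList]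

theorem polyDisc_prod {d : ℕ} (ξ : Fin d → ℂ) :
    polyDisc (∏ i, (X - C (ξ i))) = listDisc (List.ofFn ξ) := by
  rw [polyDisc_eq]
  refine listDisc_perm ?_
  rw [← Multiset.coe_eq_coe, Multiset.coe_toList]
  have : (∏ i, (X - C (ξ i))) = ((Finset.univ.val.map ξ).map fun a => X - C a).prod := by
    rw [Multiset.map_map]; rfl
  rw [this, Polynomial.roots_multiset_prod_X_sub_C]
  simp [List.ofFn_eq_map]

theorem mkPoly_coeff {d : ℕ} {p : Polynomial ℂ} (hp : p.Monic) (hd : p.natDegree = d) :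
    mkPoly d (fun i => p.coeff (d - (i.val + 1))) = p := by
  conv_rhs => rw [hp.as_sum, hd]
  rw [mkPoly, ← Finset.sum_range_reflect (fun k => C (p.coeff k) * X ^ k), Finset.sum_range]
  congr 1
  refine Finset.sum_congr rfl fun i _ => ?_
  rw [show d - (i.val + 1) = d - 1 - i.val by omega]

theorem mkPoly_monic {d : ℕ} (a : Fin d → ℂ) : (mkPoly d a).Monic := by
  refine monic_X_pow_add (lt_of_le_of_lt (degree_sum_le _ _) ?_)
  rw [Finset.sup_lt_iff (by exact_mod_cast WithBot.bot_lt_coe d)]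
  intro i _
  refine (degree_C_mul_X_pow_le _ _).trans_lt ?_
  have := i.2
  exact_mod_cast (by omega)

theorem natDegree_mkPoly {d : ℕ} (a : Fin d → ℂ) : (mkPoly d a).natDegree = d := by
  rw [mkPoly, natDegree_add_eq_left_of_degree_lt, natDegree_X_pow]
  rw [degree_X_pow]
  refine lt_of_le_of_lt (degree_sum_le _ _) ?_
  rw [Finset.sup_lt_iff (by exact_mod_cast WithBot.bot_lt_coe d)]
  intro i _
  refine (degree_C_mul_X_pow_le _ _).trans_lt ?_
  have := i.2
  exact_mod_cast (by omega)

theorem eval_mkPoly {d : ℕ} (a : Fin d → ℂ) (y : ℂ) :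
    (mkPoly d a).eval y = y ^ d + ∑ i : Fin d, a i * y ^ (d - (i.val + 1)) := by
  simp [mkPoly, eval_finsetSum]

end Discriminant

section RForm

variable {E : Type*} [NormedAddCommGroup E] [NormedSpace ℂ E]

/-- `S` is parametrised near the origin by finitely many Puiseux branches with the same
ramified parameter, any two of which only meet over `x = 0`. -/
def RForm (S : Set (E × (ℂ × ℂ))) : Prop :=
  ∃ N d : ℕ, 0 < N ∧ 0 < d ∧ ∃ ξ : Fin d → E × ℂ → ℂ,
    (∀ i, AnalyticAt ℂ (ξ i) 0 ∧ ξ i 0 = 0) ∧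
    (∀ i j, i ≠ j → ∀ᶠ p in nhds (0 : E × ℂ), p.2 ≠ 0 → ξ i p ≠ ξ j p) ∧
    (∀ ω : ℂ, ω ^ N = 1 → ∀ i, ∃ j, ∀ᶠ p in nhds (0 : E × ℂ), ξ i (p.1, ω * p.2) = ξ j p) ∧
    ∀ᶠ z in nhds (0 : E × (ℂ × ℂ)), z ∈ S ↔ ∃ i, ∃ τ : ℂ, τ ^ N = z.2.1 ∧ ξ i (z.1, τ) = z.2.2

theorem tendsto_fst_mul (ω : ℂ) :
    Filter.Tendsto (fun p : E × ℂ => (p.1, ω * p.2)) (nhds 0) (nhds 0) := by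
  have : Continuous (fun p : E × ℂ => (p.1, ω * p.2)) := by fun_prop
  exact this.tendsto' 0 0 (by simp)

theorem tendsto_fst_pow {N : ℕ} (hN : 0 < N) :
    Filter.Tendsto (fun p : E × ℂ => (p.1, p.2 ^ N)) (nhds 0) (nhds 0) := by
  have : Continuous (fun p : E × ℂ => (p.1, p.2 ^ N)) := by fun_prop
  exact this.tendsto' 0 0 (by simp [hN.ne'])

theorem eventually_forall_pow_eq {N : ℕ} {P : E × ℂ → Prop}
    (hP : ∀ᶠ p in nhds (0 : E × ℂ), P p) :
    ∀ᶠ z in nhds (0 : E × ℂ), ∀ τ, τ ^ N = z.2 → P (z.1, τ) := by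
  obtain ⟨r, hr, H⟩ := eventually_prod_nhds_zero_iff.1 hP
  refine eventually_prod_nhds_zero_iff.2 ⟨min r (r ^ N), by positivity, ?_⟩
  intro t x ht hx τ hτ
  refine H t τ (ht.trans_le (min_le_left _ _)) ?_
  simp only at hτ
  rw [← hτ, norm_pow] at hx
  exact lt_of_pow_lt_pow_left₀ N hr.le (hx.trans_le (min_le_right _ _))

theorem finite_pow_eq (N : ℕ) (hN : 0 < N) (c : ℂ) : {ω : ℂ | ω ^ N = c}.Finite := by
  have : {ω : ℂ | ω ^ N = c} = {ω | ω ∈ nthRoots N c} := by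
    ext ω; simp [mem_nthRoots hN]
  rw [this]
  exact (nthRoots N c).finite_toSet

/-- Any point off the hyperplane near the origin. -/
theorem exists_snd_ne_zero {P : E × ℂ → Prop} (h : ∀ᶠ p in nhds (0 : E × ℂ), P p) :
    ∃ p, P p ∧ p.2 ≠ 0 := by
  have hc : Filter.Tendsto (fun x : ℂ => ((0 : E), x)) (nhds 0) (nhds 0) := by
    have : Continuous (fun x : ℂ => ((0 : E), x)) := by fun_prop
    exact this.tendsto' 0 0 rfl
  obtain ⟨x, hx, hx'⟩ := (((hc.eventually h).filter_mono
    (nhdsWithin_le_nhds (s := ({0}ᶜ : Set ℂ)))).and self_mem_nhdsWithin).exists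
  exact ⟨_, hx, hx'⟩

/-- Descent along `τ ↦ τ ^ N`. -/
theorem AnalyticAt.exists_descent {e : E × ℂ → ℂ} (he : AnalyticAt ℂ e 0) {N : ℕ} (hN : 0 < N)
    (hinv : ∀ ω : ℂ, ω ^ N = 1 → ∀ᶠ p in nhds (0 : E × ℂ), e (p.1, ω * p.2) = e p) :
    ∃ a, AnalyticAt ℂ a (0 : E × ℂ) ∧ ∀ᶠ p in nhds (0 : E × ℂ), a (p.1, p.2 ^ N) = e p := by
  have hinv' : ∀ᶠ p in nhds (0 : E × ℂ), ∀ ω : ℂ, ω ^ N = 1 → e (p.1, ω * p.2) = e p :=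
    (Filter.eventually_all_finite (finite_pow_eq N hN 1)).2 hinv
  obtain ⟨B, hB⟩ : ∃ B, ∀ᶠ p in nhds (0 : E × ℂ), ‖e p‖ ≤ B :=
    ⟨‖e 0‖ + 1, (he.continuousAt.norm.eventually (gt_mem_nhds (lt_add_one _))).mono
      fun _ h => h.le⟩
  obtain ⟨r, hr, H⟩ := eventually_prod_nhds_zero_iff.1
    ((he.eventually_analyticAt.and hinv').and hB)
  set m := min r (r ^ N) with hm
  have hm0 : 0 < m := by positivity
  have hroot : ∀ x τ : ℂ, ‖x‖ < m → τ ^ N = x → ‖τ‖ < r := by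
    intro x τ hx hτ
    by_contra hcon
    push Not at hcon
    have : r ^ N ≤ ‖τ‖ ^ N := by gcongr
    rw [← norm_pow, hτ] at this
    exact absurd (hx.trans_le (min_le_right _ _)) (not_lt.2 this)
  set a0 : E × ℂ → ℂ := fun p => e (p.1, p.2 ^ ((1 : ℂ) / N)) with ha0
  have hpow : ∀ x : ℂ, (x ^ ((1 : ℂ) / N)) ^ N = x := fun x => by
    rw [one_div, Complex.cpow_nat_inv_pow _ hN.ne']
  have ha0e : ∀ t τ, ‖t‖ < r → ‖τ ^ N‖ < m → a0 (t, τ ^ N) = e (t, τ) := by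
    intro t τ ht hτ
    by_cases h0 : τ = 0
    · simp [ha0, h0, hN.ne']
    have h1 := (H t τ ht (hroot _ τ hτ rfl)).1.2 ((τ ^ N) ^ ((1 : ℂ) / N) / τ)
      (by rw [div_pow, hpow, div_self (pow_ne_zero _ h0)])
    simp only [div_mul_cancel₀ _ h0] at h1
    exact h1
  obtain ⟨a, ha, haa⟩ := exists_analyticAt_of_bounded (f := a0) (B := B)
    (eventually_prod_nhds_zero_iff.2 ⟨m, hm0, fun t x ht hx hx0 => by
      have hr1 : AnalyticAt ℂ (fun p : E × ℂ => p.2) (t, x) := by fun_prop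
      obtain ⟨v, hv, hv0, hvN⟩ := hr1.exists_pow_eq hx0 hN
      have hvx : v (t, x) ^ N = x := hvN _
      have h1 : AnalyticAt ℂ e ((fun p : E × ℂ => (p.1, v p)) (t, x)) :=
        (H t (v (t, x)) (ht.trans_le (min_le_left _ _)) (hroot x _ hx hvx)).1.1
      refine (h1.comp (f := fun p : E × ℂ => (p.1, v p)) (by fun_prop)).congr ?_
      have h2 : ∀ᶠ p in nhds ((t, x) : E × ℂ), ‖p.1‖ < r ∧ ‖p.2‖ < m :=
        (continuous_fst.norm.continuousAt.eventually (gt_mem_nhds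
          (ht.trans_le (min_le_left _ _)))).and
        (continuous_snd.norm.continuousAt.eventually (gt_mem_nhds hx))
      filter_upwards [h2] with p hp
      have := ha0e p.1 (v p) hp.1 (by rw [hvN]; exact hp.2)
      rw [hvN] at this
      exact this.symm⟩)
    (eventually_prod_nhds_zero_iff.2 ⟨m, hm0, fun t x ht hx hx0 =>
      (H t _ (ht.trans_le (min_le_left _ _)) (hroot x _ hx (hpow x))).2⟩)
  refine ⟨a, ha, AnalyticAt.eventuallyEq_of_off ?_ he ?_⟩
  · have : AnalyticAt ℂ a ((fun p : E × ℂ => (p.1, p.2 ^ N)) 0) := by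
      simp only [Prod.snd_zero, zero_pow hN.ne', Prod.fst_zero, Prod.mk_zero_zero]; exact ha
    exact this.comp (f := fun p : E × ℂ => (p.1, p.2 ^ N)) (by fun_prop)
  · filter_upwards [(tendsto_fst_pow hN).eventually haa, (tendsto_fst_pow hN).eventually
      ((eventually_prod_nhds_zero_iff (P := fun p : E × ℂ => ‖p.1‖ < m ∧ ‖p.2‖ < m)).2
        ⟨m, hm0, fun t x ht hx => And.intro ht hx⟩)]
      with p hp hp2 hp0
    rw [hp (pow_ne_zero _ hp0)]
    exact ha0e p.1 p.2 (hp2.1.trans_le (min_le_left _ _)) hp2.2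

theorem analyticAt_coeff_prod {Y ι : Type*} [NormedAddCommGroup Y] [NormedSpace ℂ Y]
    {x : Y} (ξ : ι → Y → ℂ) (h : ∀ i, AnalyticAt ℂ (ξ i) x) (s : Finset ι) (m : ℕ) :
    AnalyticAt ℂ (fun p => (∏ i ∈ s, (X - C (ξ i p)) : ℂ[X]).coeff m) x := by
  induction s using Finset.induction_on generalizing m with
  | empty => simp only [Finset.prod_empty]; exact analyticAt_const
  | insert i s hi ih =>
    simp only [Finset.prod_insert hi, coeff_mul, coeff_sub, coeff_C]
    refine Finset.analyticAt_fun_sum _ fun q _ => AnalyticAt.mul (analyticAt_const.sub ?_) (ih _)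
    split_ifs
    · exact h i
    · exact analyticAt_const

theorem analyticAt_listDisc {X : Type*} [NormedAddCommGroup X] [NormedSpace ℂ X]
    {x : X} {d : ℕ} (ξ : Fin d → X → ℂ) (h : ∀ i, AnalyticAt ℂ (ξ i) x) :
    AnalyticAt ℂ (fun p => listDisc (List.ofFn fun i => ξ i p)) x := by
  have hg : ∀ j, AnalyticAt ℂ (fun p => (List.ofFn fun i => ξ i p).getD j 0) x := by
    intro j
    by_cases hj : j < d
    · simpa [List.getD_eq_getElem?_getD, hj] using h ⟨j, hj⟩
    · simpa [List.getD_eq_getElem?_getD, hj] using analyticAt_const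
  simp only [listDisc_eq_prod, List.length_ofFn]
  exact Finset.analyticAt_fun_prod _ fun j _ => Finset.analyticAt_fun_prod _ fun i _ =>
    ((hg j).sub (hg i)).pow 2

theorem RForm.eqsFamily {q : ℕ} {S : Set ((Fin q → ℂ) × (ℂ × ℂ))} (hS : RForm S) :
    EqsFamily q S := by
  obtain ⟨N, d, hN, hd, ξ, hξ, hne, hω, hS⟩ := hS
  set P : (Fin q → ℂ) × ℂ → ℂ[X] := fun p => ∏ i, (X - C (ξ i p)) with hP
  have hPm : ∀ p, (P p).Monic := fun p => monic_prod_of_monic _ _ fun i _ => monic_X_sub_C _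
  have hPd : ∀ p, (P p).natDegree = d := fun p => by
    rw [hP, natDegree_prod_of_monic _ _ fun i _ => monic_X_sub_C _]; simp
  have hinv : ∀ ω : ℂ, ω ^ N = 1 → ∀ᶠ p in nhds (0 : (Fin q → ℂ) × ℂ),
      P (p.1, ω * p.2) = P p := by
    intro ω hω1
    have hω0 : ω ≠ 0 := by rintro rfl; simp [hN.ne'] at hω1
    choose σ hσ using hω ω hω1
    have hinj : Function.Injective σ := by
      intro i j hij
      by_contra hcon
      obtain ⟨p, hp, hp0⟩ := exists_snd_ne_zero (((hσ i).and (hσ j)).and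
        ((tendsto_fst_mul ω).eventually (hne i j hcon)))
      refine hp.2 (mul_ne_zero hω0 hp0) ?_
      rw [hp.1.1, hp.1.2, hij]
    filter_upwards [Filter.eventually_all.2 hσ] with p hp
    simp only [hP, hp]
    exact (Equiv.ofBijective σ (Finite.injective_iff_bijective.1 hinj)).prod_comp
      fun i => X - C (ξ i p)
  have hcoef : ∀ m, ∃ a, AnalyticAt ℂ a (0 : (Fin q → ℂ) × ℂ) ∧
      ∀ᶠ p in nhds (0 : (Fin q → ℂ) × ℂ), a (p.1, p.2 ^ N) = (P p).coeff m := fun m =>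
    (analyticAt_coeff_prod ξ (fun i => (hξ i).1) Finset.univ m).exists_descent hN
      fun ω hω1 => (hinv ω hω1).mono fun p hp => by
        change (P (p.1, ω * p.2)).coeff m = (P p).coeff m
        rw [hp]
  choose a ha haP using hcoef
  have hdisc : ∀ p, listDisc (List.ofFn fun i => ξ i p) = polyDisc (P p) := fun p =>
    (polyDisc_prod _).symm
  obtain ⟨D, hD, hDP⟩ := (analyticAt_listDisc ξ fun i => (hξ i).1).exists_descent hN
      fun ω hω1 => (hinv ω hω1).mono fun p hp => by rw [hdisc, hdisc, hp]
  simp only [hdisc] at hDP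
  set A : (Fin q → ℂ) × ℂ → ℂ[X] := fun p => mkPoly d fun i => a (d - (i.val + 1)) p with hA
  have hAP : ∀ᶠ p in nhds (0 : (Fin q → ℂ) × ℂ), A (p.1, p.2 ^ N) = P p := by
    filter_upwards [Filter.eventually_all.2 fun i : Fin d => haP (d - (i.val + 1))] with p hp
    rw [← mkPoly_coeff (hPm p) (hPd p), hA]
    simp only [hp]
  have hroots := fun P hP => eventually_forall_pow_eq (E := Fin q → ℂ) (N := N) (P := P) hP
  have hex : ∀ x : ℂ, ∃ τ, τ ^ N = x := fun x => IsAlgClosed.exists_pow_nat_eq x hN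
  have hnodup : ∀ᶠ p in nhds (0 : (Fin q → ℂ) × ℂ), p.2 ≠ 0 → polyDisc (P p) ≠ 0 := by
    have : ∀ᶠ p in nhds (0 : (Fin q → ℂ) × ℂ), ∀ i j, i ≠ j → p.2 ≠ 0 → ξ i p ≠ ξ j p := by
      rw [Filter.eventually_all]; intro i
      rw [Filter.eventually_all]; intro j
      by_cases h : i = j
      · simp [h]
      · simpa [h] using hne i j h
    filter_upwards [this] with p hp hp0
    rw [← hdisc, listDisc_ne_zero_iff, List.nodup_ofFn]
    intro i j hij
    by_contra h
    exact hp i j h hp0 hij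
  have hDne : ∀ᶠ z in nhds (0 : (Fin q → ℂ) × ℂ), z.2 ≠ 0 → D z ≠ 0 := by
    filter_upwards [hroots _ hnodup, hroots _ hDP] with z h1 h2 hz
    obtain ⟨τ, hτ⟩ := hex z.2
    have h3 := h2 τ hτ
    simp only [hτ] at h3
    have h4 : D z = polyDisc (P (z.1, τ)) := h3
    rw [h4]
    exact h1 τ hτ (by rintro (rfl : τ = 0); exact hz (by rw [← hτ, zero_pow hN.ne']))
  obtain ⟨M, u, hu, hu0, hDu⟩ := hD.exists_eq_pow_mul_unit hDne
  refine ⟨d, M, hd, fun i => a (d - (i.val + 1)), fun i => ⟨ha _, ?_⟩, ?_, u, hu, hu0, ?_⟩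
  · have := (haP (d - (i.val + 1))).self_of_nhds
    simp only [Prod.fst_zero, Prod.snd_zero, zero_pow hN.ne'] at this
    rw [Prod.mk_zero_zero] at this
    change a (d - (i.val + 1)) 0 = 0
    rw [this, hP]
    have h0 : ∀ i, ξ i 0 = 0 := fun i => (hξ i).2
    simp only [h0, C_0, sub_zero, Finset.prod_const, Finset.card_univ, Fintype.card_fin,
      coeff_X_pow]
    rw [if_neg]
    omega
  · have hc : Filter.Tendsto (fun z : (Fin q → ℂ) × (ℂ × ℂ) => (z.1, z.2.1)) (nhds 0)
        (nhds 0) := by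
      have : Continuous (fun z : (Fin q → ℂ) × (ℂ × ℂ) => (z.1, z.2.1)) := by fun_prop
      exact this.tendsto' 0 0 rfl
    filter_upwards [hS, hc.eventually (hroots _ hAP)] with z h1 h2
    rw [h1]
    have h3 : ∀ τ, τ ^ N = z.2.1 → (A (z.1, z.2.1) = P (z.1, τ)) := fun τ hτ => by
      have := h2 τ hτ
      simpa only [hτ] using this
    have h4 : ∀ τ, (P (z.1, τ)).eval z.2.2 = 0 ↔ ∃ i, ξ i (z.1, τ) = z.2.2 := by
      intro τ
      simp only [hP, eval_prod, Finset.prod_eq_zero_iff, eval_sub, eval_X, eval_C,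
        sub_eq_zero, Finset.mem_univ, true_and]
      exact exists_congr fun i => eq_comm
    change _ ↔ (A (z.1, z.2.1)).eval z.2.2 = 0
    constructor
    · rintro ⟨i, τ, hτ, h5⟩
      rw [h3 τ hτ, h4]
      exact ⟨i, h5⟩
    · intro h5
      obtain ⟨τ, hτ⟩ := hex z.2.1
      rw [h3 τ hτ, h4] at h5
      obtain ⟨i, hi⟩ := h5
      exact ⟨i, τ, hτ, hi⟩
  · filter_upwards [hroots _ hAP, hroots _ hDP, hDu] with z h1 h2 h3
    obtain ⟨τ, hτ⟩ := hex z.2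
    have h4 := h1 τ hτ
    have h5 := h2 τ hτ
    simp only [hτ] at h4 h5
    rw [← h3]
    change polyDisc (A (z.1, z.2)) = D (z.1, z.2)
    rw [h4, h5]

end RForm

section RootCovering

theorem AnalyticAt.exists_implicit {X : Type*} [NormedAddCommGroup X] [NormedSpace ℂ X]
    [FiniteDimensional ℂ X] {Q : X × ℂ → ℂ} {z0 : X × ℂ} (hQ : AnalyticAt ℂ Q z0)
    (hd : fderiv ℂ Q z0 (0, 1) ≠ 0) :
    ∃ φ : X → ℂ, AnalyticAt ℂ φ z0.1 ∧ φ z0.1 = z0.2 ∧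
      ∀ᶠ z in nhds z0, Q z = Q z0 ↔ z.2 = φ z.1 := by
  have hG : AnalyticAt ℂ (fun p : X × ℂ => (p.1, Q p)) z0 := by fun_prop
  have hdd : fderiv ℂ (fun p : X × ℂ => (p.1, Q p)) z0 =
      (ContinuousLinearMap.fst ℂ X ℂ).prod (fderiv ℂ Q z0) :=
    (hasFDerivAt_fst.prodMk hQ.differentiableAt.hasFDerivAt).fderiv
  obtain ⟨g, hg, hg0, h1, h2⟩ := hG.exists_inverse_of_injective rfl (by
    rw [hdd]
    rintro ⟨v, s⟩ hv
    simp only [ContinuousLinearMap.prod_apply, ContinuousLinearMap.coe_fst', Prod.mk_eq_zero] at hv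
    obtain ⟨rfl, hv2⟩ := hv
    have : fderiv ℂ Q z0 ((0 : X), s) = s * fderiv ℂ Q z0 (0, 1) := by
      rw [show ((0 : X), s) = s • ((0 : X), (1 : ℂ)) by simp, map_smul, smul_eq_mul]
    rw [this] at hv2
    rw [(mul_eq_zero.1 hv2).resolve_right hd]; rfl)
  have hφc : Filter.Tendsto (fun z : X × ℂ => (z.1, Q z0)) (nhds z0) (nhds (z0.1, Q z0)) := by
    have : Continuous (fun z : X × ℂ => (z.1, Q z0)) := by fun_prop
    exact this.tendsto z0
  refine ⟨fun p => (g (p, Q z0)).2, ?_, congrArg Prod.snd hg0, ?_⟩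
  · have : AnalyticAt ℂ (fun p : X => (p, Q z0)) z0.1 := by fun_prop
    exact AnalyticAt.fun_snd (hg.comp_of_eq this rfl)
  · filter_upwards [h1, hφc.eventually h2] with z hz1 hz2
    refine ⟨fun h => ?_, fun h => ?_⟩
    · rw [h] at hz1; simp [hz1]
    · have e1 : (g (z.1, Q z0)).1 = z.1 := (Prod.mk.inj hz2).1
      have e2 : g (z.1, Q z0) = z := Prod.ext e1 h.symm
      rw [e2] at hz2
      exact (Prod.mk.inj hz2).2

/-- The evaluation map of the universal monic polynomial of degree `d`. -/
noncomputable def univEval (d : ℕ) (p : (Fin d → ℂ) × ℂ) : (Fin d → ℂ) × ℂ :=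
  (p.1, (mkPoly d p.1).eval p.2)

theorem continuous_univEval (d : ℕ) : Continuous (univEval d) := by
  unfold univEval
  simp only [eval_mkPoly]
  fun_prop

theorem analyticAt_eval_mkPoly {d : ℕ} (p : (Fin d → ℂ) × ℂ) :
    AnalyticAt ℂ (fun p : (Fin d → ℂ) × ℂ => (mkPoly d p.1).eval p.2) p := by
  simp only [eval_mkPoly]
  have h : ∀ i : Fin d, AnalyticAt ℂ (fun p : (Fin d → ℂ) × ℂ => p.1 i) p := fun i =>
    ((ContinuousLinearMap.proj (R := ℂ) (φ := fun _ : Fin d => ℂ) i).comp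
      (ContinuousLinearMap.fst ℂ (Fin d → ℂ) ℂ)).analyticAt p
  refine (analyticAt_snd.pow d).add (Finset.analyticAt_fun_sum _ fun i _ => ?_)
  exact (h i).mul (analyticAt_snd.pow _)

theorem fderiv_eval_mkPoly {d : ℕ} (p : (Fin d → ℂ) × ℂ) :
    fderiv ℂ (fun p : (Fin d → ℂ) × ℂ => (mkPoly d p.1).eval p.2) p (0, 1) =
      (mkPoly d p.1).derivative.eval p.2 := by
  have h1 := (analyticAt_eval_mkPoly p).differentiableAt.hasFDerivAt
  have h2 : HasDerivAt (fun y : ℂ => (p.1, y)) ((0 : Fin d → ℂ), (1 : ℂ)) p.2 :=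
    (hasDerivAt_const _ _).prodMk (hasDerivAt_id _)
  have h3 := h1.comp_hasDerivAt p.2 h2
  exact h3.unique ((mkPoly d p.1).hasDerivAt p.2)

theorem norm_le_of_eval_mkPoly {d : ℕ} (hd : 0 < d) (p : (Fin d → ℂ) × ℂ) :
    ‖p.2‖ ≤ 1 + d * ‖p.1‖ + ‖(mkPoly d p.1).eval p.2‖ := by
  by_contra hcon
  push Not at hcon
  obtain ⟨a, y⟩ := p
  simp only at hcon
  rw [eval_mkPoly] at hcon
  have hy1 : 1 < ‖y‖ := lt_of_le_of_lt (by
    have : (0 : ℝ) ≤ d * ‖a‖ := by positivity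
    linarith [norm_nonneg (y ^ d + ∑ i : Fin d, a i * y ^ (d - (i.val + 1)))]) hcon
  have hsum : ‖∑ i : Fin d, a i * y ^ (d - (i.val + 1))‖ ≤ d * ‖a‖ * ‖y‖ ^ (d - 1) := by
    refine (norm_sum_le _ _).trans ?_
    refine (Finset.sum_le_card_nsmul _ _ (‖a‖ * ‖y‖ ^ (d - 1)) fun i _ => ?_).trans ?_
    · rw [norm_mul, norm_pow]
      gcongr
      · exact norm_le_pi_norm a i
      · exact hy1.le
      · omega
    · simp [mul_assoc]
  have h1 : ‖y ^ d‖ ≤ ‖y ^ d + ∑ i : Fin d, a i * y ^ (d - (i.val + 1))‖ +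
      ‖∑ i : Fin d, a i * y ^ (d - (i.val + 1))‖ := by
    simpa using norm_sub_le (y ^ d + ∑ i : Fin d, a i * y ^ (d - (i.val + 1)))
      (∑ i : Fin d, a i * y ^ (d - (i.val + 1)))
  set v := ‖y ^ d + ∑ i : Fin d, a i * y ^ (d - (i.val + 1))‖ with hv
  have hv0 : 0 ≤ v := norm_nonneg _
  have hp1 : 1 ≤ ‖y‖ ^ (d - 1) := one_le_pow₀ hy1.le
  have h2 : ‖y ^ d‖ = ‖y‖ * ‖y‖ ^ (d - 1) := by
    rw [norm_pow, ← pow_succ', Nat.sub_add_cancel hd]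
  rw [h2] at h1
  have : ‖y‖ * ‖y‖ ^ (d - 1) ≤ (v + d * ‖a‖) * ‖y‖ ^ (d - 1) := by nlinarith
  have := le_of_mul_le_mul_right this (by positivity)
  linarith

theorem isClosedMap_univEval {d : ℕ} (hd : 0 < d) : IsClosedMap (univEval d) := by
  refine (isProperMap_iff_isCompact_preimage.2 ⟨continuous_univEval d, fun K hK => ?_⟩).isClosedMap
  refine Metric.isCompact_of_isClosed_isBounded (hK.isClosed.preimage (continuous_univEval d)) ?_
  obtain ⟨R, hR⟩ := hK.isBounded.exists_norm_le
  refine isBounded_iff_forall_norm_le.2 ⟨max R (1 + d * R + R), fun p hp => ?_⟩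
  have h := hR _ hp
  have h1 : ‖p.1‖ ≤ R := (norm_fst_le (univEval d p)).trans h
  have h2 : ‖(mkPoly d p.1).eval p.2‖ ≤ R := (norm_snd_le (univEval d p)).trans h
  refine norm_prod_le_iff.2 ⟨h1.trans (le_max_left _ _), le_trans ?_ (le_max_right _ _)⟩
  refine (norm_le_of_eval_mkPoly hd p).trans ?_
  gcongr

theorem isCoveringMapOn_univEval {d : ℕ} (hd : 0 < d) :
    IsCoveringMapOn (univEval d) {q | ∀ y, (mkPoly d q.1).eval y = q.2 →
      (mkPoly d q.1).derivative.eval y ≠ 0} := by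
  refine (isClosedMap_univEval hd).isCoveringMapOn_of_isLocalHomeomorphOn ?_ ?_
  · rintro ⟨a, v⟩ -
    have hne : mkPoly d a - C v ≠ 0 := by
      intro h0
      have := natDegree_mkPoly a
      rw [sub_eq_zero.1 h0, natDegree_C] at this
      omega
    refine (((mkPoly d a - C v).roots.toFinset.finite_toSet).image (fun y => (a, y))).subset ?_
    rintro ⟨b, y⟩ hb
    have hb' : (b, (mkPoly d b).eval y) = (a, v) := hb
    obtain ⟨rfl, rfl⟩ := Prod.mk.inj hb'
    refine ⟨y, ?_, rfl⟩
    simp only [Multiset.mem_toFinset, Finset.mem_coe]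
    rw [mem_roots hne]
    simp
  · intro x hx
    have hx' := hx x.2 rfl
    have hG : AnalyticAt ℂ (univEval d) x := by
      have := analyticAt_eval_mkPoly x
      unfold univEval
      fun_prop
    have hdd : fderiv ℂ (univEval d) x = (ContinuousLinearMap.fst ℂ (Fin d → ℂ) ℂ).prod
        (fderiv ℂ (fun p : (Fin d → ℂ) × ℂ => (mkPoly d p.1).eval p.2) x) :=
      (hasFDerivAt_fst.prodMk (analyticAt_eval_mkPoly x).differentiableAt.hasFDerivAt).fderiv
    have hinj : Function.Injective (fderiv ℂ (univEval d) x : (Fin d → ℂ) × ℂ →ₗ[ℂ]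
        (Fin d → ℂ) × ℂ) := by
      refine (injective_iff_map_eq_zero _).2 ?_
      rintro ⟨v, s⟩ hv
      rw [hdd] at hv
      simp only [ContinuousLinearMap.coe_coe, ContinuousLinearMap.prod_apply,
        ContinuousLinearMap.coe_fst', Prod.mk_eq_zero] at hv
      obtain ⟨rfl, hv2⟩ := hv
      rw [show ((0 : Fin d → ℂ), s) = s • ((0 : Fin d → ℂ), (1 : ℂ)) by simp, map_smul,
        fderiv_eval_mkPoly, smul_eq_mul] at hv2
      rw [(mul_eq_zero.1 hv2).resolve_right hx']; rfl
    set e := (LinearEquiv.ofInjectiveOfFinrankEq _ hinj rfl).toContinuousLinearEquiv with he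
    have hs : HasStrictFDerivAt (univEval d) (e : (Fin d → ℂ) × ℂ →L[ℂ] _) x := by
      have : (e : (Fin d → ℂ) × ℂ →L[ℂ] (Fin d → ℂ) × ℂ) = fderiv ℂ (univEval d) x := by
        ext v <;> rfl
      rw [this]; exact hG.hasStrictFDerivAt
    exact ⟨hs.toOpenPartialHomeomorph _, hs.mem_toOpenPartialHomeomorph_source, rfl⟩

theorem derivative_eval_ne_zero_of_nodup {p : Polynomial ℂ} (hp : p ≠ 0) (h : p.roots.Nodup)
    {y : ℂ} (hy : p.eval y = 0) : p.derivative.eval y ≠ 0 := by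
  intro h0
  have := (one_lt_rootMultiplicity_iff_isRoot hp).2 ⟨hy, h0⟩
  rw [← count_roots] at this
  exact absurd (Multiset.nodup_iff_count_le_one.1 h y) (not_le.2 this)

/-- Over a simply connected base, a monic polynomial with simple roots splits. -/
theorem exists_continuous_roots {A : Type*} [TopologicalSpace A] [SimplyConnectedSpace A]
    [LocallyPathConnectedSpace A] {d : ℕ} (hd : 0 < d) {a : A → Fin d → ℂ} (ha : Continuous a)
    (hs : ∀ u, (mkPoly d (a u)).roots.Nodup) :
    ∃ y : Fin d → A → ℂ, (∀ i, Continuous (y i)) ∧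
      (∀ i j, i ≠ j → ∀ u, y i u ≠ y j u) ∧
      (∀ u, mkPoly d (a u) = ∏ i, (X - C (y i u))) ∧
      ∀ z : A → ℂ, Continuous z → (∀ u, (mkPoly d (a u)).eval (z u) = 0) → ∃ i, z = y i := by
  set s : Set ((Fin d → ℂ) × ℂ) := {q | ∀ y, (mkPoly d q.1).eval y = q.2 →
      (mkPoly d q.1).derivative.eval y ≠ 0} with hsdef
  have cov := (isCoveringMapOn_univEval hd).isCoveringMap_restrictPreimage
  rw [← hsdef] at cov
  have hmem : ∀ u, (a u, (0 : ℂ)) ∈ s := fun u y hy =>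
    derivative_eval_ne_zero_of_nodup (mkPoly_monic _).ne_zero (hs u) hy
  have hmem' : ∀ u z, (mkPoly d (a u)).eval z = 0 → (a u, z) ∈ univEval d ⁻¹' s := by
    intro u z hz
    show (a u, (mkPoly d (a u)).eval z) ∈ s
    rw [hz]; exact hmem u
  have u0 : A := Classical.arbitrary A
  have uniq : ∀ z z' : A → ℂ, Continuous z → Continuous z' →
      (∀ u, (mkPoly d (a u)).eval (z u) = 0) → (∀ u, (mkPoly d (a u)).eval (z' u) = 0) →
      ∀ u, z u = z' u → z = z' := by
    intro z z' hz hz' h h' u hu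
    have := cov.eq_of_comp_eq (g₁ := fun u => ⟨(a u, z u), hmem' u _ (h u)⟩)
      (g₂ := fun u => ⟨(a u, z' u), hmem' u _ (h' u)⟩) (by fun_prop) (by fun_prop) (by
        funext u
        apply Subtype.ext
        show (a u, (mkPoly d (a u)).eval (z u)) = (a u, (mkPoly d (a u)).eval (z' u))
        rw [h, h']) u (by simp [hu])
    funext v
    have h3 := congrArg (fun g => (g v).1.2) this
    exact h3
  have ex : ∀ c, (mkPoly d (a u0)).eval c = 0 → ∃ z : A → ℂ, Continuous z ∧ z u0 = c ∧
      ∀ u, (mkPoly d (a u)).eval (z u) = 0 := by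
    intro c hc
    obtain ⟨F, ⟨hF0, hF⟩, -⟩ := cov.existsUnique_continuousMap_lifts
      (⟨fun u => ⟨(a u, 0), hmem u⟩, by fun_prop⟩ : C(A, s)) u0
      ⟨(a u0, c), hmem' u0 c hc⟩ (by
        apply Subtype.ext
        show (a u0, (mkPoly d (a u0)).eval c) = (a u0, 0)
        rw [hc])
    have hF' : ∀ u, univEval d (F u).1 = (a u, 0) := fun u =>
      congrArg Subtype.val (congrFun hF u)
    refine ⟨fun u => (F u).1.2, by fun_prop, by simp only [hF0], fun u => ?_⟩
    obtain ⟨e1, e2⟩ := Prod.mk.inj (hF' u)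
    rw [e1] at e2
    exact e2
  have hcard : (mkPoly d (a u0)).roots.toFinset.card = d := by
    rw [Multiset.toFinset_card_of_nodup (hs u0)]
    refine Eq.trans ?_ (natDegree_mkPoly (a u0))
    exact (splits_iff_card_roots.1 (IsAlgClosed.splits _))
  set e := ((mkPoly d (a u0)).roots.toFinset.equivFinOfCardEq hcard).symm with he
  have hr : ∀ i, (mkPoly d (a u0)).eval (e i : ℂ) = 0 := fun i => by
    have := (e i).2
    rw [Multiset.mem_toFinset, mem_roots (mkPoly_monic _).ne_zero] at this
    exact this
  choose y hyc hy0 hyr using fun i => ex (e i) (hr i)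
  have hne : ∀ i j, i ≠ j → ∀ u, y i u ≠ y j u := by
    intro i j hij u hu
    have := uniq _ _ (hyc i) (hyc j) (hyr i) (hyr j) u hu
    refine hij (e.injective (Subtype.ext ?_))
    rw [← hy0 i, ← hy0 j, this]
  refine ⟨y, hyc, hne, fun u => ?_, fun z hz hzr => ?_⟩
  · refine (eq_of_monic_of_dvd_of_natDegree_le (monic_prod_X_sub_C _ _) (mkPoly_monic _) ?_ ?_)
    · refine Finset.prod_dvd_of_coprime ?_ fun i _ => dvd_iff_isRoot.2 (hyr i u)
      exact (pairwise_coprime_X_sub_C (s := fun i => y i u) (fun i j h => by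
        by_contra hij; exact hne i j hij u h)).set_pairwise _
    · rw [natDegree_mkPoly, natDegree_prod_of_monic _ _ fun i _ => monic_X_sub_C _]
      simp
  · have hz0 := hzr u0
    have hmemz : z u0 ∈ (mkPoly d (a u0)).roots.toFinset := by
      rw [Multiset.mem_toFinset, mem_roots (mkPoly_monic _).ne_zero]; exact hz0
    refine ⟨e.symm ⟨z u0, hmemz⟩, uniq _ _ hz (hyc _) hzr (hyr _) u0 ?_⟩
    rw [hy0]; simp

end RootCovering

section PuiseuxSplitting

/-- Over a convex open set, a monic polynomial with analytic coefficients and simple roots has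
analytic roots. -/
theorem exists_analytic_roots {X : Type*} [NormedAddCommGroup X] [NormedSpace ℂ X]
    [NormedSpace ℝ X] [FiniteDimensional ℂ X] {U : Set X} (hU : IsOpen U) (hc : Convex ℝ U)
    (hne : U.Nonempty) {d : ℕ} (hd : 0 < d) {a : Fin d → X → ℂ}
    (ha : ∀ i, AnalyticOnNhd ℂ (a i) U) (hs : ∀ p ∈ U, (mkPoly d fun i => a i p).roots.Nodup) :
    ∃ y : Fin d → X → ℂ, (∀ i, AnalyticOnNhd ℂ (y i) U) ∧
      (∀ i j, i ≠ j → ∀ p ∈ U, y i p ≠ y j p) ∧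
      (∀ p ∈ U, mkPoly d (fun i => a i p) = ∏ i, (Polynomial.X - C (y i p))) ∧
      ∀ z : X → ℂ, ContinuousOn z U → (∀ p ∈ U, (mkPoly d fun i => a i p).eval (z p) = 0) →
        ∃ i, ∀ p ∈ U, z p = y i p := by
  have := hc.contractibleSpace hne
  have : LocallyPathConnectedSpace X := by
    have : LocallyConvexSpace ℝ X := inferInstance
    infer_instance
  have := hU.locallyPathConnectedSpace
  have hac : Continuous (fun (u : U) (i : Fin d) => a i u) := by
    refine continuous_pi fun i => ?_
    exact continuousOn_iff_continuous_domRestrict.1 (ha i).continuousOn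
  obtain ⟨y, hyc, hyn, hyp, hyu⟩ := exists_continuous_roots hd hac (fun u => hs u u.2)
  set Y : Fin d → X → ℂ := fun i p => if h : p ∈ U then y i ⟨p, h⟩ else 0 with hY
  have hYe : ∀ i p (h : p ∈ U), Y i p = y i ⟨p, h⟩ := fun i p h => by simp [hY, h]
  have hYc : ∀ i, ContinuousOn (Y i) U := fun i => by
    rw [continuousOn_iff_continuous_domRestrict]
    convert hyc i using 1
    funext u
    simp [hYe i u u.2]
  have hYp : ∀ p ∈ U, mkPoly d (fun i => a i p) = ∏ i, (Polynomial.X - C (Y i p)) := by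
    intro p hp
    rw [hyp ⟨p, hp⟩]
    exact Finset.prod_congr rfl fun i _ => by rw [hYe i p hp]
  have hYr : ∀ i, ∀ p ∈ U, (mkPoly d fun i => a i p).eval (Y i p) = 0 := by
    intro i p hp
    rw [hYp p hp, eval_prod]
    exact Finset.prod_eq_zero (Finset.mem_univ i) (by simp)
  refine ⟨Y, fun i p hp => ?_, fun i j hij p hp => ?_, hYp, fun z hz hzr => ?_⟩
  · have hQ : AnalyticAt ℂ (fun w : X × ℂ => (mkPoly d fun i => a i w.1).eval w.2) (p, Y i p) := by
      have h1 : AnalyticAt ℂ (fun w : X × ℂ => ((fun i => a i w.1 : Fin d → ℂ), w.2))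
          (p, Y i p) := by
        refine AnalyticAt.prod ?_ analyticAt_snd
        rw [analyticAt_pi_iff]
        intro j
        exact (ha j p hp).comp_of_eq analyticAt_fst rfl
      exact (analyticAt_eval_mkPoly (d := d) (fun j => a j p, Y i p)).comp_of_eq h1 rfl
    have hder : fderiv ℂ (fun w : X × ℂ => (mkPoly d fun i => a i w.1).eval w.2) (p, Y i p) (0, 1)
        ≠ 0 := by
      have h2 : HasDerivAt (fun y : ℂ => (p, y)) ((0 : X), (1 : ℂ)) (Y i p) :=
        (hasDerivAt_const _ _).prodMk (hasDerivAt_id _)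
      have h3 := hQ.differentiableAt.hasFDerivAt.comp_hasDerivAt (Y i p) h2
      rw [h3.unique ((mkPoly d fun j => a j p).hasDerivAt (Y i p))]
      exact derivative_eval_ne_zero_of_nodup (mkPoly_monic _).ne_zero (hs p hp) (hYr i p hp)
    obtain ⟨φ, hφ, -, hφe⟩ := hQ.exists_implicit hder
    have hcont : ContinuousAt (fun x => (x, Y i x)) p :=
      continuousAt_id.prodMk ((hYc i).continuousAt (hU.mem_nhds hp))
    refine hφ.congr ?_
    filter_upwards [hcont.eventually hφe, hU.mem_nhds hp] with x hx hxU
    refine (hx.1 ?_).symm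
    show eval (Y i x) _ = eval (Y i p) _
    rw [hYr i x hxU, hYr i p hp]
  · rw [hYe i p hp, hYe j p hp]
    exact hyn i j hij _
  · obtain ⟨i, hi⟩ := hyu (fun u => z u) (continuousOn_iff_continuous_domRestrict.1 hz)
      fun u => hzr u u.2
    exact ⟨i, fun p hp => by rw [hYe i p hp]; exact congrFun hi ⟨p, hp⟩⟩

theorem coeff_mkPoly {d : ℕ} (a : Fin d → ℂ) (i : Fin d) :
    (mkPoly d a).coeff (d - (i.val + 1)) = a i := by
  have h0 := i.2
  simp only [mkPoly, coeff_add, coeff_X_pow, finsetSum_coeff, coeff_C_mul]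
  rw [Finset.sum_eq_single i]
  · simp; omega
  · intro j _ hj
    have := j.2
    have : d - (i.val + 1) ≠ d - (j.val + 1) := fun h => hj (Fin.ext (by omega))
    simp [this]
  · simp

variable {q : ℕ}

theorem EqsFamily.rForm {S : Set ((Fin q → ℂ) × (ℂ × ℂ))} (hS : EqsFamily q S) : RForm S := by
  obtain ⟨d, M, hd, a, ha, hSa, u, hu, hu0, hdisc⟩ := hS
  have hune : ∀ᶠ z in nhds (0 : (Fin q → ℂ) × ℂ), u z ≠ 0 := hu.continuousAt.eventually_ne hu0
  have han : ∀ᶠ z in nhds (0 : (Fin q → ℂ) × ℂ), ∀ i, AnalyticAt ℂ (a i) z :=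
    Filter.eventually_all.2 fun i => (ha i).1.eventually_analyticAt
  obtain ⟨r, hr, H⟩ := eventually_prod_nhds_zero_iff.1 ((hdisc.and hune).and han)
  set U : Set ((Fin q → ℂ) × ℂ) := Metric.ball 0 r ×ˢ {w | w.re < Real.log r} with hUdef
  have hUo : IsOpen U := Metric.isOpen_ball.prod (isOpen_lt Complex.continuous_re continuous_const)
  have hUc : Convex ℝ U := (convex_ball 0 r).prod (convex_halfSpace_re_lt _)
  have hUn : U.Nonempty := ⟨(0, ((Real.log r - 1 : ℝ) : ℂ)), by simp [hUdef, hr]⟩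
  have hUmem : ∀ t w, (t, w) ∈ U ↔ ‖t‖ < r ∧ ‖Complex.exp w‖ < r := by
    intro t w
    simp [hUdef, Complex.norm_exp, Real.lt_log_iff_exp_lt hr]
  set b : Fin d → (Fin q → ℂ) × ℂ → ℂ := fun i p => a i (p.1, Complex.exp p.2) with hb
  have hban : ∀ i, AnalyticOnNhd ℂ (b i) U := by
    rintro i ⟨t, w⟩ hp
    obtain ⟨h1, h2⟩ := (hUmem t w).1 hp
    have hh : AnalyticAt ℂ (fun p : (Fin q → ℂ) × ℂ => (p.1, Complex.exp p.2)) (t, w) := by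
      fun_prop
    exact ((H t _ h1 h2).2 i).comp_of_eq hh rfl
  have hbs : ∀ p ∈ U, (mkPoly d fun i => b i p).roots.Nodup := by
    rintro ⟨t, w⟩ hp
    obtain ⟨h1, h2⟩ := (hUmem t w).1 hp
    rw [← polyDisc_ne_zero_iff]
    have := (H t _ h1 h2).1
    rw [hb]
    simp only
    rw [this.1]
    exact mul_ne_zero (pow_ne_zero _ (Complex.exp_ne_zero _)) this.2
  obtain ⟨y, hya, hyn, hyp, hyu⟩ := exists_analytic_roots hUo hUc hUn hd hban hbs
  have hyr : ∀ i, ∀ p ∈ U, (mkPoly d fun i => b i p).eval (y i p) = 0 := by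
    intro i p hp
    rw [hyp p hp, eval_prod]
    exact Finset.prod_eq_zero (Finset.mem_univ i) (by simp)
  -- monodromy
  set c : ℂ := 2 * Real.pi * Complex.I with hcdef
  have hshift : ∀ t w, (t, w) ∈ U → (t, w + c) ∈ U := by
    intro t w h
    rw [hUmem] at h ⊢
    rwa [hcdef, Complex.exp_periodic w]
  have hbshift : ∀ i t w, b i (t, w + c) = b i (t, w) := by
    intro i t w
    simp only [hb]
    rw [hcdef, Complex.exp_periodic w]
  have hmono : ∀ i, ∃ j, ∀ p ∈ U, y i (p.1, p.2 + c) = y j p := by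
    intro i
    refine hyu (fun p => y i (p.1, p.2 + c)) ?_ ?_
    · have : ContinuousOn (fun p : (Fin q → ℂ) × ℂ => (p.1, p.2 + c)) U := by fun_prop
      exact (hya i).continuousOn.comp this fun p hp => hshift _ _ hp
    · intro p hp
      have := hyr i _ (hshift _ _ hp)
      simpa only [hbshift] using this
  choose σ hσ using hmono
  have hσi : Function.Injective σ := by
    intro i j hij
    obtain ⟨p, hp⟩ := hUn
    by_contra hne
    refine hyn i j hne _ (hshift p.1 p.2 hp) ?_
    rw [hσ i p hp, hσ j p hp, hij]
  set σ' : Equiv.Perm (Fin d) := Equiv.ofBijective σ (Finite.injective_iff_bijective.1 hσi)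
    with hσ'
  have hshiftn : ∀ (k : ℕ) t w, (t, w) ∈ U → (t, w + k * c) ∈ U := by
    intro k t w h
    induction k with
    | zero => simpa using h
    | succ k ih =>
      have := hshift _ _ ih
      convert this using 2; push_cast; ring
  have hpow : ∀ (k : ℕ) i, ∀ p ∈ U, y i (p.1, p.2 + k * c) = y ((σ' ^ k) i) p := by
    intro k
    induction k with
    | zero => intro i p hp; simp
    | succ k ih =>
      intro i p hp
      have h1 := hσ i _ (hshiftn k p.1 p.2 hp)
      rw [pow_succ, Equiv.Perm.mul_apply, ← ih _ p hp]
      refine Eq.trans ?_ h1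
      simp only
      congr 2
      push_cast; ring
  set N := orderOf σ' with hN
  have hN0 : 0 < N := orderOf_pos _
  have hNc : (N : ℂ) ≠ 0 := by exact_mod_cast hN0.ne'
  have hper : ∀ (k : ℕ) i, ∀ p ∈ U, y i (p.1, p.2 + N * (k * c)) = y i p := by
    intro k i p hp
    have := hpow (N * k) i p hp
    rw [pow_mul, pow_orderOf_eq_one, one_pow, Equiv.Perm.one_apply] at this
    rw [← this]; push_cast; ring_nf
  have hperz : ∀ (w w' : ℂ) t i, Complex.exp w = Complex.exp w' → (t, N * w) ∈ U →
      y i (t, N * w) = y i (t, N * w') := by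
    intro w w' t i hww hp
    obtain ⟨n, hn⟩ := Complex.exp_eq_exp_iff_exists_int.1 hww
    have hp' : (t, N * w') ∈ U := by
      rw [hUmem] at hp ⊢
      rwa [Complex.exp_nat_mul, ← hww, ← Complex.exp_nat_mul]
    rcases Int.eq_nat_or_neg n with ⟨m, rfl | rfl⟩
    · have := hper m i _ hp'
      simp only at this
      rw [← this, hn, hcdef]; push_cast; ring_nf
    · have := hper m i _ hp
      simp only at this
      rw [← this, hn, hcdef]; push_cast; ring_nf
  -- the ramified branches
  set Ξ : Fin d → (Fin q → ℂ) × ℂ → ℂ := fun i p => y i (p.1, N * Complex.log p.2) with hΞ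
  set m := min r 1 with hm
  have hm0 : 0 < m := by positivity
  have hmU : ∀ t w, ‖t‖ < m → ‖Complex.exp w‖ < m → (t, N * w) ∈ U := by
    intro t w ht hw
    rw [hUmem, Complex.exp_nat_mul, norm_pow]
    refine ⟨ht.trans_le (min_le_left _ _), lt_of_le_of_lt ?_ (hw.trans_le (min_le_left _ _))⟩
    exact pow_le_of_le_one (norm_nonneg _) (hw.le.trans (min_le_right _ _)) hN0.ne'
  have hΞe : ∀ i t w, ‖t‖ < m → ‖Complex.exp w‖ < m → Ξ i (t, Complex.exp w) = y i (t, N * w) := by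
    intro i t w ht hw
    exact (hperz w _ t i (Complex.exp_log (Complex.exp_ne_zero _)).symm (hmU t w ht hw)).symm
  have hmev : ∀ᶠ p in nhds (0 : (Fin q → ℂ) × ℂ), ‖p.1‖ < m ∧ ‖p.2‖ < m :=
    eventually_prod_nhds_zero_iff.2 ⟨m, hm0, fun t x ht hx => ⟨ht, hx⟩⟩
  have hlogU : ∀ p : (Fin q → ℂ) × ℂ, ‖p.1‖ < m → ‖p.2‖ < m → p.2 ≠ 0 →
      (p.1, N * Complex.log p.2) ∈ U := by
    intro p h1 h2 h3
    exact hmU _ _ h1 (by rwa [Complex.exp_log h3])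
  have hexplog : ∀ x : ℂ, x ≠ 0 → Complex.exp (N * Complex.log x) = x ^ N := by
    intro x hx
    rw [Complex.exp_nat_mul, Complex.exp_log hx]
  have hΞan : ∀ i, ∀ᶠ p in nhds (0 : (Fin q → ℂ) × ℂ), p.2 ≠ 0 → AnalyticAt ℂ (Ξ i) p := by
    intro i
    filter_upwards [hmev.eventually_nhds] with p hp hp2
    obtain ⟨h1, h2⟩ := hp.self_of_nhds
    have hl : AnalyticAt ℂ (fun z : (Fin q → ℂ) × ℂ =>
        (z.1, N * (Complex.log (z.2 / p.2) + Complex.log p.2))) p := by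
      have h3 : AnalyticAt ℂ (fun z : (Fin q → ℂ) × ℂ => Complex.log (z.2 / p.2)) p := by
        refine AnalyticAt.clog (analyticAt_snd.div analyticAt_const hp2) ?_
        simp [div_self hp2]
      fun_prop
    have hy' := (hya i _ (hlogU p h1 h2 hp2)).comp_of_eq hl (by simp [div_self hp2])
    refine hy'.congr ?_
    have hne : ∀ᶠ z in nhds p, z.2 ≠ 0 := continuousAt_snd.eventually_ne hp2
    filter_upwards [hp, hne] with z hz hz2
    have he : Complex.exp (Complex.log (z.2 / p.2) + Complex.log p.2) = z.2 := by
      rw [Complex.exp_add, Complex.exp_log hp2, Complex.exp_log (div_ne_zero hz2 hp2)]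
      field_simp
    have := hΞe i z.1 _ hz.1 (by rw [he]; exact hz.2)
    rw [he] at this
    exact this.symm
  have hpoly : ∀ p : (Fin q → ℂ) × ℂ, ‖p.1‖ < m → ‖p.2‖ < m → p.2 ≠ 0 →
      mkPoly d (fun i => a i (p.1, p.2 ^ N)) = ∏ i, (X - C (Ξ i p)) := by
    intro p h1 h2 h3
    have := hyp _ (hlogU p h1 h2 h3)
    simp only [hb, hexplog _ h3] at this
    exact this
  have hbound : ∀ i, ∃ B : ℝ, ∀ᶠ p in nhds (0 : (Fin q → ℂ) × ℂ), p.2 ≠ 0 → ‖Ξ i p‖ ≤ B := by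
    intro i
    refine ⟨1 + d * 1, ?_⟩
    have hsm : ∀ᶠ p in nhds (0 : (Fin q → ℂ) × ℂ), ‖fun i => a i p‖ < 1 := by
      have hc : ContinuousAt (fun p (i : Fin d) => a i p) 0 :=
        continuousAt_pi.2 fun i => (ha i).1.continuousAt
      refine hc.norm.eventually (gt_mem_nhds ?_)
      have : (fun i => a i 0) = (0 : Fin d → ℂ) := funext fun i => (ha i).2
      simp [this]
    filter_upwards [hmev, (tendsto_fst_pow hN0).eventually hsm] with p hp hp1 hp2
    have h1 := norm_le_of_eval_mkPoly hd (fun i => a i (p.1, p.2 ^ N), Ξ i p)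
    have h2 : eval (Ξ i p) (mkPoly d fun i => a i (p.1, p.2 ^ N)) = 0 := by
      rw [hpoly p hp.1 hp.2 hp2, eval_prod]
      exact Finset.prod_eq_zero (Finset.mem_univ i) (by simp)
    simp only [h2, norm_zero, add_zero] at h1
    refine h1.trans ?_
    gcongr
  choose B hB using hbound
  choose ξ hξ hξe using fun i => exists_analyticAt_of_bounded (hΞan i) (hB i)
  have hξe' : ∀ᶠ p in nhds (0 : (Fin q → ℂ) × ℂ), p.2 ≠ 0 → ∀ i, ξ i p = Ξ i p := by
    have := Filter.eventually_all.2 hξe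
    filter_upwards [this] with p hp h i using hp i h
  have hfull : ∀ᶠ p in nhds (0 : (Fin q → ℂ) × ℂ),
      mkPoly d (fun i => a i (p.1, p.2 ^ N)) = ∏ i, (X - C (ξ i p)) := by
    have hco : ∀ i : Fin d, (fun p : (Fin q → ℂ) × ℂ => a i (p.1, p.2 ^ N)) =ᶠ[nhds 0]
        fun p => (∏ i, (X - C (ξ i p)) : ℂ[X]).coeff (d - (i.val + 1)) := by
      intro i
      refine AnalyticAt.eventuallyEq_of_off ?_ (analyticAt_coeff_prod ξ hξ _ _) ?_
      · have : AnalyticAt ℂ (fun p : (Fin q → ℂ) × ℂ => (p.1, p.2 ^ N)) 0 := by fun_prop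
        exact (ha i).1.comp_of_eq this (by simp [hN0.ne'])
      · filter_upwards [hmev, hξe'] with p hp h1 h2
        have h3 := hpoly p hp.1 hp.2 h2
        simp only [← h1 h2] at h3
        rw [← h3, coeff_mkPoly]
    filter_upwards [Filter.eventually_all.2 hco] with p hp
    have : (fun i => a i (p.1, p.2 ^ N)) = fun i : Fin d =>
      (∏ i, (X - C (ξ i p)) : ℂ[X]).coeff (d - (i.val + 1)) := funext hp
    rw [this]
    refine mkPoly_coeff (monic_prod_X_sub_C _ _) ?_
    rw [natDegree_prod_of_monic _ _ fun i _ => monic_X_sub_C _]; simp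
  refine ⟨N, d, hN0, hd, ξ, fun i => ⟨hξ i, ?_⟩, fun i j hij => ?_, fun ω hω i => ?_, ?_⟩
  · have h0 := hfull.self_of_nhds
    have h1 : eval (ξ i 0) (mkPoly d fun i =>
        a i ((0 : (Fin q → ℂ) × ℂ).1, (0 : (Fin q → ℂ) × ℂ).2 ^ N)) = 0 := by
      rw [h0, eval_prod]
      exact Finset.prod_eq_zero (Finset.mem_univ i) (by simp)
    rw [eval_mkPoly] at h1
    have h2 : ∀ i, a i ((0 : Fin q → ℂ), (0 : ℂ)) = 0 := fun i => (ha i).2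
    simpa [hN0.ne', h2, hd.ne'] using h1
  · filter_upwards [hmev, hξe'] with p hp h1 h2
    rw [h1 h2, h1 h2]
    exact hyn i j hij _ (hlogU p hp.1 hp.2 h2)
  · have : NeZero N := ⟨hN0.ne'⟩
    obtain ⟨k, -, hk⟩ := (Complex.isPrimitiveRoot_exp N hN0.ne').eq_pow_of_pow_eq_one hω
    refine ⟨(σ' ^ k) i, ?_⟩
    have hω1 : ‖ω‖ = 1 := Complex.norm_eq_one_of_pow_eq_one hω hN0.ne'
    have hω0 : ω ≠ 0 := fun h => by simp [h] at hω1
    refine AnalyticAt.eventuallyEq_of_off ?_ (hξ _) ?_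
    · have : AnalyticAt ℂ (fun p : (Fin q → ℂ) × ℂ => (p.1, ω * p.2)) 0 := by fun_prop
      exact (hξ i).comp_of_eq this (by simp)
    · filter_upwards [hmev, hξe', (tendsto_fst_mul ω).eventually hξe'] with p hp h1 h2 h3
      rw [h1 h3, h2 (mul_ne_zero hω0 h3)]
      have he : Complex.exp (Complex.log p.2 + k * (c / N)) = ω * p.2 := by
        rw [Complex.exp_add, Complex.exp_log h3, Complex.exp_nat_mul, ← hk, hcdef, mul_comm]
      have h4 := hΞe i p.1 (Complex.log p.2 + k * (c / N)) hp.1 (by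
        rw [he, norm_mul, hω1, one_mul]; exact hp.2)
      rw [he] at h4
      rw [h4]
      have h5 := hpow k i _ (hlogU p hp.1 hp.2 h3)
      simp only at h5
      show _ = y _ (p.1, N * Complex.log p.2)
      rw [← h5]
      congr 2
      field_simp
  · have hz : Filter.Tendsto (fun z : (Fin q → ℂ) × (ℂ × ℂ) => (z.1, z.2.1)) (nhds 0) (nhds 0) := by
      have : Continuous (fun z : (Fin q → ℂ) × (ℂ × ℂ) => (z.1, z.2.1)) := by fun_prop
      exact this.tendsto' 0 0 rfl
    filter_upwards [hSa, hz.eventually (eventually_forall_pow_eq (N := N) hfull)] with z h1 h2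
    rw [h1]
    have key : ∀ τ : ℂ, τ ^ N = z.2.1 →
        (eval z.2.2 (mkPoly d fun i => a i (z.1, z.2.1)) = 0 ↔ ∃ i, ξ i (z.1, τ) = z.2.2) := by
      intro τ hτ
      have h3 := h2 τ hτ
      simp only [hτ] at h3
      rw [h3, eval_prod, Finset.prod_eq_zero_iff]
      simp only [eval_sub, eval_X, eval_C, sub_eq_zero, Finset.mem_univ, true_and]
      exact exists_congr fun _ => eq_comm
    constructor
    · intro h
      obtain ⟨τ, hτ⟩ := IsAlgClosed.exists_pow_nat_eq z.2.1 hN0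
      obtain ⟨i, hi⟩ := (key τ hτ).1 h
      exact ⟨i, τ, hτ, hi⟩
    · rintro ⟨i, τ, hτ, hi⟩
      exact (key τ hτ).2 ⟨i, hi⟩

end PuiseuxSplitting

section NormalForms

variable {E : Type*} [NormedAddCommGroup E] [NormedSpace ℂ E] [FiniteDimensional ℂ E]

/-- `V` is covered near the origin by finitely many branches `(t, τ) ↦ (t, τ ^ k • w)` with `w`
non vanishing, that is, by branches tangent to the same cone over each `t`. -/
def NForm (V : Set (E × (ℂ × ℂ))) : Prop :=
  ∃ (ι : Type) (_ : Finite ι) (_ : Nonempty ι) (k : ι → ℕ) (w : ι → E × ℂ → ℂ × ℂ),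
    (∀ i, 0 < k i ∧ AnalyticAt ℂ (w i) 0 ∧ w i 0 ≠ 0) ∧
    (∀ i, ∀ᶠ p in nhds (0 : E × ℂ), (p.1, p.2 ^ k i • w i p) ∈ V) ∧
    ∀ U ∈ nhds (0 : E × ℂ), ∀ᶠ z in nhds (0 : E × (ℂ × ℂ)), z ∈ V →
      ∃ i, ∃ τ : ℂ, (z.1, τ) ∈ U ∧ z.2 = τ ^ k i • w i (z.1, τ)

/-- `V` is, in suitable linear coordinates, parametrised near the origin by finitely many
branches `(τ ^ N, τ ^ N * s)` which only meet over `τ = 0`. -/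
def TForm (V : Set (E × (ℂ × ℂ))) : Prop :=
  ∃ (L : (ℂ × ℂ) ≃L[ℂ] (ℂ × ℂ)) (N d : ℕ), 0 < N ∧ 0 < d ∧ ∃ s : Fin d → E × ℂ → ℂ,
    (∀ i, AnalyticAt ℂ (s i) 0) ∧
    (∀ i j, i ≠ j → ∀ᶠ p in nhds (0 : E × ℂ), p.2 ≠ 0 → s i p ≠ s j p) ∧
    (∀ ω : ℂ, ω ^ N = 1 → ∀ i, ∃ j, ∀ᶠ p in nhds (0 : E × ℂ), s i (p.1, ω * p.2) = s j p) ∧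
    ∀ᶠ z in nhds (0 : E × (ℂ × ℂ)), z ∈ V ↔
      ∃ i, ∃ τ : ℂ, τ ^ N = (L z.2).1 ∧ τ ^ N * s i (z.1, τ) = (L z.2).2

theorem exists_shear (S : Finset (ℂ × ℂ)) (h : ∀ w ∈ S, w ≠ 0) :
    ∃ L : (ℂ × ℂ) ≃L[ℂ] (ℂ × ℂ), ∀ w ∈ S, (L w).1 ≠ 0 := by
  obtain ⟨c, hc⟩ := Infinite.exists_notMem_finset (S.image fun w => -w.1 / w.2)
  let f : (ℂ × ℂ) →L[ℂ] (ℂ × ℂ) :=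
    (ContinuousLinearMap.fst ℂ ℂ ℂ + c • ContinuousLinearMap.snd ℂ ℂ ℂ).prod
      (ContinuousLinearMap.snd ℂ ℂ ℂ)
  let g : (ℂ × ℂ) →L[ℂ] (ℂ × ℂ) :=
    (ContinuousLinearMap.fst ℂ ℂ ℂ - c • ContinuousLinearMap.snd ℂ ℂ ℂ).prod
      (ContinuousLinearMap.snd ℂ ℂ ℂ)
  refine ⟨ContinuousLinearEquiv.equivOfInverse f g (fun x => by simp [f, g])
    (fun x => by simp [f, g]), fun w hw h0 => ?_⟩
  have h1 : w.1 + c * w.2 = 0 := h0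
  rcases eq_or_ne w.2 0 with h2 | h2
  · rw [h2, mul_zero, add_zero] at h1
    exact h w hw (Prod.ext h1 h2)
  · refine hc (Finset.mem_image.2 ⟨w, hw, ?_⟩)
    field_simp
    linear_combination -h1

/-- In suitable linear coordinates the first coordinate of each branch is a power of the
parameter. -/
theorem NForm.exists_normalized {V : Set (E × (ℂ × ℂ))} (hV : NForm V) :
    ∃ (L : (ℂ × ℂ) ≃L[ℂ] (ℂ × ℂ)) (ι : Type) (_ : Finite ι) (_ : Nonempty ι) (k : ι → ℕ)
      (s : ι → E × ℂ → ℂ), (∀ i, 0 < k i ∧ AnalyticAt ℂ (s i) 0) ∧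
      (∀ i, ∀ᶠ p in nhds (0 : E × ℂ), (p.1, L.symm (p.2 ^ k i, p.2 ^ k i * s i p)) ∈ V) ∧
      ∀ᶠ z in nhds (0 : E × (ℂ × ℂ)), z ∈ V →
        ∃ i, ∃ τ : ℂ, L z.2 = (τ ^ k i, τ ^ k i * s i (z.1, τ)) := by
  obtain ⟨ι, hfin, hne, k, w, hw, hin, hcov⟩ := hV
  have := Fintype.ofFinite ι
  obtain ⟨L, hL⟩ := exists_shear (Finset.univ.image fun i => w i 0) (by
    simp only [Finset.mem_image, Finset.mem_univ, true_and]
    rintro _ ⟨i, rfl⟩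
    exact (hw i).2.2)
  have hL' : ∀ i, (L (w i 0)).1 ≠ 0 := fun i => hL _ (Finset.mem_image_of_mem _ (Finset.mem_univ i))
  have hLan : ∀ i, AnalyticAt ℂ (fun p => L (w i p)) 0 := fun i =>
    ((L : (ℂ × ℂ) →L[ℂ] (ℂ × ℂ)).analyticAt (w i 0)).comp_of_eq (hw i).2.1 rfl
  have key : ∀ i, ∃ s : E × ℂ → ℂ, AnalyticAt ℂ s 0 ∧
      (∀ᶠ p in nhds (0 : E × ℂ), (p.1, L.symm (p.2 ^ k i, p.2 ^ k i * s p)) ∈ V) ∧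
      ∀ᶠ p in nhds (0 : E × ℂ), ∃ σ : ℂ,
        L (p.2 ^ k i • w i p) = (σ ^ k i, σ ^ k i * s (p.1, σ)) := by
    intro i
    have hu : AnalyticAt ℂ (fun p => (L (w i p)).1) 0 := (hLan i).fun_fst
    obtain ⟨v, hv, hv0, hvk⟩ := hu.exists_pow_eq (hL' i) (hw i).1
    obtain ⟨θ, hθ, hθ0, h1, h2, -⟩ := hv.exists_inverse_mul hv0
    have hθ' : AnalyticAt ℂ (fun p => (p.1, θ p)) 0 := analyticAt_fst.prod hθ
    have hθ0' : ((0 : E × ℂ).1, θ 0) = (0 : E × ℂ) := by rw [hθ0]; rfl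
    have hθt : Filter.Tendsto (fun p => (p.1, θ p)) (nhds (0 : E × ℂ)) (nhds 0) := by
      have := hθ'.continuousAt.tendsto
      simp only [hθ0'] at this
      exact this
    have hne : ∀ᶠ p in nhds (0 : E × ℂ), (L (w i p)).1 ≠ 0 := hu.continuousAt.eventually_ne (hL' i)
    have hrat : AnalyticAt ℂ (fun p => (L (w i p)).2 / (L (w i p)).1) 0 :=
      (hLan i).fun_snd.div hu (hL' i)
    have hLs : ∀ p τ, (L (w i p)).1 ≠ 0 → L (τ ^ k i • w i p) =
        ((τ * v p) ^ k i, (τ * v p) ^ k i * ((L (w i p)).2 / (L (w i p)).1)) := by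
      intro p τ hp
      rw [map_smul, mul_pow, hvk]
      refine Prod.ext ?_ ?_
      · simp
      · simp; field_simp
    refine ⟨fun p => (L (w i (p.1, θ p))).2 / (L (w i (p.1, θ p))).1,
      hrat.comp_of_eq hθ' hθ0', ?_, ?_⟩
    · filter_upwards [h1, hθt.eventually (hin i), hθt.eventually hne] with p hp1 hp2 hp3
      convert hp2 using 2
      rw [L.symm_apply_eq, hLs _ _ hp3, hp1]
    · filter_upwards [h2, hne] with p hp1 hp2
      exact ⟨p.2 * v p, by rw [hLs _ _ hp2, hp1]⟩
  choose s hs hsV hsc using key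
  refine ⟨L, ι, hfin, hne, k, s, fun i => ⟨(hw i).1, hs i⟩, hsV, ?_⟩
  filter_upwards [hcov _ (Filter.eventually_all.2 hsc)] with z hz hzV
  obtain ⟨i, τ, hU, he⟩ := hz hzV
  obtain ⟨σ, hσ⟩ := hU i
  exact ⟨i, σ, by rw [he]; exact hσ⟩

end NormalForms

section Branches

variable {E : Type*} [NormedAddCommGroup E] [NormedSpace ℂ E] [FiniteDimensional ℂ E]

/-- Two branches lying over the same parameter in the zero set of a submersion and meeting at a
point off the discriminant coincide near that point. -/
theorem eventuallyEq_of_fderiv_ne_zero {Z X : Type*} [NormedAddCommGroup Z] [NormedSpace ℂ Z]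
    [NormedAddCommGroup X] [NormedSpace ℂ X] [FiniteDimensional ℂ X] {Q : X × ℂ → ℂ} {f : Z → X}
    {y y' : Z → ℂ} {p : Z} (hf : AnalyticAt ℂ f p) (hsurj : Function.Surjective (fderiv ℂ f p))
    (hy : AnalyticAt ℂ y p) (hy' : AnalyticAt ℂ y' p) (hQ : AnalyticAt ℂ Q (f p, y p))
    (hd : fderiv ℂ Q (f p, y p) ≠ 0) (h : ∀ᶠ z in nhds p, Q (f z, y z) = 0)
    (h' : ∀ᶠ z in nhds p, Q (f z, y' z) = 0) (heq : y p = y' p) : ∀ᶠ z in nhds p, y z = y' z := by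
  have hdy : fderiv ℂ Q (f p, y p) (0, 1) ≠ 0 := by
    intro h0
    have h01 : ∀ s : ℂ, fderiv ℂ Q (f p, y p) (0, s) = 0 := fun s => by
      rw [show ((0 : X), s) = s • ((0 : X), (1 : ℂ)) by simp, map_smul, h0, smul_zero]
    refine hd (ContinuousLinearMap.ext ?_)
    rintro ⟨v, s⟩
    obtain ⟨ζ, rfl⟩ := hsurj v
    have h1 := hQ.differentiableAt.hasFDerivAt.comp p
      (hf.differentiableAt.hasFDerivAt.prodMk hy.differentiableAt.hasFDerivAt)
    have h2 : fderiv ℂ (fun z => Q (f z, y z)) p = 0 := by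
      rw [Filter.EventuallyEq.fderiv_eq (f := fun _ => (0 : ℂ)) h]; simp
    have h3 := h1.fderiv.symm.trans h2
    have h4 := congrArg (fun l => l ζ) h3
    simp only [ContinuousLinearMap.comp_apply, ContinuousLinearMap.prod_apply,
      zero_apply] at h4
    rw [show (fderiv ℂ f p ζ, s) = (fderiv ℂ f p ζ, fderiv ℂ y p ζ) + (0, s - fderiv ℂ y p ζ) by
      simp, map_add, h4, h01]
    simp
  obtain ⟨φ, -, -, hφ⟩ := hQ.exists_implicit hdy
  have hQ0 := h.self_of_nhds
  have hc : Filter.Tendsto (fun z => (f z, y z)) (nhds p) (nhds (f p, y p)) :=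
    (hf.continuousAt.prodMk hy.continuousAt)
  have hc' : Filter.Tendsto (fun z => (f z, y' z)) (nhds p) (nhds (f p, y p)) := by
    rw [heq]; exact (hf.continuousAt.prodMk hy'.continuousAt)
  filter_upwards [hc.eventually hφ, hc'.eventually hφ, h, h'] with z h1 h2 h3 h4
  rw [h1.1 (h3.trans hQ0.symm), h2.1 (h4.trans hQ0.symm)]

theorem fderiv_fst_pow_surjective (p : E × ℂ) (hp : p.2 ≠ 0) {N : ℕ} (hN : 0 < N) :
    Function.Surjective (fderiv ℂ (fun p : E × ℂ => (p.1, p.2 ^ N)) p) := by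
  have h1 := (hasFDerivAt_fst (𝕜 := ℂ) (p := p)).prodMk
    ((hasFDerivAt_snd (𝕜 := ℂ) (p := p)).pow N)
  rw [h1.fderiv]
  rintro ⟨v, s⟩
  refine ⟨(v, s / (N * p.2 ^ (N - 1))), ?_⟩
  have : (N : ℂ) ≠ 0 := by exact_mod_cast hN.ne'
  have : p.2 ^ (N - 1) ≠ 0 := pow_ne_zero _ hp
  simp
  field_simp

/-- Finitely many germs contain a duplicate-free subfamily. -/
theorem exists_distinct_germs {X Y J : Type*} [Finite J] [Nonempty J] (l : Filter X)
    (s : J → X → Y) : ∃ (d : ℕ) (c : Fin d → J), 0 < d ∧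
      (∀ i j, i ≠ j → ¬ s (c i) =ᶠ[l] s (c j)) ∧ ∀ j, ∃ i, s j =ᶠ[l] s (c i) := by
  let S : Setoid J := ⟨fun i j => s i =ᶠ[l] s j, ⟨fun _ => Filter.EventuallyEq.rfl,
    fun h => h.symm, fun h h' => h.trans h'⟩⟩
  obtain ⟨d, ⟨e⟩⟩ := Finite.exists_equiv_fin (Quotient S)
  have hQ : Nonempty (Quotient S) := (inferInstance : Nonempty J).map (Quotient.mk S)
  refine ⟨d, fun i => (e.symm i).out, ?_, fun i j hij h => hij ?_, fun j => ⟨e ⟦j⟧, ?_⟩⟩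
  · have : Nonempty (Fin d) := e.nonempty_congr.1 inferInstance
    exact Fin.pos_iff_nonempty.2 this
  · refine e.symm.injective (Quotient.out_equiv_out.1 h)
  · show s j =ᶠ[l] s ((e.symm (e ⟦j⟧)).out)
    rw [e.symm_apply_apply]
    exact (Quotient.mk_out (s := S) j).symm

theorem NForm.tForm {V : Set (E × (ℂ × ℂ))} (hV : NForm V) {F : E × (ℂ × ℂ) → ℂ}
    (hF : AnalyticAt ℂ F 0) (hVF : ∀ᶠ z in nhds (0 : E × (ℂ × ℂ)), z ∈ V ↔ F z = 0)
    (hsm : ∀ᶠ z in nhds (0 : E × (ℂ × ℂ)), z.2 ≠ 0 → F z = 0 → fderiv ℂ F z ≠ 0) : TForm V := by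
  obtain ⟨L, ι, hfin, hne, k, r, hr, hin, hcov⟩ := hV.exists_normalized
  have := Fintype.ofFinite ι
  set N := ∏ i, k i with hN
  have hN0 : 0 < N := Finset.prod_pos fun i _ => (hr i).1
  have hkN : ∀ i, ∃ e, 0 < e ∧ e * k i = N := fun i => by
    obtain ⟨e, he⟩ := Finset.dvd_prod_of_mem k (Finset.mem_univ i)
    refine ⟨e, Nat.pos_of_ne_zero ?_, by rw [hN, he, mul_comm]⟩
    rintro rfl
    rw [← hN] at he; omega
  choose e he0 heN using hkN
  let J := ι × {ω : ℂ // ω ^ N = 1}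
  have hJ : Finite {ω : ℂ // ω ^ N = 1} := (finite_pow_eq N hN0 1).to_subtype
  have hJn : Nonempty {ω : ℂ // ω ^ N = 1} := ⟨1, one_pow N⟩
  let σ : J → E × ℂ → ℂ := fun j p => r j.1 (p.1, (j.2 * p.2) ^ e j.1)
  have hpowan : ∀ j : J, AnalyticAt ℂ (fun p : E × ℂ => (p.1, ((j.2 : ℂ) * p.2) ^ e j.1)) 0 :=
    fun j => by fun_prop
  have hpow0 : ∀ j : J, ((0 : E × ℂ).1, ((j.2 : ℂ) * (0 : E × ℂ).2) ^ e j.1) = (0 : E × ℂ) :=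
    fun j => by simp [(he0 j.1).ne']
  have hσ : ∀ j, AnalyticAt ℂ (σ j) 0 := fun j => (hr j.1).2.comp_of_eq (hpowan j) (hpow0 j)
  have hσV : ∀ j, ∀ᶠ p in nhds (0 : E × ℂ), (p.1, L.symm (p.2 ^ N, p.2 ^ N * σ j p)) ∈ V := by
    intro j
    have ht : Filter.Tendsto (fun p : E × ℂ => (p.1, ((j.2 : ℂ) * p.2) ^ e j.1)) (nhds 0)
        (nhds 0) := by
      have := (hpowan j).continuousAt.tendsto
      simp only [hpow0 j] at this
      exact this
    filter_upwards [ht.eventually (hin j.1)] with p hp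
    have h1 : ((j.2 * p.2) ^ e j.1) ^ k j.1 = p.2 ^ N := by
      rw [← pow_mul, heN, mul_pow, j.2.2, one_mul]
    simp only [h1] at hp
    exact hp
  -- dichotomy
  have hγ : ∀ j, Filter.Tendsto (fun p : E × ℂ => (p.1, L.symm (p.2 ^ N, p.2 ^ N * σ j p)))
      (nhds 0) (nhds 0) := by
    intro j
    have : ContinuousAt (fun p : E × ℂ => (p.1, L.symm (p.2 ^ N, p.2 ^ N * σ j p))) 0 := by
      refine continuousAt_fst.prodMk (L.symm.continuous.continuousAt.comp ?_)
      have := (hσ j).continuousAt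
      fun_prop
    refine this.tendsto.mono_right (congrArg nhds ?_).le
    have h0 : L.symm ((0 : ℂ), (0 : ℂ)) = 0 := map_zero L.symm
    simp [hN0.ne', h0, Prod.ext_iff]
  obtain ⟨R, hR, H⟩ := eventually_prod_nhds_zero_iff.1
    ((Filter.eventually_all.2 fun j => (hσ j).eventually_analyticAt).and
      ((Filter.eventually_all.2 hσV).and (Filter.eventually_all.2 fun j =>
        (hγ j).eventually ((hVF.and hsm).and hF.eventually_analyticAt))))
  set B : Set (E × ℂ) := Metric.ball 0 R ×ˢ Metric.ball 0 R with hB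
  have hBo : IsOpen B := Metric.isOpen_ball.prod Metric.isOpen_ball
  have hB0 : (0 : E × ℂ) ∈ B := ⟨by simpa using hR, by simpa using hR⟩
  have hBc : IsPreconnected B := by
    let := NormedSpace.restrictScalars ℝ ℂ E
    exact ((convex_ball (0 : E) R).isPreconnected).prod ((convex_ball (0 : ℂ) R).isPreconnected)
  have hBH : ∀ p ∈ B, _ := fun p hp => H p.1 p.2 (by simpa using hp.1) (by simpa using hp.2)
  have hdich : ∀ j j', ¬ σ j =ᶠ[nhds 0] σ j' →
      ∀ᶠ p in nhds (0 : E × ℂ), p.2 ≠ 0 → σ j p ≠ σ j' p := by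
    intro j j' hjj
    filter_upwards [hBo.mem_nhds hB0] with p hp hp2 heq
    refine hjj ?_
    have hev : ∀ᶠ z in nhds p, p.2 ^ N * σ j z = p.2 ^ N * σ j z ∧ z ∈ B ∧ z.2 ≠ 0 := by
      filter_upwards [hBo.mem_nhds hp, continuousAt_snd.eventually_ne hp2] with z h h'
      exact ⟨rfl, h, h'⟩
    set Q : (E × ℂ) × ℂ → ℂ := fun w => F (w.1.1, L.symm (w.1.2, w.2)) with hQ
    let A : ((E × ℂ) × ℂ) ≃L[ℂ] (E × (ℂ × ℂ)) :=
      (ContinuousLinearEquiv.prodAssoc ℂ E ℂ ℂ).trans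
        ((ContinuousLinearEquiv.refl ℂ E).prodCongr L.symm)
    have hQA : Q = F ∘ A := rfl
    obtain ⟨h1, h2, h3⟩ := hBH p hp
    obtain ⟨⟨h4, h5⟩, h6⟩ := h3 j
    have hz0 : ∀ i, ∀ᶠ z in nhds p, Q ((z.1, z.2 ^ N), z.2 ^ N * σ i z) = 0 := by
      intro i
      filter_upwards [hBo.mem_nhds hp] with z hz
      obtain ⟨h1, h2, h3⟩ := hBH z hz
      exact (h3 i).1.1.1 (h2 i)
    have hne0 : (p.1, L.symm (p.2 ^ N, p.2 ^ N * σ j p)).2 ≠ 0 := by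
      simp [hp2, hN0.ne']
    have hdF := h5 hne0 (h4.1 (h2 j))
    have hyan : ∀ i, AnalyticAt ℂ (fun z : E × ℂ => z.2 ^ N * σ i z) p := fun i =>
      (analyticAt_snd.pow N).mul (h1 i)
    have := eventuallyEq_of_fderiv_ne_zero (Q := Q) (f := fun z : E × ℂ => (z.1, z.2 ^ N))
      (by fun_prop) (fderiv_fst_pow_surjective p hp2 hN0) (hyan j) (hyan j')
      (by
        rw [hQA]
        exact AnalyticAt.comp h6 (A.toContinuousLinearMap.analyticAt _))
      (by
        rw [hQA]
        intro h0
        have h7 : fderiv ℂ (F ∘ A) ((p.1, p.2 ^ N), p.2 ^ N * σ j p) =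
            (fderiv ℂ F (A ((p.1, p.2 ^ N), p.2 ^ N * σ j p))).comp A.toContinuousLinearMap :=
          A.comp_right_fderiv
        rw [h7] at h0
        refine hdF (ContinuousLinearMap.ext fun v => ?_)
        have := congrArg (fun l => l (A.symm v)) h0
        simpa [A] using this) (hz0 j) (hz0 j') (by rw [heq])
    have h8 : σ j =ᶠ[nhds p] σ j' := by
      filter_upwards [this, hev] with z hz hz2
      exact mul_left_cancel₀ (pow_ne_zero N hz2.2.2) hz
    have h9 := AnalyticOnNhd.eqOn_of_preconnected_of_eventuallyEq (f := σ j) (g := σ j')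
      (fun z hz => (hBH z hz).1 j) (fun z hz => (hBH z hz).1 j') hBc hp h8
    exact Filter.eventually_of_mem (hBo.mem_nhds hB0) h9
  obtain ⟨d, c, hd, hc, hcs⟩ := exists_distinct_germs (nhds (0 : E × ℂ)) σ
  refine ⟨L, N, d, hN0, hd, fun i => σ (c i), fun i => hσ _, fun i j hij => hdich _ _ (hc i j hij),
    fun ω hω i => ?_, ?_⟩
  · have hm : ((c i).2 * ω : ℂ) ^ N = 1 := by rw [mul_pow, hω, (c i).2.2, one_mul]
    obtain ⟨j, hj⟩ := hcs ((c i).1, ⟨(c i).2 * ω, hm⟩)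
    refine ⟨j, ?_⟩
    filter_upwards [hj] with p hp
    rw [← hp]
    simp only [σ]
    rw [mul_assoc]
  · have hcs' : ∀ᶠ p in nhds (0 : E × ℂ), ∀ j, ∃ i, σ j p = σ (c i) p :=
      Filter.eventually_all.2 fun j => (hcs j).elim fun i hi => hi.mono fun p hp => ⟨i, hp⟩
    have hz : Filter.Tendsto (fun z : E × (ℂ × ℂ) => (z.1, (L z.2).1)) (nhds 0) (nhds 0) := by
      have : Continuous (fun z : E × (ℂ × ℂ) => (z.1, (L z.2).1)) := by
        have := L.continuous
        fun_prop
      exact this.tendsto' 0 0 (by simp)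
    filter_upwards [hcov, hz.eventually (eventually_forall_pow_eq (N := N)
      ((Filter.eventually_all.2 hσV).and hcs'))]
      with z h1 h2
    constructor
    · intro hzV
      obtain ⟨i, τ, hτ⟩ := h1 hzV
      obtain ⟨ρ, hρ⟩ := IsAlgClosed.exists_pow_nat_eq τ (he0 i)
      have hρN : ρ ^ N = (L z.2).1 := by rw [hτ, ← heN i, pow_mul, hρ]
      obtain ⟨j, hj⟩ := (h2 ρ hρN).2 (i, ⟨1, one_pow N⟩)
      refine ⟨j, ρ, hρN, ?_⟩
      rw [← hj]
      simp only [σ, one_mul, hρ]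
      rw [hρN, hτ]
    · rintro ⟨i, ρ, hρ, hρ2⟩
      have := (h2 ρ hρ).1 (c i)
      rw [hρ2] at this
      simp only [hρ] at this
      simpa using this

end Branches

section Transfer

variable {E : Type*} [NormedAddCommGroup E] [NormedSpace ℂ E]

theorem AnalyticAt.tendsto_of_eq {X Y : Type*} [NormedAddCommGroup X] [NormedSpace ℂ X]
    [NormedAddCommGroup Y] [NormedSpace ℂ Y] {f : X → Y} {x : X} {y : Y} (hf : AnalyticAt ℂ f x)
    (h : f x = y) : Filter.Tendsto f (nhds x) (nhds y) :=
  h ▸ hf.continuousAt.tendsto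

theorem AnalyticAt.exists_eq_pow_mul_comp {Y : Type*} [NormedAddCommGroup Y] [NormedSpace ℂ Y]
    {f : E × Y → ℂ} (hf : AnalyticAt ℂ f 0) (h0 : ∀ᶠ t in nhds (0 : E), f (t, 0) = 0)
    {v : E × ℂ → Y} (hv : AnalyticAt ℂ v 0) {k : ℕ} (hk : 0 < k) :
    ∃ w : E × ℂ → ℂ, AnalyticAt ℂ w 0 ∧
      ∀ᶠ p in nhds (0 : E × ℂ), f (p.1, p.2 ^ k • v p) = p.2 ^ k * w p := by
  have hG : AnalyticAt ℂ (fun g : (E × ℂ) × ℂ => f (g.1.1, g.2 • v g.1)) 0 := by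
    have h1 : AnalyticAt ℂ (fun g : (E × ℂ) × ℂ => v g.1) 0 := hv.comp_of_eq analyticAt_fst rfl
    exact hf.comp_of_eq (f := fun g : (E × ℂ) × ℂ => (g.1.1, g.2 • v g.1)) (by fun_prop) (by simp)
  have hfst : Filter.Tendsto (fun p : E × ℂ => p.1) (nhds 0) (nhds 0) :=
    continuous_fst.tendsto' 0 0 rfl
  obtain ⟨g, hg, hgG⟩ := hG.exists_eq_snd_mul (by simpa using hfst.eventually h0)
  have hc : AnalyticAt ℂ (fun p : E × ℂ => (p, p.2 ^ k)) 0 := by fun_prop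
  have hc0 : ((0 : E × ℂ), (0 : E × ℂ).2 ^ k) = 0 := by simp [hk.ne']
  exact ⟨fun p => g (p, p.2 ^ k), hg.comp_of_eq hc hc0, (hc.tendsto_of_eq hc0).eventually hgG⟩

theorem AnalyticAt.exists_eq_pow_smul_comp {Y : Type*} [NormedAddCommGroup Y] [NormedSpace ℂ Y]
    {f : E × Y → ℂ × ℂ} (hf : AnalyticAt ℂ f 0) (h0 : ∀ᶠ t in nhds (0 : E), f (t, 0) = 0)
    {v : E × ℂ → Y} (hv : AnalyticAt ℂ v 0) {k : ℕ} (hk : 0 < k) :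
    ∃ w : E × ℂ → ℂ × ℂ, AnalyticAt ℂ w 0 ∧
      ∀ᶠ p in nhds (0 : E × ℂ), f (p.1, p.2 ^ k • v p) = p.2 ^ k • w p := by
  obtain ⟨w₁, h1, hw1⟩ := hf.fun_fst.exists_eq_pow_mul_comp
    (h0.mono fun t ht => by rw [ht]; rfl) hv hk
  obtain ⟨w₂, h2, hw2⟩ := hf.fun_snd.exists_eq_pow_mul_comp
    (h0.mono fun t ht => by rw [ht]; rfl) hv hk
  refine ⟨fun p => (w₁ p, w₂ p), h1.prod h2, ?_⟩
  filter_upwards [hw1, hw2] with p hp1 hp2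
  exact Prod.ext hp1 hp2

/-- A family of germs of curves can be parametrised so that the parameter space maps
identically to the base. -/
theorem exists_reparam {X : Type*} [NormedAddCommGroup X] [NormedSpace ℂ X]
    [FiniteDimensional ℂ E] {T : E × ℂ → E} (hT : AnalyticAt ℂ T 0) (hT0 : T 0 = 0)
    {R : E → E} (hR : AnalyticAt ℂ R 0) (hRT : ∀ᶠ t in nhds (0 : E), R (T (t, 0)) = t)
    {w : E × ℂ → X} (hw : AnalyticAt ℂ w 0) :
    ∃ (w' : E × ℂ → X) (θ : E × ℂ → E), AnalyticAt ℂ w' 0 ∧ w' 0 = w 0 ∧ AnalyticAt ℂ θ 0 ∧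
      θ 0 = 0 ∧ (∀ᶠ p in nhds (0 : E × ℂ), T (θ p, p.2) = p.1 ∧ w' p = w (θ p, p.2)) ∧
      ∀ᶠ p in nhds (0 : E × ℂ), w' (T p, p.2) = w p := by
  have hi : ∀ v, fderiv ℂ T 0 (v, 0) = 0 → v = 0 := by
    intro v hv
    have hl : HasFDerivAt (fun t : E => (t, (0 : ℂ))) (ContinuousLinearMap.inl ℂ E ℂ) 0 :=
      (ContinuousLinearMap.inl ℂ E ℂ).hasFDerivAt
    have h1 := HasFDerivAt.comp (0 : E) (g := T)
      (show HasFDerivAt T (fderiv ℂ T 0) (0, 0) from hT.differentiableAt.hasFDerivAt) hl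
    have h2 := HasFDerivAt.comp (0 : E) (g := R) (f := T ∘ fun t : E => (t, (0 : ℂ)))
      (show HasFDerivAt R (fderiv ℂ R 0) (T (0, 0)) from by
        rw [show T (0, 0) = 0 from hT0]; exact hR.differentiableAt.hasFDerivAt) h1
    have h3 := (h2.congr_of_eventuallyEq (f₁ := fun t => t)
      (hRT.mono fun t ht => ht.symm)).unique (hasFDerivAt_id (0 : E))
    have h4 := congrArg (fun l => l v) h3
    simpa [hv] using h4.symm
  obtain ⟨θ, hθ, hθ0, h1, h2⟩ := hT.exists_inverse_left hT0 hi
  have hθ' : AnalyticAt ℂ (fun p => (θ p, p.2)) 0 := hθ.prod analyticAt_snd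
  have hθ0' : (θ 0, (0 : E × ℂ).2) = 0 := by rw [hθ0]; rfl
  refine ⟨fun p => w (θ p, p.2), θ, hw.comp_of_eq hθ' hθ0', by simp only [hθ0'], hθ, hθ0,
    h1.mono fun p hp => ⟨hp, rfl⟩, h2.mono fun p hp => by simp only [hp]⟩

/-- A Puiseux branch tangent to a conjugate of itself to a constant order, or equal to it, is
of the form `τ ^ k • v` with `v` non vanishing. -/
theorem exists_eq_pow_smul_of_conjugates {N : ℕ} (hN : 0 < N) {f : E × ℂ → ℂ}
    (hf : AnalyticAt ℂ f 0) (h0 : ∀ᶠ t in nhds (0 : E), f (t, 0) = 0)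
    (hω : ∀ ω : ℂ, ω ^ N = 1 → (∀ᶠ p in nhds (0 : E × ℂ), f (p.1, ω * p.2) = f p) ∨
      ∀ᶠ p in nhds (0 : E × ℂ), p.2 ≠ 0 → f (p.1, ω * p.2) ≠ f p) :
    ∃ (k : ℕ) (v : E × ℂ → ℂ × ℂ), 0 < k ∧ AnalyticAt ℂ v 0 ∧ v 0 ≠ 0 ∧
      ∀ᶠ p in nhds (0 : E × ℂ), (p.2 ^ N, f p) = p.2 ^ k • v p := by
  let P : ℕ → Prop := fun m => ∃ g, AnalyticAt ℂ g (0 : E × ℂ) ∧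
    ∀ᶠ p in nhds (0 : E × ℂ), f p = p.2 ^ m * g p
  have hP1 : P 1 := by
    obtain ⟨g, hg, h⟩ := hf.exists_eq_snd_mul h0
    exact ⟨g, hg, by simpa using h⟩
  obtain ⟨g, hg, hfg⟩ : P (Nat.findGreatest P N) := Nat.findGreatest_spec hN hP1
  have hm1 : 1 ≤ Nat.findGreatest P N := Nat.le_findGreatest hN hP1
  have hmN : Nat.findGreatest P N ≤ N := Nat.findGreatest_le N
  have hmax : ∀ n, Nat.findGreatest P N < n → n ≤ N → ¬ P n := fun n =>
    Nat.findGreatest_is_greatest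
  set m := Nat.findGreatest P N
  refine ⟨m, fun p => (p.2 ^ (N - m), g p), hm1, by fun_prop, ?_, ?_⟩
  swap
  · filter_upwards [hfg] with p hp
    simp only [Prod.smul_mk, smul_eq_mul, ← pow_add, hp, Nat.add_sub_cancel' hmN]
  rcases hmN.eq_or_lt with h | hlt
  · simp [h]
  suffices g 0 ≠ 0 by
    intro h; exact this (congrArg Prod.snd h)
  have hg0 : ¬ ∀ᶠ t in nhds (0 : E), g (t, 0) = 0 := by
    intro h
    obtain ⟨g', hg', hgg⟩ := hg.exists_eq_snd_mul h
    refine hmax (m + 1) (Nat.lt_succ_self _) hlt ⟨g', hg', ?_⟩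
    filter_upwards [hfg, hgg] with p h1 h2
    rw [h1, h2]; ring
  have hprim := Complex.isPrimitiveRoot_exp N hN.ne'
  set ω := Complex.exp (2 * Real.pi * Complex.I / N)
  have hωm : ω ^ m ≠ 1 := hprim.pow_ne_one_of_pos_of_lt (by omega) hlt
  have hgω : AnalyticAt ℂ (fun p : E × ℂ => g (p.1, ω * p.2)) 0 :=
    hg.comp_of_eq (f := fun p : E × ℂ => (p.1, ω * p.2)) (by fun_prop) (by simp)
  have hh : AnalyticAt ℂ (fun p : E × ℂ => ω ^ m * g (p.1, ω * p.2) - g p) 0 :=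
    (analyticAt_const.fun_mul hgω).fun_sub hg
  have hfh : ∀ᶠ p in nhds (0 : E × ℂ), f (p.1, ω * p.2) - f p =
      p.2 ^ m * (ω ^ m * g (p.1, ω * p.2) - g p) := by
    filter_upwards [hfg, (tendsto_fst_mul ω).eventually hfg] with p h1 h2
    rw [h1, h2]; ring
  have hcontra : ¬ ∀ᶠ t in nhds (0 : E), ω ^ m * g (t, ω * 0) - g (t, 0) = 0 := by
    intro h
    refine hg0 (h.mono fun t ht => ?_)
    rw [mul_zero, ← sub_one_mul] at ht
    exact (mul_eq_zero.1 ht).resolve_left (sub_ne_zero.2 hωm)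
  rcases hω ω hprim.pow_eq_one with h | h
  · refine absurd ?_ hcontra
    have h1 := hh.eventuallyEq_of_off (g := fun _ => 0) analyticAt_const (by
      filter_upwards [h, hfh] with p h1 h2 h3
      rw [h1, sub_self, eq_comm] at h2
      exact (mul_eq_zero.1 h2).resolve_left (pow_ne_zero _ h3))
    exact tendsto_prodMk_zero.eventually h1
  · obtain ⟨e, u, hu, hu0, hhu⟩ := hh.exists_eq_pow_mul_unit (by
      filter_upwards [h, hfh] with p h1 h2 h3 h4
      rw [h4, mul_zero] at h2
      exact h1 h3 (sub_eq_zero.1 h2))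
    rcases Nat.eq_zero_or_pos e with rfl | he
    · have h1 := hhu.self_of_nhds
      intro h2
      rw [show ((0 : E × ℂ).1, ω * (0 : E × ℂ).2) = (0 : E × ℂ) by simp] at h1
      simp [h2] at h1
      exact hu0 h1.symm
    · refine absurd ?_ hcontra
      filter_upwards [tendsto_prodMk_zero.eventually hhu] with t ht
      simpa [he.ne'] using ht

end Transfer

section DimType

variable {q : ℕ}

theorem TForm.dimType1Along {V W : Set ((Fin q → ℂ) × (ℂ × ℂ))} (hV : TForm V)
    (hW : ∀ᶠ z in nhds (0 : (Fin q → ℂ) × (ℂ × ℂ)), z ∈ W ↔ z.2 = 0) :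
    DimType1Along q V W 0 := by
  obtain ⟨L, N, d, hN, hd, s, hs, hne, hω, hVs⟩ := hV
  let A : ((Fin q → ℂ) × (ℂ × ℂ)) ≃L[ℂ] ((Fin q → ℂ) × (ℂ × ℂ)) :=
    (ContinuousLinearEquiv.refl ℂ _).prodCongr L
  have hA : Filter.Tendsto A.symm (nhds 0) (nhds 0) :=
    A.symm.continuous.tendsto' 0 0 (map_zero _)
  refine ⟨A, A.symm, A.toContinuousLinearMap.analyticAt _, map_zero _,
    A.symm.toContinuousLinearMap.analyticAt _, by simp, by simp, ?_, A.symm ⁻¹' V, ?_, by simp⟩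
  · filter_upwards [hW] with z hz
    rw [hz]
    exact (map_eq_zero_iff L L.injective).symm
  refine RForm.eqsFamily ⟨N, d, hN, hd, fun i p => p.2 ^ N * s i p, fun i =>
    ⟨(analyticAt_snd.pow N).mul (hs i), by simp [hN.ne']⟩, fun i j hij => ?_, fun ω h i => ?_, ?_⟩
  · filter_upwards [hne i j hij] with p hp hp2 h
    exact hp hp2 (mul_left_cancel₀ (pow_ne_zero N hp2) h)
  · obtain ⟨j, hj⟩ := hω ω h i
    refine ⟨j, hj.mono fun p hp => ?_⟩
    simp only [hp, mul_pow, h, one_mul]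
  · filter_upwards [hA.eventually hVs] with z hz
    have h1 : L (A.symm z).2 = z.2 := L.apply_symm_apply z.2
    rw [Set.mem_preimage, hz, h1]
    refine exists_congr fun i => exists_congr fun τ => ?_
    rfl

theorem DimType1Along.nForm {V W : Set ((Fin q → ℂ) × (ℂ × ℂ))} (hV : DimType1Along q V W 0)
    (hW : ∀ᶠ z in nhds (0 : (Fin q → ℂ) × (ℂ × ℂ)), z ∈ W ↔ z.2 = 0)
    (hWV : ∀ᶠ z in nhds (0 : (Fin q → ℂ) × (ℂ × ℂ)), z.2 = 0 → z ∈ V) : NForm V := by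
  obtain ⟨Φ, Ψ, hΦ, hΦ0, hΨ, hΨΦ, hΦΨ, hΦW, S, hS, hVS⟩ := hV
  obtain ⟨N, d, hN, hd, ξ, hξ, hne, hω, hSξ⟩ := hS.rForm
  have hΨ0 : Ψ 0 = 0 := by simpa [hΦ0] using hΨΦ.self_of_nhds
  have hΨt := hΨ.tendsto_of_eq hΨ0
  have hΦt := hΦ.tendsto_of_eq hΦ0
  have hΨW : ∀ᶠ t in nhds (0 : Fin q → ℂ), (Ψ (t, 0)).2 = 0 := by
    have h1 : ∀ᶠ w in nhds (0 : (Fin q → ℂ) × (ℂ × ℂ)), w.2 = 0 → (Ψ w).2 = 0 := by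
      filter_upwards [hΦΨ, hΨt.eventually hΦW, hΨt.eventually hW] with w h1 h2 h3 h4
      exact h3.1 (h2.2 (by rw [h1, h4]))
    exact (tendsto_prodMk_zero.eventually h1).mono fun t ht => ht rfl
  have hdiff : ∀ i j, ∀ᶠ t in nhds (0 : Fin q → ℂ), ξ i (t, 0) = ξ j (t, 0) := by
    intro i j
    rcases eq_or_ne i j with rfl | hij
    · simp
    obtain ⟨e, u, hu, hu0, h⟩ := ((hξ i).1.fun_sub (hξ j).1).exists_eq_pow_mul_unit
      ((hne i j hij).mono fun p hp h2 => sub_ne_zero.2 (hp h2))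
    have he : e ≠ 0 := by
      rintro rfl
      have := h.self_of_nhds
      simp [(hξ i).2, (hξ j).2] at this
      exact hu0 this.symm
    exact (tendsto_prodMk_zero.eventually h).mono fun t ht => sub_eq_zero.1 (by simpa [he] using ht)
  have hξ0 : ∀ i, ∀ᶠ t in nhds (0 : Fin q → ℂ), ξ i (t, 0) = 0 := by
    intro i
    have hw : ∀ᶠ w in nhds (0 : (Fin q → ℂ) × (ℂ × ℂ)), w.2 = 0 → w ∈ S := by
      filter_upwards [hΦΨ, hΨt.eventually hΦW, hΨt.eventually hW, hΨt.eventually hWV,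
        hΨt.eventually hVS] with w h1 h2 h3 h4 h5 h6
      have := h5.1 (h4 (h3.1 (h2.2 (by rw [h1, h6]))))
      rwa [h1] at this
    filter_upwards [tendsto_prodMk_zero.eventually hw, tendsto_prodMk_zero.eventually hSξ,
      Filter.eventually_all.2 (hdiff i)] with t h1 h2 h3
    obtain ⟨j, τ, hτ, h⟩ := h2.1 (h1 rfl)
    have : τ = 0 := by simpa using eq_zero_of_pow_eq_zero hτ
    rw [this] at h
    rw [h3 j, h]; rfl
  have key : ∀ i, ∃ (k : ℕ) (w : (Fin q → ℂ) × ℂ → ℂ × ℂ), (0 < k ∧ AnalyticAt ℂ w 0 ∧ w 0 ≠ 0) ∧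
      (∀ᶠ p in nhds (0 : (Fin q → ℂ) × ℂ), (p.1, p.2 ^ k • w p) ∈ V) ∧
      ∀ᶠ p in nhds (0 : (Fin q → ℂ) × ℂ), (Ψ (p.1, (p.2 ^ N, ξ i p))).2 =
        p.2 ^ k • w ((Ψ (p.1, (p.2 ^ N, ξ i p))).1, p.2) := by
    intro i
    obtain ⟨k, v, hk, hv, hv0, hkv⟩ := exists_eq_pow_smul_of_conjugates hN (hξ i).1 (hξ0 i) (by
      intro ω h
      obtain ⟨j, hj⟩ := hω ω h i
      rcases eq_or_ne i j with rfl | hij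
      · exact Or.inl hj
      · right
        filter_upwards [hj, hne i j hij] with p h1 h2 h3
        rw [h1]; exact (h2 h3).symm)
    obtain ⟨w, hw, hkw⟩ := hΨ.fun_snd.exists_eq_pow_smul_comp hΨW hv hk
    have hγ : AnalyticAt ℂ (fun p : (Fin q → ℂ) × ℂ => (p.1, (p.2 ^ N, ξ i p))) 0 := by
      have := (hξ i).1
      fun_prop
    have hγ0 : ((0 : (Fin q → ℂ) × ℂ).1, ((0 : (Fin q → ℂ) × ℂ).2 ^ N, ξ i 0)) = 0 := by
      simp [hN.ne', (hξ i).2, Prod.ext_iff]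
    have hγt := hγ.tendsto_of_eq hγ0
    have hw0 : w 0 ≠ 0 := by
      intro hw0
      obtain ⟨K, s, hs, hL⟩ := (hΦ.contDiffAt (n := 1)).exists_lipschitzOnWith
      have hΨγ := hΨt.comp hγt
      have hΨγ0 : Filter.Tendsto (fun p => ((Ψ (p.1, (p.2 ^ N, ξ i p))).1, (0 : ℂ × ℂ)))
          (nhds 0) (nhds (0 : (Fin q → ℂ) × (ℂ × ℂ))) :=
        tendsto_prodMk_zero.comp ((continuous_fst.tendsto' 0 0 rfl).comp hΨγ)
      have hle : ∀ᶠ p in nhds (0 : (Fin q → ℂ) × ℂ), p.2 ≠ 0 → ‖v p‖ ≤ K * ‖w p‖ := by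
        filter_upwards [hkv, hkw, hΨγ.eventually hs, hΨγ0.eventually hs, hγt.eventually hΦΨ,
          hΨγ0.eventually hΦW, hΨγ0.eventually hW] with p h1 h2 h3 h4 h5 h6 h7 hp
        have h8 := (hL.dist_le_mul _ h3 _ h4).trans' (le_max_right _ _)
        simp only [Function.comp_apply] at h8
        rw [h5, h6.1 (h7.2 rfl), dist_zero_right, Prod.dist_eq, dist_self, dist_zero_right,
          max_eq_right (norm_nonneg _), h1, h2, norm_smul, norm_smul] at h8
        have h9 : 0 < ‖p.2 ^ k‖ := norm_pos_iff.2 (pow_ne_zero _ hp)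
        nlinarith
      have hlt : ∀ᶠ p in nhds (0 : (Fin q → ℂ) × ℂ), K * ‖w p‖ < ‖v p‖ := by
        refine Filter.Tendsto.eventually_lt
          (tendsto_const_nhds.mul hw.continuousAt.norm) hv.continuousAt.norm ?_
        simpa [hw0] using hv0
      obtain ⟨p, h1, h2⟩ := exists_snd_ne_zero (hle.and hlt)
      exact absurd (h1.1 h2) (not_le.2 h1.2)
    have hT : AnalyticAt ℂ (fun p : (Fin q → ℂ) × ℂ => (Ψ (p.1, (p.2 ^ N, ξ i p))).1) 0 :=
      hΨ.fun_fst.comp_of_eq hγ hγ0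
    have hT0 : (fun p : (Fin q → ℂ) × ℂ => (Ψ (p.1, (p.2 ^ N, ξ i p))).1) 0 = 0 := by
      simp only [hγ0, hΨ0]; rfl
    have hR : AnalyticAt ℂ (fun t : Fin q → ℂ => (Φ (t, 0)).1) 0 :=
      hΦ.fun_fst.comp_of_eq (f := fun t : Fin q → ℂ => (t, (0 : ℂ × ℂ))) (by fun_prop) rfl
    obtain ⟨w', θ, hw', hw0', hθ, hθ0, h1, h2⟩ := exists_reparam hT hT0 hR (by
      filter_upwards [hξ0 i, hΨW, tendsto_prodMk_zero.eventually hΦΨ] with t h1 h2 h3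
      have h4 : (t, ((0 : ℂ) ^ N, ξ i (t, 0))) = (t, (0 : ℂ × ℂ)) := by
        rw [h1, zero_pow hN.ne']; rfl
      simp only [h4]
      rw [show ((Ψ (t, 0)).1, (0 : ℂ × ℂ)) = Ψ (t, 0) from Prod.ext rfl h2.symm, h3]) hw
    have hθ' : AnalyticAt ℂ (fun p => (θ p, p.2)) 0 := hθ.prod analyticAt_snd
    have hθ0' : (θ 0, (0 : (Fin q → ℂ) × ℂ).2) = 0 := by rw [hθ0]; rfl
    refine ⟨k, w', ⟨hk, hw', by rwa [hw0']⟩, ?_, ?_⟩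
    · filter_upwards [h1, (hθ'.tendsto_of_eq hθ0').eventually hkw,
        (hθ'.tendsto_of_eq hθ0').eventually hkv,
        (hθ'.tendsto_of_eq hθ0').eventually (hγt.eventually (hΨt.eventually hVS)),
        (hθ'.tendsto_of_eq hθ0').eventually (hγt.eventually hΦΨ),
        (hθ'.tendsto_of_eq hθ0').eventually (hγt.eventually hSξ)] with p h1 h2 h3 h4 h5 h6
      have h7 := h4.2 (by rw [h5]; exact h6.2 ⟨i, p.2, rfl, rfl⟩)
      rw [h1.2, ← h2, ← h3]
      convert h7
      exact h1.1.symm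
    · filter_upwards [h2, hkw, hkv] with p h2 h3 h4
      rw [h2, ← h3, ← h4]
  choose k w hw hwV hwc using key
  refine ⟨Fin d, inferInstance, ⟨⟨0, hd⟩⟩, k, w, hw, hwV, fun U hU => ?_⟩
  have hΦ2 : Filter.Tendsto (fun z => ((Φ z).1, (Φ z).2.1)) (nhds 0) (nhds (0 : (Fin q → ℂ) × ℂ)) :=
    (hΦ.fun_fst.prod hΦ.fun_snd.fun_fst).tendsto_of_eq (by rw [hΦ0]; rfl)
  have hTU : ∀ᶠ p in nhds (0 : (Fin q → ℂ) × ℂ), ∀ i, ((Ψ (p.1, (p.2 ^ N, ξ i p))).1, p.2) ∈ U := by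
    refine Filter.eventually_all.2 fun i => ?_
    have h : AnalyticAt ℂ (fun p : (Fin q → ℂ) × ℂ => ((Ψ (p.1, (p.2 ^ N, ξ i p))).1, p.2)) 0 := by
      refine (hΨ.fun_fst.comp_of_eq (f := fun p : (Fin q → ℂ) × ℂ => (p.1, (p.2 ^ N, ξ i p))) ?_
        ?_).prod analyticAt_snd
      · have := (hξ i).1
        fun_prop
      · simp [hN.ne', (hξ i).2, Prod.ext_iff]
    refine (h.tendsto_of_eq ?_).eventually hU
    have : ((0 : (Fin q → ℂ) × ℂ).1, ((0 : (Fin q → ℂ) × ℂ).2 ^ N, ξ i 0)) = 0 := by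
      simp [hN.ne', (hξ i).2, Prod.ext_iff]
    rw [this, hΨ0]; rfl
  filter_upwards [hΨΦ, hVS, hΦt.eventually hSξ, hΦ2.eventually (eventually_forall_pow_eq (N := N)
    (hTU.and (Filter.eventually_all.2 hwc)))] with z h1 h2 h3 h4 h5
  obtain ⟨i, τ, hτ, hξτ⟩ := h3.1 (h2.1 h5)
  obtain ⟨h6, h7⟩ := h4 τ hτ
  have h8 : ((Φ z).1, (τ ^ N, ξ i ((Φ z).1, τ))) = Φ z := by rw [hτ, hξτ]
  have h6 := h6 i
  have h7 := h7 i
  simp only [h8, h1] at h6 h7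
  exact ⟨i, τ, h6, h7⟩

end DimType

section Blowup

variable {E : Type*} [NormedAddCommGroup E] [NormedSpace ℂ E]

/-- The strict transform of `V` in the first chart of the blowing-up of `x = y = 0`. -/
def strictTransform (V : Set (E × (ℂ × ℂ))) : Set (E × (ℂ × ℂ)) :=
  closure {z | (z.1, (z.2.1, z.2.1 * z.2.2)) ∈ V ∧ z.2.1 ≠ 0}

/-- The set obtained by exchanging the last two coordinates. -/
def swapSet (V : Set (E × (ℂ × ℂ))) : Set (E × (ℂ × ℂ)) := {z | (z.1, z.2.swap) ∈ V}

theorem strictTransform_swapSet (V : Set (E × (ℂ × ℂ))) : strictTransform (swapSet V) =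
    closure {z | (z.1, (z.2.2 * z.2.1, z.2.1)) ∈ V ∧ z.2.1 ≠ 0} := by
  simp only [strictTransform, swapSet, Set.mem_ofPred_eq, Prod.swap_prod_mk, mul_comm]

/-- The branches `s` parametrise `V` in the linear coordinates `L`. -/
def IsTForm (V : Set (E × (ℂ × ℂ))) (L : (ℂ × ℂ) ≃L[ℂ] (ℂ × ℂ)) (N d : ℕ)
    (s : Fin d → E × ℂ → ℂ) : Prop :=
  0 < N ∧ 0 < d ∧ (∀ i, AnalyticAt ℂ (s i) 0) ∧
    (∀ i j, i ≠ j → ∀ᶠ p in nhds (0 : E × ℂ), p.2 ≠ 0 → s i p ≠ s j p) ∧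
    (∀ ω : ℂ, ω ^ N = 1 → ∀ i, ∃ j, ∀ᶠ p in nhds (0 : E × ℂ), s i (p.1, ω * p.2) = s j p) ∧
    ∀ᶠ z in nhds (0 : E × (ℂ × ℂ)), z ∈ V ↔
      ∃ i, ∃ τ : ℂ, τ ^ N = (L z.2).1 ∧ τ ^ N * s i (z.1, τ) = (L z.2).2

theorem tendsto_fst_swap : Filter.Tendsto (fun z : E × (ℂ × ℂ) => (z.1, z.2.swap)) (nhds 0)
    (nhds 0) := by
  have : Continuous (fun z : E × (ℂ × ℂ) => (z.1, z.2.swap)) := by fun_prop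
  exact this.tendsto' 0 0 rfl

theorem IsTForm.swap {V : Set (E × (ℂ × ℂ))} {L : (ℂ × ℂ) ≃L[ℂ] (ℂ × ℂ)} {N d : ℕ}
    {s : Fin d → E × ℂ → ℂ} (h : IsTForm V L N d s) :
    IsTForm (swapSet V) ((ContinuousLinearEquiv.prodComm ℂ ℂ ℂ).trans L) N d s := by
  obtain ⟨hN, hd, hs, hne, hω, hV⟩ := h
  exact ⟨hN, hd, hs, hne, hω, tendsto_fst_swap.eventually hV⟩

theorem ContinuousLinearEquiv.apply_mk_mul (L : (ℂ × ℂ) ≃L[ℂ] (ℂ × ℂ)) (x s : ℂ) :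
    L (x, x * s) = (x * (L (1, s)).1, x * (L (1, s)).2) := by
  rw [show (x, x * s) = x • ((1 : ℂ), s) by simp, map_smul]; rfl

theorem IsTForm.mem_strictTransform {V : Set (E × (ℂ × ℂ))} {L : (ℂ × ℂ) ≃L[ℂ] (ℂ × ℂ)} {N d : ℕ}
    {s : Fin d → E × ℂ → ℂ} (h : IsTForm V L N d s) :
    ∃ (O : Set (E × (ℂ × ℂ))) (r : ℝ), IsOpen O ∧ 0 < r ∧ (∀ t s, ‖t‖ < r → (t, (0, s)) ∈ O) ∧
      ∀ z ∈ O, z ∈ strictTransform V ↔ ∃ i, ∃ τ : ℂ, τ ^ N = z.2.1 * (L (1, z.2.2)).1 ∧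
        (L (1, z.2.2)).2 = (L (1, z.2.2)).1 * s i (z.1, τ) := by
  obtain ⟨hN, hd, hs, hne, hω, hV⟩ := h
  obtain ⟨r1, hr1, H1⟩ := eventually_prod_nhds_zero_iff.1 hV
  obtain ⟨r2, hr2, H2⟩ := eventually_prod_nhds_zero_iff.1 (Filter.eventually_all.2 fun i =>
    (hs i).eventually_analyticAt)
  set r := min r1 r2
  have hr : 0 < r := lt_min hr1 hr2
  set R : E × (ℂ × ℂ) → Prop := fun z => ∃ i, ∃ τ : ℂ, τ ^ N = z.2.1 * (L (1, z.2.2)).1 ∧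
        (L (1, z.2.2)).2 = (L (1, z.2.2)).1 * s i (z.1, τ) with hR
  set O : Set (E × (ℂ × ℂ)) := {z | ‖z.1‖ < r ∧ ‖(z.2.1, z.2.1 * z.2.2)‖ < r ∧
    ‖z.2.1 * (L (1, z.2.2)).1‖ < (r / 2) ^ N} with hO
  have hLc : Continuous fun z : E × (ℂ × ℂ) => L (1, z.2.2) := L.continuous.comp (by fun_prop)
  have hOo : IsOpen O := by
    have h1 : IsOpen {z : E × (ℂ × ℂ) | ‖z.1‖ < r} := isOpen_lt (by fun_prop) (by fun_prop)
    have h2 : IsOpen {z : E × (ℂ × ℂ) | ‖(z.2.1, z.2.1 * z.2.2)‖ < r} :=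
      isOpen_lt (by fun_prop) (by fun_prop)
    have h3 : IsOpen {z : E × (ℂ × ℂ) | ‖z.2.1 * (L (1, z.2.2)).1‖ < (r / 2) ^ N} :=
      isOpen_lt (by fun_prop) (by fun_prop)
    exact h1.inter (h2.inter h3)
  have hoff : ∀ z ∈ O, z.2.1 ≠ 0 → ((z.1, (z.2.1, z.2.1 * z.2.2)) ∈ V ↔ R z) := by
    intro z hz h0
    rw [H1 _ _ (hz.1.trans_le (min_le_left _ _)) (hz.2.1.trans_le (min_le_left _ _))]
    simp only [ContinuousLinearEquiv.apply_mk_mul]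
    refine exists_congr fun i => exists_congr fun τ => and_congr_right fun hτ => ?_
    rw [hτ, mul_assoc, mul_right_inj' h0, eq_comm]
  have hclosed : ∀ z ∈ O, ¬ R z → ∀ᶠ z' in nhds z, ¬ R z' := by
    intro z hz hRz
    have key : ∀ i, ∀ᶠ z' in nhds z, ∀ τ ∈ Metric.closedBall (0 : ℂ) (r / 2),
        ¬ (τ ^ N = z'.2.1 * (L (1, z'.2.2)).1 ∧
          (L (1, z'.2.2)).2 = (L (1, z'.2.2)).1 * s i (z'.1, τ)) := by
      intro i
      refine (isCompact_closedBall (0 : ℂ) (r / 2)).eventually_forall_of_forall_eventually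
        fun τ hτ => ?_
      have hτ' : ‖τ‖ < r := by
        have : ‖τ‖ ≤ r / 2 := by simpa using hτ
        linarith
      have hsi : ContinuousAt (fun p : (E × (ℂ × ℂ)) × ℂ => s i (p.1.1, p.2)) (z, τ) := by
        refine ContinuousAt.comp (g := s i) (f := fun p : (E × (ℂ × ℂ)) × ℂ => (p.1.1, p.2)) ?_
          (by fun_prop)
        exact (H2 _ _ (hz.1.trans_le (min_le_right _ _)) (hτ'.trans_le (min_le_right _ _))
          i).continuousAt
      have hLc' : Continuous fun p : (E × (ℂ × ℂ)) × ℂ => L (1, p.1.2.2) :=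
        hLc.comp continuous_fst
      have hz' := not_and_or.1 fun hh => hRz ⟨i, τ, hh⟩
      rcases hz' with h | h
      · have h1 : ContinuousAt (fun p : (E × (ℂ × ℂ)) × ℂ => p.2 ^ N) (z, τ) := by fun_prop
        have h2 : ContinuousAt (fun p : (E × (ℂ × ℂ)) × ℂ => p.1.2.1 * (L (1, p.1.2.2)).1)
          (z, τ) := by fun_prop
        filter_upwards [(h1.ne_iff_eventually_ne h2).1 h] with p hp hp'
        exact hp hp'.1
      · have h1 : ContinuousAt (fun p : (E × (ℂ × ℂ)) × ℂ => (L (1, p.1.2.2)).2) (z, τ) := by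
          fun_prop
        have h2 : ContinuousAt (fun p : (E × (ℂ × ℂ)) × ℂ =>
          (L (1, p.1.2.2)).1 * s i (p.1.1, p.2)) (z, τ) :=
          hLc'.fst.continuousAt.mul hsi
        filter_upwards [(h1.ne_iff_eventually_ne h2).1 h] with p hp hp'
        exact hp hp'.2
    filter_upwards [Filter.eventually_all.2 key, hOo.mem_nhds hz] with z' h1 h2
    rintro ⟨i, τ, h⟩
    refine h1 i τ ?_ h
    have h3 := h2.2.2
    rw [← h.1, norm_pow] at h3
    simpa using (lt_of_pow_lt_pow_left₀ N (by positivity) h3).le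
  refine ⟨O, r, hOo, hr, fun t s ht => ⟨ht, by simpa using hr, by simp; positivity⟩, ?_⟩
  intro z hz
  constructor
  · intro hcl
    by_contra hRz
    obtain ⟨z', h1, h2⟩ := (mem_closure_iff_frequently.1 hcl).and_eventually
      ((hclosed z hz hRz).and (hOo.mem_nhds hz)) |>.exists
    exact h2.1 ((hoff z' h2.2 h1.2).1 h1.1)
  · intro hRz
    by_cases h0 : z.2.1 = 0
    swap
    · exact subset_closure ⟨(hoff z hz h0).2 hRz, h0⟩
    obtain ⟨i, τ, hτ, h⟩ := hRz
    obtain rfl : τ = 0 := by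
      rw [h0, zero_mul] at hτ
      exact eq_zero_of_pow_eq_zero hτ
    have hl1 : (L (1, z.2.2)).1 ≠ 0 := by
      intro h1
      rw [h1, zero_mul] at h
      have : L (1, z.2.2) = 0 := Prod.ext h1 h
      rw [map_eq_zero_iff L L.injective] at this
      simpa using congrArg Prod.fst this
    have hu0 : L.symm (1, s i (z.1, 0)) = (L (1, z.2.2)).1⁻¹ • (1, z.2.2) := by
      rw [L.symm_apply_eq, map_smul]
      refine Prod.ext ?_ ?_
      · simp [hl1]
      · simp only [Prod.smul_snd, smul_eq_mul]
        rw [h, inv_mul_cancel_left₀ hl1]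
    have hsc : ContinuousAt (fun τ : ℂ => s i (z.1, τ)) 0 := by
      refine ContinuousAt.comp (g := s i) (f := fun τ : ℂ => (z.1, τ)) ?_ (by fun_prop)
      exact (H2 _ _ (hz.1.trans_le (min_le_right _ _)) (by simpa using hr2) i).continuousAt
    have huc : ContinuousAt (fun τ : ℂ => L.symm (1, s i (z.1, τ))) 0 :=
      L.symm.continuous.continuousAt.comp (continuousAt_const.prodMk hsc)
    have hu1 : (L.symm (1, s i (z.1, 0))).1 ≠ 0 := by rw [hu0]; simpa using hl1
    have hγ : Filter.Tendsto (fun τ : ℂ => (z.1, (τ ^ N * (L.symm (1, s i (z.1, τ))).1,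
        (L.symm (1, s i (z.1, τ))).2 / (L.symm (1, s i (z.1, τ))).1))) (nhds 0) (nhds z) := by
      have : ContinuousAt (fun τ : ℂ => (z.1, (τ ^ N * (L.symm (1, s i (z.1, τ))).1,
        (L.symm (1, s i (z.1, τ))).2 / (L.symm (1, s i (z.1, τ))).1))) 0 := by
        refine continuousAt_const.prodMk ((by fun_prop : ContinuousAt _ _).prodMk
          (huc.snd.div huc.fst hu1))
      refine this.tendsto.mono_right (congrArg nhds ?_).le
      refine Prod.ext rfl (Prod.ext ?_ ?_)
      · simp [hN.ne', h0]
      · simp only [hu0, Prod.smul_fst, Prod.smul_snd, smul_eq_mul, mul_one]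
        field_simp
    refine mem_closure_of_tendsto (hγ.mono_left (nhdsWithin_le_nhds (s := {0}ᶜ))) ?_
    filter_upwards [self_mem_nhdsWithin, (hγ.eventually (hOo.mem_nhds hz)).filter_mono
      nhdsWithin_le_nhds, (huc.fst.eventually_ne hu1).filter_mono nhdsWithin_le_nhds]
      with τ h1 h2 h3
    have h4 : τ ^ N * (L.symm (1, s i (z.1, τ))).1 ≠ 0 := mul_ne_zero (pow_ne_zero _ h1) h3
    have h5 : L (1, (L.symm (1, s i (z.1, τ))).2 / (L.symm (1, s i (z.1, τ))).1) =
        (L.symm (1, s i (z.1, τ))).1⁻¹ • (1, s i (z.1, τ)) := by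
      rw [← L.apply_symm_apply (1, s i (z.1, τ)), ← map_smul, L.symm_apply_apply]
      congr 1
      refine Prod.ext ?_ ?_
      · simp [h3]
      · simp [div_eq_inv_mul]
    have h6 := (hoff (z.1, (τ ^ N * (L.symm (1, s i (z.1, τ))).1,
        (L.symm (1, s i (z.1, τ))).2 / (L.symm (1, s i (z.1, τ))).1)) h2 h4).2
    refine ⟨h6 ⟨i, τ, ?_⟩, h4⟩
    simp only [h5, Prod.smul_fst, Prod.smul_snd, smul_eq_mul, mul_one]
    exact ⟨by field_simp, trivial⟩

end Blowup

section BlowupOfTForm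

theorem mul_eq_mul_of_apply (L : (ℂ × ℂ) ≃L[ℂ] (ℂ × ℂ)) {a b : ℂ × ℂ}
    (h : (L a).2 * (L b).1 = (L b).2 * (L a).1) : a.2 * b.1 = b.2 * a.1 := by
  have h1 : L ((L b).1 • a - (L a).1 • b) = 0 := by
    rw [map_sub, map_smul, map_smul]
    refine Prod.ext ?_ ?_
    · simp; ring
    · simp; linear_combination h
  have h2 : L ((L b).2 • a - (L a).2 • b) = 0 := by
    rw [map_sub, map_smul, map_smul]
    refine Prod.ext ?_ ?_
    · simp; linear_combination - h
    · simp; ring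
  rw [map_eq_zero_iff L L.injective] at h1 h2
  have h11 : (L b).1 * a.1 = (L a).1 * b.1 := by simpa [sub_eq_zero] using congrArg Prod.fst h1
  have h12 : (L b).1 * a.2 = (L a).1 * b.2 := by simpa [sub_eq_zero] using congrArg Prod.snd h1
  have h21 : (L b).2 * a.1 = (L a).2 * b.1 := by simpa [sub_eq_zero] using congrArg Prod.fst h2
  have h22 : (L b).2 * a.2 = (L a).2 * b.2 := by simpa [sub_eq_zero] using congrArg Prod.snd h2
  by_cases hb1 : (L b).1 = 0
  · by_cases hb2 : (L b).2 = 0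
    · have : L b = 0 := Prod.ext hb1 hb2
      rw [map_eq_zero_iff L L.injective] at this
      simp [this]
    · apply mul_left_cancel₀ hb2
      linear_combination b.1 * h22 - b.2 * h21
  · apply mul_left_cancel₀ hb1
    linear_combination b.1 * h12 - b.2 * h11

theorem ncard_setOf_slope {d : ℕ} (L : (ℂ × ℂ) ≃L[ℂ] (ℂ × ℂ)) (m : Fin d → ℂ) :
    {s : ℂ | ∃ i, (L (1, s)).2 = (L (1, s)).1 * m i}.Finite ∧
    {s : ℂ | ∃ i, (L (1, s)).2 = (L (1, s)).1 * m i}.ncard +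
      (if ∃ i, (L (0, 1)).2 = (L (0, 1)).1 * m i then 1 else 0) = (Set.range m).ncard := by
  set A := {s : ℂ | ∃ i, (L (1, s)).2 = (L (1, s)).1 * m i} with hA
  set B : Set ℂ := {c | c ∈ Set.range m ∧ (L (0, 1)).2 = (L (0, 1)).1 * c} with hB
  have hne : ∀ a : ℂ × ℂ, a ≠ 0 → ∀ c, (L a).2 = (L a).1 * c → (L a).1 ≠ 0 := by
    intro a ha c h h1
    rw [h1, zero_mul] at h
    exact ha ((map_eq_zero_iff L L.injective).1 (Prod.ext h1 h))
  have h1s : ∀ s : ℂ, ((1 : ℂ), s) ≠ 0 := fun s h => one_ne_zero (congrArg Prod.fst h)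
  have h01 : ((0 : ℂ), (1 : ℂ)) ≠ 0 := fun h => one_ne_zero (congrArg Prod.snd h)
  set g : ℂ → ℂ := fun s => (L (1, s)).2 / (L (1, s)).1 with hg
  have hgA : ∀ s i, (L (1, s)).2 = (L (1, s)).1 * m i → g s = m i := fun s i h => by
    simp only [hg]
    rw [h, mul_div_cancel_left₀ _ (hne _ (h1s s) _ h)]
  have hinj : Set.InjOn g A := by
    rintro s ⟨i, hi⟩ s' ⟨j, hj⟩ h
    have := mul_eq_mul_of_apply L (a := (1, s)) (b := (1, s'))
      ((div_eq_div_iff (hne _ (h1s s) _ hi) (hne _ (h1s s') _ hj)).1 h)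
    simpa using this
  have hdisj : Disjoint (g '' A) B := by
    rw [Set.disjoint_left]
    rintro _ ⟨s, ⟨i, hi⟩, rfl⟩ ⟨-, h⟩
    have := mul_eq_mul_of_apply L (a := (0, 1)) (b := (1, s)) (by
      rw [h]; simp only [hg]; field_simp [hne _ (h1s s) _ hi])
    simp at this
  have hunion : Set.range m = g '' A ∪ B := by
    ext c
    constructor
    · rintro ⟨i, rfl⟩
      have h1 : L (L.symm (1, m i)) = (1, m i) := L.apply_symm_apply _
      set u := L.symm (1, m i)
      by_cases hu : u.1 = 0
      · right
        refine ⟨⟨i, rfl⟩, ?_⟩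
        have h2 : u = u.2 • ((0 : ℂ), (1 : ℂ)) := Prod.ext (by simp [hu]) (by simp)
        rw [h2, map_smul] at h1
        have h3 := congrArg Prod.fst h1
        have h4 := congrArg Prod.snd h1
        simp only [Prod.smul_fst, Prod.smul_snd, smul_eq_mul] at h3 h4
        have h5 : u.2 ≠ 0 := left_ne_zero_of_mul_eq_one h3
        apply mul_left_cancel₀ h5
        linear_combination h4 - m i * h3
      · left
        have h2 : u = u.1 • ((1 : ℂ), u.2 / u.1) := Prod.ext (by simp)
          (by simp; field_simp)
        rw [h2, map_smul] at h1
        have h3 := congrArg Prod.fst h1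
        have h4 := congrArg Prod.snd h1
        simp only [Prod.smul_fst, Prod.smul_snd, smul_eq_mul] at h3 h4
        have h6 : (L (1, u.2 / u.1)).2 = (L (1, u.2 / u.1)).1 * m i := by
          apply mul_left_cancel₀ hu
          linear_combination h4 - m i * h3
        exact ⟨u.2 / u.1, ⟨i, h6⟩, hgA _ _ h6⟩
    · rintro (⟨s, ⟨i, hi⟩, rfl⟩ | ⟨h, -⟩)
      · exact ⟨i, (hgA _ _ hi).symm⟩
      · exact h
  have hfin : (Set.range m).Finite := Set.finite_range m
  have hAf : A.Finite := Set.Finite.of_finite_image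
    (hfin.subset (hunion ▸ Set.subset_union_left)) hinj
  refine ⟨hAf, ?_⟩
  rw [hunion, Set.ncard_union_eq hdisj (hAf.image g)
    (hfin.subset (hunion ▸ Set.subset_union_right)), hinj.ncard_image]
  congr 1
  split_ifs with h
  · obtain ⟨i, hi⟩ := h
    rw [eq_comm, Set.ncard_eq_one]
    refine ⟨m i, Set.eq_singleton_iff_unique_mem.2 ⟨⟨⟨i, rfl⟩, hi⟩, fun c hc => ?_⟩⟩
    exact mul_left_cancel₀ (hne _ h01 _ hi) (hc.2.symm.trans hi)
  · rw [eq_comm, Set.ncard_eq_zero (hfin.subset (hunion ▸ Set.subset_union_right)),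
      Set.eq_empty_iff_forall_notMem]
    rintro c ⟨⟨i, rfl⟩, hc⟩
    exact h ⟨i, hc⟩

theorem ncard_range_eq_of_eq_iff {ι : Type*} [Finite ι] {m m' : ι → ℂ}
    (h : ∀ i j, m i = m j ↔ m' i = m' j) : (Set.range m).ncard = (Set.range m').ncard := by
  refine Set.ncard_congr (fun c hc => m' hc.choose) (fun c hc => ⟨_, rfl⟩) ?_ ?_
  · intro a b ha hb hab
    have := (h _ _).2 hab
    rwa [ha.choose_spec, hb.choose_spec] at this
  · rintro _ ⟨i, rfl⟩
    exact ⟨m i, ⟨i, rfl⟩, (h _ _).1 (Exists.choose_spec (⟨i, rfl⟩ : ∃ j, m j = m i))⟩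

variable {E : Type*} [NormedAddCommGroup E] [NormedSpace ℂ E]

theorem IsTForm.fibre {V : Set (E × (ℂ × ℂ))} {L : (ℂ × ℂ) ≃L[ℂ] (ℂ × ℂ)} {N d : ℕ}
    {s : Fin d → E × ℂ → ℂ} (h : IsTForm V L N d s) : ∃ r : ℝ, 0 < r ∧ ∀ t, ‖t‖ < r →
      {c : ℂ | (t, ((0 : ℂ), c)) ∈ strictTransform V}.Finite ∧
      {c : ℂ | (t, ((0 : ℂ), c)) ∈ strictTransform V}.ncard +
        (if (t, ((0 : ℂ), (0 : ℂ))) ∈ strictTransform (swapSet V) then 1 else 0) =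
        (Set.range fun i => s i 0).ncard := by
  obtain ⟨O, r1, -, hr1, hO, H1⟩ := h.mem_strictTransform
  obtain ⟨O', r2, -, hr2, hO', H2⟩ := h.swap.mem_strictTransform
  obtain ⟨hN, hd, hs, hne, hω, hV⟩ := h
  have hrel : ∀ᶠ t in nhds (0 : E), ∀ i j, s i (t, 0) = s j (t, 0) ↔ s i 0 = s j 0 := by
    refine Filter.eventually_all.2 fun i => Filter.eventually_all.2 fun j => ?_
    rcases eq_or_ne i j with rfl | hij
    · simp
    obtain ⟨e, u, hu, hu0, h⟩ := ((hs i).fun_sub (hs j)).exists_eq_pow_mul_unit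
      ((hne i j hij).mono fun p hp h2 => sub_ne_zero.2 (hp h2))
    have h0 := h.self_of_nhds
    filter_upwards [tendsto_prodMk_zero.eventually h,
      tendsto_prodMk_zero.eventually (hu.continuousAt.eventually_ne hu0)] with t h1 h2
    rw [← sub_eq_zero, ← sub_eq_zero (a := s i 0), h1, h0]
    simp [h2, hu0]
  obtain ⟨r3, hr3, H3⟩ := Metric.eventually_nhds_iff.1 hrel
  refine ⟨min r1 (min r2 r3), by positivity, fun t ht => ?_⟩
  have e1 : ∀ c, (t, ((0 : ℂ), c)) ∈ strictTransform V ↔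
      ∃ i, (L (1, c)).2 = (L (1, c)).1 * s i (t, 0) := fun c => by
    rw [H1 _ (hO t c (ht.trans_le (min_le_left _ _)))]
    simp [hN.ne']
  have e2 : (t, ((0 : ℂ), (0 : ℂ))) ∈ strictTransform (swapSet V) ↔
      ∃ i, (L (0, 1)).2 = (L (0, 1)).1 * s i (t, 0) := by
    rw [H2 _ (hO' t 0 (ht.trans_le ((min_le_right _ _).trans (min_le_left _ _))))]
    simp [hN.ne']
  simp only [e1, e2]
  have ht3 : ‖t‖ < r3 := ht.trans_le ((min_le_right _ _).trans (min_le_right _ _))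
  rw [← ncard_range_eq_of_eq_iff (H3 (by simpa using ht3))]
  exact ncard_setOf_slope L _

theorem IsTForm.dimType1Along_strictTransform {q : ℕ} {V : Set ((Fin q → ℂ) × (ℂ × ℂ))}
    {L : (ℂ × ℂ) ≃L[ℂ] (ℂ × ℂ)} {N d : ℕ} {s : Fin d → (Fin q → ℂ) × ℂ → ℂ}
    (h : IsTForm V L N d s) {c : ℂ}
    (hc : ((0 : Fin q → ℂ), ((0 : ℂ), c)) ∈ strictTransform V) :
    ∃ W', DimType1Along q (strictTransform V) W' ((0 : Fin q → ℂ), ((0 : ℂ), c)) := by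
  obtain ⟨O, r1, hOo, hr1, hO, H1⟩ := h.mem_strictTransform
  obtain ⟨hN, hd, hs, hne, hω, hV⟩ := h
  have hcO := hO 0 c (by simpa using hr1)
  obtain ⟨i0, hi0⟩ : ∃ i, (L (1, c)).2 = (L (1, c)).1 * s i 0 := by
    rw [H1 _ hcO] at hc
    obtain ⟨i, τ, hτ, h⟩ := hc
    have : τ = 0 := by simpa using eq_zero_of_pow_eq_zero (hτ.trans (zero_mul _))
    rw [this] at h
    exact ⟨i, h⟩
  set m0 := s i0 0
  have hl1 : (L (1, c)).1 ≠ 0 := by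
    intro h1
    rw [h1, zero_mul] at hi0
    have := (map_eq_zero_iff L L.injective).1 (Prod.ext h1 hi0)
    exact one_ne_zero (congrArg Prod.fst this)
  have hsymm : L.symm (1, m0) = (L (1, c)).1⁻¹ • (1, c) := by
    rw [L.symm_apply_eq, map_smul]
    refine Prod.ext ?_ ?_
    · simp [hl1]
    · simp only [Prod.smul_snd, smul_eq_mul]
      rw [hi0, inv_mul_cancel_left₀ hl1]
  set Φ : (Fin q → ℂ) × (ℂ × ℂ) → (Fin q → ℂ) × (ℂ × ℂ) := fun z =>
    (z.1, (z.2.1 * (L (1, z.2.2)).1, (L (1, z.2.2)).2 / (L (1, z.2.2)).1 - m0)) with hΦ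
  set Ψ : (Fin q → ℂ) × (ℂ × ℂ) → (Fin q → ℂ) × (ℂ × ℂ) := fun w =>
    (w.1, (w.2.1 * (L.symm (1, w.2.2 + m0)).1,
      (L.symm (1, w.2.2 + m0)).2 / (L.symm (1, w.2.2 + m0)).1)) with hΨ
  set P' : (Fin q → ℂ) × (ℂ × ℂ) := ((0 : Fin q → ℂ), ((0 : ℂ), c)) with hP'
  have hLan : AnalyticAt ℂ (fun z : (Fin q → ℂ) × (ℂ × ℂ) => L (1, z.2.2)) P' :=
    (L.toContinuousLinearMap.analyticAt _).comp_of_eq (f := fun z : (Fin q → ℂ) × (ℂ × ℂ) =>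
      ((1 : ℂ), z.2.2)) (by fun_prop) rfl
  have hLan' : AnalyticAt ℂ (fun z : (Fin q → ℂ) × (ℂ × ℂ) => L.symm (1, z.2.2 + m0)) 0 :=
    (L.symm.toContinuousLinearMap.analyticAt _).comp_of_eq (f := fun z : (Fin q → ℂ) × (ℂ × ℂ) =>
      ((1 : ℂ), z.2.2 + m0)) (by fun_prop) rfl
  have hu1 : (L.symm (1, (0 : (Fin q → ℂ) × (ℂ × ℂ)).2.2 + m0)).1 ≠ 0 := by
    simp [hsymm, hl1]
  have hΦ0 : Φ P' = 0 := by
    simp [hΦ, hP', hi0, hl1, Prod.ext_iff]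
  have hΦan : AnalyticAt ℂ Φ P' := analyticAt_fst.prod (((by fun_prop : AnalyticAt ℂ _ _).mul
    hLan.fun_fst).prod ((hLan.fun_snd.div hLan.fun_fst hl1).sub analyticAt_const))
  have hne1 : ∀ᶠ z in nhds P', (L (1, z.2.2)).1 ≠ 0 := hLan.fun_fst.continuousAt.eventually_ne hl1
  refine ⟨{z | (Φ z).2 = 0}, Φ, Ψ, hΦan, hΦ0, ?_, ?_, ?_, by simp, {w | ∃ i, s i 0 = m0 ∧
    ∃ τ : ℂ, τ ^ N = w.2.1 ∧ s i (w.1, τ) - m0 = w.2.2}, ?_, ?_⟩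
  · exact analyticAt_fst.prod (((by fun_prop : AnalyticAt ℂ _ _).mul
      hLan'.fun_fst).prod (hLan'.fun_snd.div hLan'.fun_fst hu1))
  · filter_upwards [hne1] with z hz
    have h1 : L.symm (1, (L (1, z.2.2)).2 / (L (1, z.2.2)).1) =
        (L (1, z.2.2)).1⁻¹ • (1, z.2.2) := by
      rw [L.symm_apply_eq, map_smul]
      refine Prod.ext ?_ ?_
      · simp [hz]
      · simp [div_eq_inv_mul]
    simp only [hΦ, hΨ, sub_add_cancel, h1]
    refine Prod.ext rfl (Prod.ext ?_ ?_)
    · simp [hz]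
    · simp; field_simp
  · filter_upwards [hLan'.fun_fst.continuousAt.eventually_ne hu1] with w hw
    have h1 : L (1, (L.symm (1, w.2.2 + m0)).2 / (L.symm (1, w.2.2 + m0)).1) =
        (L.symm (1, w.2.2 + m0)).1⁻¹ • (1, w.2.2 + m0) := by
      rw [← L.apply_symm_apply (1, w.2.2 + m0), ← map_smul, L.symm_apply_apply]
      congr 1
      refine Prod.ext ?_ ?_
      · simp [hw]
      · simp [div_eq_inv_mul]
    simp only [hΦ, hΨ, h1]
    refine Prod.ext rfl (Prod.ext ?_ ?_)
    · simp [hw]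
    · simp only [Prod.smul_fst, Prod.smul_snd, smul_eq_mul]; field_simp; ring
  · obtain ⟨d', ⟨e⟩⟩ := Finite.exists_equiv_fin {i // s i 0 = m0}
    have hd' : 0 < d' := Fin.pos_iff_nonempty.2 (e.nonempty_congr.1 ⟨⟨i0, rfl⟩⟩)
    refine RForm.eqsFamily ⟨N, d', hN, hd', fun j p => s (e.symm j).1 p - m0, fun j =>
      ⟨(hs _).sub analyticAt_const, by
        show s (e.symm j).1 0 - m0 = 0
        rw [(e.symm j).2, sub_self]⟩, fun i j hij => ?_,
      fun ω hω1 i => ?_, ?_⟩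
    · have : (e.symm i).1 ≠ (e.symm j).1 := fun h => hij (e.symm.injective (Subtype.ext h))
      filter_upwards [hne _ _ this] with p hp hp2 h
      exact hp hp2 (sub_left_inj.1 h)
    · obtain ⟨j, hj⟩ := hω ω hω1 (e.symm i).1
      have hj0 : s j 0 = m0 := by
        rw [← hj.self_of_nhds]
        refine Eq.trans ?_ (e.symm i).2
        congr 1
        simp [Prod.ext_iff]
      refine ⟨e ⟨j, hj0⟩, hj.mono fun p hp => ?_⟩
      simp only [e.symm_apply_apply, hp]
    · refine Filter.Eventually.of_forall fun w => ⟨?_, ?_⟩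
      · rintro ⟨i, hi, h⟩
        exact ⟨e ⟨i, hi⟩, by simpa using h⟩
      · rintro ⟨j, h⟩
        exact ⟨_, (e.symm j).2, h⟩
  · have hfar : ∀ᶠ z in nhds P', ∀ i, ∀ τ : ℂ, τ ^ N = z.2.1 * (L (1, z.2.2)).1 →
        (L (1, z.2.2)).2 = (L (1, z.2.2)).1 * s i (z.1, τ) → s i 0 = m0 := by
      refine Filter.eventually_all.2 fun i => ?_
      by_cases hi : s i 0 = m0
      · simp [hi]
      have h1 : ∀ᶠ p in nhds ((0 : (Fin q → ℂ) × ℂ), m0), s i p.1 ≠ p.2 :=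
        (((hs i).continuousAt.comp (f := Prod.fst) (x := ((0 : (Fin q → ℂ) × ℂ), m0))
          continuousAt_fst).ne_iff_eventually_ne continuousAt_snd).1 hi
      rw [nhds_prod_eq, Filter.eventually_prod_iff] at h1
      obtain ⟨pa, hpa, pb, hpb, hab⟩ := h1
      have h2 : Filter.Tendsto (fun z => ((Φ z).1, (Φ z).2.1)) (nhds P')
          (nhds (0 : (Fin q → ℂ) × ℂ)) :=
        (hΦan.fun_fst.prod hΦan.fun_snd.fun_fst).tendsto_of_eq (by rw [hΦ0]; rfl)
      have h3 : Filter.Tendsto (fun z : (Fin q → ℂ) × (ℂ × ℂ) =>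
          (L (1, z.2.2)).2 / (L (1, z.2.2)).1) (nhds P') (nhds m0) :=
        (hLan.fun_snd.div hLan.fun_fst hl1).tendsto_of_eq (by simp [hP', hi0, hl1])
      filter_upwards [h2.eventually (eventually_forall_pow_eq (N := N) hpa), h3.eventually hpb,
        hne1] with z h4 h5 h6 τ hτ h7
      refine absurd ?_ (hab (h4 τ hτ) h5)
      simp only [hΦ]
      rw [h7, mul_div_cancel_left₀ _ h6]
    filter_upwards [hOo.mem_nhds hcO, hfar, hne1] with z h1 h2 h3
    rw [H1 z h1]
    constructor
    · rintro ⟨i, τ, hτ, h⟩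
      refine ⟨i, h2 i τ hτ h, τ, hτ, ?_⟩
      simp only [hΦ]
      rw [h, mul_div_cancel_left₀ _ h3]
    · rintro ⟨i, -, τ, hτ, h⟩
      refine ⟨i, τ, hτ, ?_⟩
      simp only [hΦ, sub_left_inj] at h
      rw [h, mul_div_cancel₀ _ h3]

end BlowupOfTForm

section Forward

theorem IsTForm.blowup_conditions {q : ℕ} {V : Set ((Fin q → ℂ) × (ℂ × ℂ))}
    {L : (ℂ × ℂ) ≃L[ℂ] (ℂ × ℂ)} {N d : ℕ} {s : Fin d → (Fin q → ℂ) × ℂ → ℂ}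
    (h : IsTForm V L N d s) :
    (∃ T ∈ nhds (0 : Fin q → ℂ), ∃ D ⊆ T, T ⊆ closure D ∧
      ∀ t₀ ∈ D,
        {s : ℂ | ((0 : Fin q → ℂ), ((0 : ℂ), s)) ∈ strictTransform V}.Finite ∧
        {s : ℂ | (t₀, ((0 : ℂ), s)) ∈ strictTransform V}.Finite ∧
        {s : ℂ | ((0 : Fin q → ℂ), ((0 : ℂ), s)) ∈ strictTransform V}.ncard
            + (if ((0 : Fin q → ℂ), ((0 : ℂ), (0 : ℂ))) ∈ strictTransform (swapSet V)
                then 1 else 0)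
          = {s : ℂ | (t₀, ((0 : ℂ), s)) ∈ strictTransform V}.ncard
            + (if (t₀, ((0 : ℂ), (0 : ℂ))) ∈ strictTransform (swapSet V) then 1 else 0)) ∧
    (∀ s : ℂ, ((0 : Fin q → ℂ), ((0 : ℂ), s)) ∈ strictTransform V →
      NonsingPt q (strictTransform V) ((0 : Fin q → ℂ), ((0 : ℂ), s)) ∨
        ∃ W', DimType1Along q (strictTransform V) W' ((0 : Fin q → ℂ), ((0 : ℂ), s))) ∧
    (((0 : Fin q → ℂ), ((0 : ℂ), (0 : ℂ))) ∈ strictTransform (swapSet V) →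
      NonsingPt q (strictTransform (swapSet V)) 0 ∨
        ∃ W', DimType1Along q (strictTransform (swapSet V)) W' 0) := by
  obtain ⟨r, hr, H⟩ := h.fibre
  refine ⟨⟨Metric.ball 0 r, Metric.ball_mem_nhds _ hr, _, subset_rfl, subset_closure,
    fun t ht => ?_⟩, fun c hc => Or.inr (h.dimType1Along_strictTransform hc),
    fun hc => Or.inr (h.swap.dimType1Along_strictTransform hc)⟩
  obtain ⟨h1, h2⟩ := H 0 (by simpa using hr)
  obtain ⟨h3, h4⟩ := H t (by simpa using ht)
  exact ⟨h1, h3, h2.trans h4.symm⟩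

end Forward

section Center

theorem circleIntegral_logDeriv_of_unique_zero {f : ℂ → ℂ} {r : ℝ}
    (hf : AnalyticOnNhd ℂ f (Metric.closedBall 0 r)) {b : ℂ} (hb : b ∈ Metric.ball (0 : ℂ) r)
    (h0 : f b = 0) (hne : ∀ s ∈ Metric.closedBall (0 : ℂ) r, s ≠ b → f s ≠ 0) :
    ∃ l : ℕ, l ≠ 0 ∧ (∮ s in C(0, r), deriv f s / f s) = l * (2 * Real.pi * Complex.I) ∧
      (∮ s in C(0, r), s * (deriv f s / f s)) = l * (2 * Real.pi * Complex.I) * b := by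
  have hr : 0 < r := dist_nonneg.trans_lt hb
  have hbc := Metric.ball_subset_closedBall hb
  have hnz : ¬ ∀ᶠ z in nhds b, f z = 0 := by
    intro h
    have h2 : ∀ᶠ z in nhds b, z = b := by
      filter_upwards [h, Metric.isOpen_ball.mem_nhds hb] with z hz hzb
      by_contra hzb'
      exact hne z (Metric.ball_subset_closedBall hzb) hzb' hz
    have h3 := h2.filter_mono (nhdsWithin_le_nhds (s := {b}ᶜ))
    obtain ⟨z, hz, hz'⟩ := (h3.and self_mem_nhdsWithin).exists
    exact hz' hz
  obtain ⟨l, u, hu, hu0, hfu⟩ := (hf b hbc).exists_eventuallyEq_pow_smul_nonzero_iff.2 hnz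
  simp only [smul_eq_mul] at hfu
  have hl : l ≠ 0 := by
    rintro rfl
    have := hfu.self_of_nhds
    rw [h0, pow_zero, one_mul] at this
    exact hu0 this.symm
  set ψ : ℂ → ℂ := Function.update (fun s => deriv f s / f s - l * (s - b)⁻¹) b
    (deriv u b / u b) with hψ
  have hψb : ψ =ᶠ[nhds b] fun s => deriv u s / u s := by
    filter_upwards [hfu.eventually_nhds, hu.eventually_analyticAt,
      hu.continuousAt.eventually_ne hu0] with s h1 h2 h3
    rcases eq_or_ne s b with rfl | hsb
    · simp [hψ]
    · have hsb' := sub_ne_zero.2 hsb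
      have hd : deriv f s = l * (s - b) ^ (l - 1) * u s + (s - b) ^ l * deriv u s := by
        rw [Filter.EventuallyEq.deriv_eq h1]
        have e1 : HasDerivAt (fun z : ℂ => (z - b) ^ l) (l * (s - b) ^ (l - 1)) s := by
          simpa using ((hasDerivAt_id s).sub_const b).fun_pow l
        exact (e1.mul h2.differentiableAt.hasDerivAt).deriv
      rw [hψ, Function.update_of_ne hsb, hd, h1.self_of_nhds]
      obtain ⟨m, rfl⟩ := Nat.exists_eq_succ_of_ne_zero hl
      simp only [Nat.succ_eq_add_one, Nat.add_sub_cancel]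
      field_simp
      ring
  have hψd : ∀ s ∈ Metric.closedBall (0 : ℂ) r, DifferentiableAt ℂ ψ s := by
    intro s hs
    rcases eq_or_ne s b with rfl | hsb
    · exact (hu.deriv.div hu hu0).differentiableAt.congr_of_eventuallyEq hψb
    · have e : ψ =ᶠ[nhds s] fun s => deriv f s / f s - l * (s - b)⁻¹ := by
        filter_upwards [isOpen_ne.mem_nhds hsb] with z hz
        rw [hψ, Function.update_of_ne hz]
      refine DifferentiableAt.congr_of_eventuallyEq ?_ e
      refine ((hf s hs).deriv.div (hf s hs) (hne s hs hsb)).differentiableAt.sub ?_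
      exact ((differentiableAt_id.sub_const b).inv (sub_ne_zero.2 hsb)).const_mul _
  have hz : ∀ φ : ℂ → ℂ, Differentiable ℂ φ → (∮ s in C(0, r), φ s * ψ s) = 0 := fun φ hφ =>
    Complex.circleIntegral_eq_zero_of_differentiable_on_off_countable hr.le Set.countable_empty
      (fun s hs => ((hφ s).mul (hψd s hs)).continuousAt.continuousWithinAt)
      (fun s hs => (hφ s).mul (hψd s (Metric.ball_subset_closedBall hs.1)))
  have hsph : ∀ s ∈ Metric.sphere (0 : ℂ) r, s ≠ b := by
    rintro s hs rfl
    exact (Metric.mem_ball.1 hb).ne hs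
  have hci : ∀ φ : ℂ → ℂ, Differentiable ℂ φ → CircleIntegrable (fun s => φ s * ψ s) 0 r := by
    intro φ hφ
    refine ContinuousOn.circleIntegrable hr.le fun s hs => ?_
    exact ((hφ s).mul (hψd s (Metric.sphere_subset_closedBall hs))).continuousAt.continuousWithinAt
  have hcinv : CircleIntegrable (fun s : ℂ => (s - b)⁻¹) 0 r := by
    refine ContinuousOn.circleIntegrable hr.le fun s hs => ?_
    exact ((continuousAt_id.sub continuousAt_const).inv₀
      (sub_ne_zero.2 (hsph s hs))).continuousWithinAt
  have hI := circleIntegral.integral_sub_inv_of_mem_ball hb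
  have hcs : ∀ a : ℂ, CircleIntegrable (fun s : ℂ => a * (s - b)⁻¹) 0 r :=
    fun a => hcinv.const_fun_smul
  have hI' : ∀ a : ℂ, (∮ s in C(0, r), a * (s - b)⁻¹) = a * (2 * Real.pi * Complex.I) := fun a => by
    rw [circleIntegral.integral_const_mul, hI]
  refine ⟨l, hl, ?_, ?_⟩
  · have h1 : (∮ s in C(0, r), deriv f s / f s) =
        ∮ s in C(0, r), ((fun _ => (1 : ℂ)) s * ψ s + l * (s - b)⁻¹) := by
      refine circleIntegral.integral_congr hr.le fun s hs => ?_
      simp only [hψ, Function.update_of_ne (hsph s hs)]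
      ring
    refine h1.trans ((circleIntegral.integral_add (hci _ (by fun_prop)) (hcs l)).trans ?_)
    rw [hz _ (by fun_prop), hI', zero_add]
  · have h1 : (∮ s in C(0, r), s * (deriv f s / f s)) =
        ∮ s in C(0, r), (id s * ψ s + (l * b * (s - b)⁻¹ + l)) := by
      refine circleIntegral.integral_congr hr.le fun s hs => ?_
      have := sub_ne_zero.2 (hsph s hs)
      simp only [hψ, Function.update_of_ne (hsph s hs), id]
      field_simp
      ring
    have hc : CircleIntegrable (fun _ : ℂ => (l : ℂ)) 0 r :=
      ContinuousOn.circleIntegrable hr.le continuousOn_const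
    refine h1.trans ((circleIntegral.integral_add (hci _ differentiable_id)
      ((hcs (l * b)).add hc)).trans ?_)
    have h2 := circleIntegral.integral_add (hcs (l * b)) hc
    have h3 : (∮ _ in C((0 : ℂ), r), (l : ℂ)) = 0 :=
      Complex.circleIntegral_eq_zero_of_differentiable_on_off_countable hr.le Set.countable_empty
        continuousOn_const (fun s _ => differentiableAt_const _)
    rw [hI', h3] at h2
    rw [hz _ differentiable_id, zero_add]
    refine h2.trans ?_
    ring

end Center

section Center

variable {E : Type*} [NormedAddCommGroup E] [NormedSpace ℂ E] [FiniteDimensional ℂ E]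

/-- If the slices `h (t, ·)` have at most one zero near the origin for a dense set of `t`, then the
zeros of `h` form the graph of an analytic function. -/
theorem AnalyticAt.exists_center {h : E × ℂ → ℂ} (hh : AnalyticAt ℂ h 0) (h0 : h 0 = 0)
    (hne : ¬ ∀ᶠ s in nhds (0 : ℂ), h (0, s) = 0) {D : Set E}
    (hD : ∀ᶠ t in nhds (0 : E), t ∈ closure D) {r : ℝ} (hr : 0 < r)
    (h1 : ∀ᶠ t in nhds (0 : E), t ∈ D → ∀ s s' : ℂ, ‖s‖ < r → ‖s'‖ < r → h (t, s) = 0 →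
      h (t, s') = 0 → s = s') :
    ∃ c : E → ℂ, AnalyticAt ℂ c 0 ∧ c 0 = 0 ∧
      ∀ᶠ p in nhds (0 : E × ℂ), h p = 0 ↔ p.2 = c p.1 := by
  have hs0 : AnalyticAt ℂ (fun s : ℂ => h (0, s)) 0 :=
    AnalyticAt.comp (f := fun s : ℂ => ((0 : E), s)) (x := 0) hh (by fun_prop)
  obtain ⟨r1, hr1, H1⟩ := eventually_prod_nhds_zero_iff.1 hh.eventually_analyticAt
  have h2 := (hs0.eventually_eq_zero_or_eventually_ne_zero).resolve_left hne
  rw [eventually_nhdsWithin_iff, Metric.eventually_nhds_iff] at h2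
  obtain ⟨r2, hr2, H2⟩ := h2
  set ρ := min (r / 2) (min (r1 / 2) (r2 / 2)) with hρ
  have hρ0 : 0 < ρ := by positivity
  have hρr : ρ < r := (min_le_left _ _).trans_lt (half_lt_self hr)
  have hρ1 : ρ < r1 := ((min_le_right _ _).trans (min_le_left _ _)).trans_lt (half_lt_self hr1)
  have hρ2 : ρ < r2 := ((min_le_right _ _).trans (min_le_right _ _)).trans_lt (half_lt_self hr2)
  have han : ∀ t s, ‖t‖ < r1 → ‖s‖ ≤ ρ → AnalyticAt ℂ h (t, s) := fun t s ht hs =>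
    H1 t s ht (hs.trans_lt hρ1)
  have hball : ∀ t, ‖t‖ < r1 →
      AnalyticOnNhd ℂ (fun s : ℂ => h (t, s)) (Metric.closedBall 0 ρ) := fun t ht s hs =>
    AnalyticAt.comp (f := fun s : ℂ => (t, s)) (x := s) (han t s ht (by simpa using hs))
      (by fun_prop)
  have hsph0 : ∀ s : ℂ, ‖s‖ ≤ ρ → s ≠ 0 → h (0, s) ≠ 0 := fun s hs hs0 =>
    H2 (by simpa using hs.trans_lt hρ2) hs0
  have hsph : ∀ᶠ t in nhds (0 : E), ∀ s ∈ Metric.sphere (0 : ℂ) ρ, h (t, s) ≠ 0 := by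
    refine (isCompact_sphere (0 : ℂ) ρ).eventually_forall_of_forall_eventually fun s hs => ?_
    have hs' : ‖s‖ = ρ := by simpa using hs
    refine (han 0 s (by simpa using hr1) hs'.le).continuousAt.eventually_ne (hsph0 s hs'.le ?_)
    rintro rfl
    simp at hs'
    exact hρ0.ne hs'
  set dh : E × ℂ → ℂ := fun p => fderiv ℂ h p (0, 1) with hdh
  have hdan : ∀ t s, ‖t‖ < r1 → ‖s‖ ≤ ρ → AnalyticAt ℂ dh (t, s) := fun t s ht hs =>
    ((ContinuousLinearMap.apply ℂ ℂ ((0 : E), (1 : ℂ))).analyticAt _).comp (han t s ht hs).fderiv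
  have hderiv : ∀ t s, ‖t‖ < r1 → ‖s‖ ≤ ρ → deriv (fun s => h (t, s)) s = dh (t, s) := by
    intro t s ht hs
    have := (han t s ht hs).differentiableAt.hasFDerivAt.comp_hasDerivAt s
      ((hasDerivAt_const s t).prodMk (hasDerivAt_id s))
    exact this.deriv
  set I0 : E → ℂ := fun t => ∮ s in C(0, ρ), dh (t, s) / h (t, s) with hI0
  set I1 : E → ℂ := fun t => ∮ s in C(0, ρ), s * (dh (t, s) / h (t, s)) with hI1
  have hq : ∀ s : ℂ, ‖s‖ = ρ → AnalyticAt ℂ (fun p : E × ℂ => dh p / h p) (0, s) := by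
    intro s hs
    refine (hdan 0 s (by simpa using hr1) hs.le).div (han 0 s (by simpa using hr1) hs.le)
      (hsph0 s hs.le ?_)
    rintro rfl
    simp at hs
    exact hρ0.ne hs
  have hI0an : AnalyticAt ℂ I0 0 := analyticAt_circleIntegral (fun p => dh p / h p) 0 0 ρ
    fun s hs => hq s (by simpa [abs_of_pos hρ0] using hs)
  have hI1an : AnalyticAt ℂ I1 0 := analyticAt_circleIntegral (fun p => p.2 * (dh p / h p)) 0 0 ρ
    fun s hs => analyticAt_snd.mul (hq s (by simpa [abs_of_pos hρ0] using hs))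
  have key : ∀ t, ‖t‖ < r1 → ∀ b : ℂ, ‖b‖ < ρ → h (t, b) = 0 →
      (∀ s : ℂ, ‖s‖ ≤ ρ → s ≠ b → h (t, s) ≠ 0) → I0 t ≠ 0 ∧ I1 t / I0 t = b := by
    intro t ht b hb hb0 hbu
    obtain ⟨l, hl, e0, e1⟩ := circleIntegral_logDeriv_of_unique_zero (hball t ht)
      (by simpa using hb) hb0 (fun s hs => hbu s (by simpa using hs))
    have c0 : I0 t = l * (2 * Real.pi * Complex.I) := by
      rw [← e0]
      refine circleIntegral.integral_congr hρ0.le fun s hs => ?_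
      rw [hderiv t s ht (by simpa using (Metric.mem_sphere.1 hs).le)]
    have c1 : I1 t = l * (2 * Real.pi * Complex.I) * b := by
      rw [← e1]
      refine circleIntegral.integral_congr hρ0.le fun s hs => ?_
      rw [hderiv t s ht (by simpa using (Metric.mem_sphere.1 hs).le)]
    have hne : (l : ℂ) * (2 * Real.pi * Complex.I) ≠ 0 :=
      mul_ne_zero (by exact_mod_cast hl) Complex.two_pi_I_ne_zero
    refine ⟨c0 ▸ hne, ?_⟩
    rw [c0, c1, mul_div_cancel_left₀ _ hne]
  obtain ⟨n0, c00⟩ := key 0 (by simpa using hr1) 0 (by simpa using hρ0) h0 hsph0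
  set c : E → ℂ := fun t => I1 t / I0 t with hc
  have hcan : AnalyticAt ℂ c 0 := hI1an.div hI0an n0
  have hcD : ∀ᶠ t in nhds (0 : E), t ∈ D → h (t, c t) = 0 ∧ ‖c t‖ < ρ := by
    filter_upwards [hh.eventually_exists_zero h0 hne hρ0, h1, hsph,
      Metric.ball_mem_nhds (0 : E) hr1] with t ⟨b, hb, hb0⟩ hu hs ht htD
    have : c t = b := (key t (by simpa using ht) b hb hb0 fun s hs' hsb hs0 => hsb
      (hu htD s b (hs'.trans_lt hρr) (hb.trans hρr) hs0 hb0)).2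
    rw [this]
    exact ⟨hb0, hb⟩
  have hcc : ∀ᶠ t in nhds (0 : E), ContinuousAt c t ∧ ‖c t‖ < ρ :=
    (hcan.eventually_analyticAt.mono fun t ht => ht.continuousAt).and
      (hcan.continuousAt.norm.eventually (gt_mem_nhds (by
        show ‖c 0‖ < ρ
        rwa [show c 0 = 0 from c00, norm_zero])))
  have hall : ∀ᶠ t in nhds (0 : E), h (t, c t) = 0 := by
    filter_upwards [hD, hcc, hcD.eventually_nhds, Metric.ball_mem_nhds (0 : E) hr1]
      with t htD ⟨htc, htρ⟩ hev ht
    have hcont : ContinuousAt (fun t => h (t, c t)) t :=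
      ContinuousAt.comp (f := fun t => (t, c t)) (x := t)
        (han t (c t) (by simpa using ht) htρ.le).continuousAt (continuousAt_id.prodMk htc)
    by_contra hne0
    obtain ⟨t', h3, htD'⟩ := (mem_closure_iff_frequently.1 htD |>.and_eventually
      ((hcont.eventually_ne hne0).and hev)).exists
    exact htD'.1 (htD'.2 h3).1
  refine ⟨c, hcan, c00, ?_⟩
  have hN : ∀ᶠ t in nhds (0 : E), ∀ s : ℂ, ‖s‖ < ρ → h (t, s) = 0 → s = c t := by
    filter_upwards [hD, hcc, hcD.eventually_nhds, Metric.ball_mem_nhds (0 : E) hr1, hsph,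
      h1.eventually_nhds] with t htD ⟨htc, htρ⟩ hev ht hts hu s hs hs0
    have ht' : ‖t‖ < r1 := by simpa using ht
    by_contra hsc
    set ε := min (‖s - c t‖ / 2) (ρ - ‖s‖) with hε
    have hε0 : 0 < ε := lt_min (half_pos (norm_pos_iff.2 (sub_ne_zero.2 hsc))) (sub_pos.2 hs)
    have hnz : ¬ ∀ᶠ s' in nhds (0 : ℂ), h (t, s + s') = 0 := by
      intro hz
      have hz' : ∀ᶠ s' in nhds s, h (t, s') = 0 := by
        have : Filter.Tendsto (fun s' => s' - s) (nhds s) (nhds 0) :=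
          (continuous_id.sub continuous_const).tendsto' s 0 (sub_self s)
        simpa using this.eventually hz
      have hE := (hball t ht').eqOn_zero_of_preconnected_of_eventuallyEq_zero
        (convex_closedBall (0 : ℂ) ρ).isPreconnected (by simpa using hs.le) hz'
      refine hts (ρ : ℂ) (by simp [abs_of_pos hρ0]) (hE (by simp [abs_of_pos hρ0]))
    have hz := AnalyticAt.eventually_exists_zero (h := fun p : E × ℂ => h (t + p.1, s + p.2))
      (AnalyticAt.comp_of_eq (han t s ht' hs.le) (f := fun p : E × ℂ => (t + p.1, s + p.2))
        (by fun_prop) (by simp)) (by simpa using hs0) (by simpa using hnz) hε0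
    have hz' : ∀ᶠ t' in nhds t, ∃ s' : ℂ, ‖s'‖ < ε ∧ h (t', s + s') = 0 := by
      have : Filter.Tendsto (fun t' => t' - t) (nhds t) (nhds 0) :=
        (continuous_id.sub continuous_const).tendsto' t 0 (sub_self t)
      simpa using this.eventually hz
    have hcl : ∀ᶠ t' in nhds t, ‖c t' - c t‖ < ‖s - c t‖ / 2 := by
      have := Metric.continuousAt_iff'.1 htc (‖s - c t‖ / 2)
        (half_pos (norm_pos_iff.2 (sub_ne_zero.2 hsc)))
      simpa [dist_eq_norm] using this
    obtain ⟨t', htD', ⟨s', hs', hs0'⟩, hct, h3, h4⟩ := (mem_closure_iff_frequently.1 htD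
      |>.and_eventually (hz'.and (hcl.and (hev.and hu)))).exists
    have h5 : ‖s + s'‖ < r := by
      have := norm_add_le s s'
      have := hs'.trans_le (min_le_right _ _)
      linarith
    have h6 := h4 htD' _ _ h5 ((h3 htD').2.trans hρr) hs0' (h3 htD').1
    have h7 : s - c t = (c t' - c t) - s' := by rw [← h6]; ring
    have h8 := norm_sub_le (c t' - c t) s'
    rw [← h7] at h8
    have := hs'.trans_le (min_le_left _ _)
    linarith
  have hb : ∀ᶠ s in nhds (0 : ℂ), ‖s‖ < ρ :=
    (continuous_norm.tendsto (0 : ℂ)).eventually (gt_mem_nhds (by rwa [norm_zero]))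
  rw [← Prod.mk_zero_zero, nhds_prod_eq]
  filter_upwards [(hN.and hall).prod_inl (nhds (0 : ℂ)),
    hb.prod_inr (nhds (0 : E))] with p hp hp2
  constructor
  · intro h
    exact hp.1 p.2 hp2 h
  · intro h
    have := hp.2
    rwa [← h] at this

end Center

section Pieces

variable {E : Type*} [NormedAddCommGroup E] [NormedSpace ℂ E] [FiniteDimensional ℂ E]

theorem AnalyticAt.exists_implicit_snd {g : E × (ℂ × ℂ) → ℂ} {z0 : E × (ℂ × ℂ)}
    (hg : AnalyticAt ℂ g z0) (hd : fderiv ℂ g z0 (0, (0, 1)) ≠ 0) :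
    ∃ φ : E × ℂ → ℂ, AnalyticAt ℂ φ (z0.1, z0.2.1) ∧ φ (z0.1, z0.2.1) = z0.2.2 ∧
      ∀ᶠ z in nhds z0, g z = g z0 ↔ z.2.2 = φ (z.1, z.2.1) := by
  let A : ((E × ℂ) × ℂ) →L[ℂ] E × (ℂ × ℂ) :=
    ((ContinuousLinearMap.fst ℂ E ℂ).comp (ContinuousLinearMap.fst ℂ (E × ℂ) ℂ)).prod
      (((ContinuousLinearMap.snd ℂ E ℂ).comp (ContinuousLinearMap.fst ℂ (E × ℂ) ℂ)).prod
        (ContinuousLinearMap.snd ℂ (E × ℂ) ℂ))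
  have hA : AnalyticAt ℂ (fun w => g (A w)) ((z0.1, z0.2.1), z0.2.2) :=
    hg.comp_of_eq (A.analyticAt _) rfl
  have hdA : fderiv ℂ (fun w => g (A w)) ((z0.1, z0.2.1), z0.2.2) (0, 1) ≠ 0 := by
    have := (HasFDerivAt.comp (g := g) ((z0.1, z0.2.1), z0.2.2)
      (hg.differentiableAt.hasFDerivAt) A.hasFDerivAt).fderiv
    rw [show (fun w => g (A w)) = g ∘ A from rfl, this]
    exact hd
  obtain ⟨φ, h1, h2, h3⟩ := hA.exists_implicit hdA
  refine ⟨φ, h1, h2, ?_⟩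
  have : Continuous fun z : E × (ℂ × ℂ) => ((z.1, z.2.1), z.2.2) := by fun_prop
  exact (this.tendsto z0).eventually h3

theorem AnalyticAt.exists_implicit_fst {g : E × (ℂ × ℂ) → ℂ} {z0 : E × (ℂ × ℂ)}
    (hg : AnalyticAt ℂ g z0) (hd : fderiv ℂ g z0 (0, (1, 0)) ≠ 0) :
    ∃ φ : E × ℂ → ℂ, AnalyticAt ℂ φ (z0.1, z0.2.2) ∧ φ (z0.1, z0.2.2) = z0.2.1 ∧
      ∀ᶠ z in nhds z0, g z = g z0 ↔ z.2.1 = φ (z.1, z.2.2) := by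
  let A : ((E × ℂ) × ℂ) →L[ℂ] E × (ℂ × ℂ) :=
    ((ContinuousLinearMap.fst ℂ E ℂ).comp (ContinuousLinearMap.fst ℂ (E × ℂ) ℂ)).prod
      ((ContinuousLinearMap.snd ℂ (E × ℂ) ℂ).prod
        ((ContinuousLinearMap.snd ℂ E ℂ).comp (ContinuousLinearMap.fst ℂ (E × ℂ) ℂ)))
  have hA : AnalyticAt ℂ (fun w => g (A w)) ((z0.1, z0.2.2), z0.2.1) :=
    hg.comp_of_eq (A.analyticAt _) rfl
  have hdA : fderiv ℂ (fun w => g (A w)) ((z0.1, z0.2.2), z0.2.1) (0, 1) ≠ 0 := by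
    have := (HasFDerivAt.comp (g := g) ((z0.1, z0.2.2), z0.2.1)
      (hg.differentiableAt.hasFDerivAt) A.hasFDerivAt).fderiv
    rw [show (fun w => g (A w)) = g ∘ A from rfl, this]
    exact hd
  obtain ⟨φ, h1, h2, h3⟩ := hA.exists_implicit hdA
  refine ⟨φ, h1, h2, ?_⟩
  have : Continuous fun z : E × (ℂ × ℂ) => ((z.1, z.2.2), z.2.1) := by fun_prop
  exact (this.tendsto z0).eventually h3

/-- Near the origin `S` is covered by branches `(t, τ) ↦ (t, τ ^ k * u, σ)` with `u` a unit. -/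
def PieceForm (S : Set (E × (ℂ × ℂ))) : Prop :=
  ∃ (ι : Type) (_ : Finite ι) (k : ι → ℕ) (u σ : ι → E × ℂ → ℂ),
    (∀ i, 0 < k i ∧ AnalyticAt ℂ (u i) 0 ∧ u i 0 ≠ 0 ∧ AnalyticAt ℂ (σ i) 0 ∧ σ i 0 = 0) ∧
    (∀ i, ∀ᶠ p in nhds (0 : E × ℂ), (p.1, (p.2 ^ k i * u i p, σ i p)) ∈ S) ∧
    ∀ U ∈ nhds (0 : E × ℂ), ∀ᶠ z in nhds (0 : E × (ℂ × ℂ)), z ∈ S →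
      ∃ i, ∃ τ : ℂ, (z.1, τ) ∈ U ∧ z.2 = (τ ^ k i * u i (z.1, τ), σ i (z.1, τ))

theorem AnalyticAt.tendsto_mk {X Y Z : Type*} [NormedAddCommGroup X] [NormedSpace ℂ X]
    [NormedAddCommGroup Y] [NormedSpace ℂ Y] [NormedAddCommGroup Z] [NormedSpace ℂ Z]
    {f : X → Y} {g : X → Z} (hf : AnalyticAt ℂ f 0) (hf0 : f 0 = 0) (hg : AnalyticAt ℂ g 0)
    (hg0 : g 0 = 0) : Filter.Tendsto (fun x => (f x, g x)) (nhds 0) (nhds 0) :=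
  (hf.prod hg).tendsto_of_eq (by rw [hf0, hg0]; rfl)

theorem pieceForm_of_fderiv_ne_zero {S : Set (E × (ℂ × ℂ))} {g : E × (ℂ × ℂ) → ℂ}
    (hg : AnalyticAt ℂ g 0) (hS : ∀ᶠ z in nhds 0, z ∈ S ↔ g z = 0) (hd : fderiv ℂ g 0 ≠ 0)
    (hE : ∀ᶠ z in nhds (0 : E × (ℂ × ℂ)), z.2.1 = 0 → (z ∈ S ↔ z.2.2 = 0)) : PieceForm S := by
  have g0 : g 0 = 0 := hS.self_of_nhds.1 ((hE.self_of_nhds rfl).2 rfl)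
  have hdt : ∀ v : E, fderiv ℂ g 0 (v, 0) = 0 := by
    intro v
    have h1 : ∀ᶠ t in nhds (0 : E), g (t, 0) = 0 := by
      filter_upwards [tendsto_prodMk_zero.eventually (hS.and hE)] with t ⟨h1, h2⟩
      exact h1.1 ((h2 rfl).2 rfl)
    have h2 : HasFDerivAt (fun t : E => g (t, 0))
        ((fderiv ℂ g 0).comp (ContinuousLinearMap.inl ℂ E (ℂ × ℂ))) 0 :=
      HasFDerivAt.comp (g := g) (f := fun t : E => (t, (0 : ℂ × ℂ))) 0
        hg.differentiableAt.hasFDerivAt (ContinuousLinearMap.inl ℂ E (ℂ × ℂ)).hasFDerivAt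
    have h3 := h2.fderiv
    rw [Filter.EventuallyEq.fderiv_eq (f := fun _ => (0 : ℂ)) h1, fderiv_fun_const] at h3
    have := congrArg (fun L => L v) h3
    simpa using this.symm
  by_cases hs : fderiv ℂ g 0 (0, (0, 1)) = 0
  · have hx : fderiv ℂ g 0 (0, (1, 0)) ≠ 0 := by
      intro hx
      refine hd (ContinuousLinearMap.ext fun w => ?_)
      have : w = (w.1, 0) + (w.2.1 • ((0 : E), ((1 : ℂ), (0 : ℂ))) +
          w.2.2 • ((0 : E), ((0 : ℂ), (1 : ℂ)))) := by
        simp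
      rw [this, map_add, map_add, map_smul, map_smul, hs, hx, hdt]
      simp
    obtain ⟨φ, hφ, hφ0, h⟩ := hg.exists_implicit_fst hx
    simp only [g0] at h
    replace hφ : AnalyticAt ℂ φ 0 := hφ
    replace hφ0 : φ 0 = 0 := hφ0
    have hmem : ∀ᶠ z in nhds (0 : E × (ℂ × ℂ)), z ∈ S ↔ z.2.1 = φ (z.1, z.2.2) := by
      filter_upwards [hS, h] with z h1 h2
      rw [h1, h2]
    have hφz : ∀ᶠ p in nhds (0 : E × ℂ), φ p = 0 ↔ p.2 = 0 := by
      have ht : Filter.Tendsto (fun p : E × ℂ => (p.1, ((0 : ℂ), p.2))) (nhds 0) (nhds 0) :=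
        Continuous.tendsto' (by fun_prop) 0 0 rfl
      filter_upwards [ht.eventually (hmem.and hE)] with p ⟨h1, h2⟩
      rw [← h2 rfl, h1, eq_comm]
    obtain ⟨k, u, hu, hu0, hk⟩ := hφ.exists_eq_pow_mul_unit
      (hφz.mono fun p hp h2 h3 => h2 (hp.1 h3))
    have hk0 : 0 < k := by
      rcases Nat.eq_zero_or_pos k with rfl | h
      · have := hk.self_of_nhds
        rw [hφ0, pow_zero, one_mul] at this
        exact absurd this.symm hu0
      · exact h
    refine ⟨Unit, inferInstance, fun _ => k, fun _ => u, fun _ p => p.2, fun _ =>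
      ⟨hk0, hu, hu0, analyticAt_snd, rfl⟩, fun _ => ?_, fun U hU => ?_⟩
    · have ht : Filter.Tendsto (fun p : E × ℂ => (p.1, (φ p, p.2))) (nhds 0) (nhds 0) :=
        AnalyticAt.tendsto_mk analyticAt_fst rfl (hφ.prod analyticAt_snd) (by simp [hφ0])
      filter_upwards [ht.eventually hmem, hk] with p h1 h2
      rw [← h2]
      exact h1.2 rfl
    · have ht : Filter.Tendsto (fun z : E × (ℂ × ℂ) => (z.1, z.2.2)) (nhds 0) (nhds 0) :=
        Continuous.tendsto' (by fun_prop) 0 0 rfl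
      filter_upwards [hmem, ht.eventually hk, ht hU] with z h1 h2 h3 hz
      refine ⟨(), z.2.2, h3, Prod.ext ?_ rfl⟩
      rw [h1.1 hz, h2]
  · obtain ⟨φ, hφ, hφ0, h⟩ := hg.exists_implicit_snd hs
    simp only [g0] at h
    replace hφ : AnalyticAt ℂ φ 0 := hφ
    replace hφ0 : φ 0 = 0 := hφ0
    have hmem : ∀ᶠ z in nhds (0 : E × (ℂ × ℂ)), z ∈ S ↔ z.2.2 = φ (z.1, z.2.1) := by
      filter_upwards [hS, h] with z h1 h2
      rw [h1, h2]
    refine ⟨Unit, inferInstance, fun _ => 1, fun _ _ => 1, fun _ => φ, fun _ =>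
      ⟨one_pos, analyticAt_const, one_ne_zero, hφ, hφ0⟩, fun _ => ?_, fun U hU => ?_⟩
    · have ht : Filter.Tendsto (fun p : E × ℂ => (p.1, (p.2, φ p))) (nhds 0) (nhds 0) :=
        AnalyticAt.tendsto_mk analyticAt_fst rfl (analyticAt_snd.prod hφ) (by simp [hφ0])
      filter_upwards [ht.eventually hmem] with p h1
      rw [pow_one, mul_one]
      exact h1.2 rfl
    · have ht : Filter.Tendsto (fun z : E × (ℂ × ℂ) => (z.1, z.2.1)) (nhds 0) (nhds 0) :=
        Continuous.tendsto' (by fun_prop) 0 0 rfl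
      filter_upwards [hmem, ht hU] with z h1 h3 hz
      refine ⟨(), z.2.1, h3, Prod.ext ?_ ?_⟩
      · simp
      · exact h1.1 hz

theorem fderiv_comp_ne_zero {X Y : Type*} [NormedAddCommGroup X] [NormedSpace ℂ X]
    [NormedAddCommGroup Y] [NormedSpace ℂ Y] {g : Y → ℂ} {f : X → Y} {f' : Y → X} {y : Y} {x : X}
    (hg : AnalyticAt ℂ g y) (hf : AnalyticAt ℂ f x) (hf' : AnalyticAt ℂ f' y) (hx : f' y = x)
    (h : ∀ᶠ w in nhds y, f (f' w) = w) (hd : fderiv ℂ g y ≠ 0) :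
    fderiv ℂ (fun z => g (f z)) x ≠ 0 := by
  intro h0
  subst hx
  have hy : f (f' y) = y := h.self_of_nhds
  have h1 : (fun w => g (f (f' w))) =ᶠ[nhds y] g := h.mono fun w hw => by simp only [hw]
  have h2 : AnalyticAt ℂ (fun z => g (f z)) (f' y) := hg.comp_of_eq hf hy
  have h3 := (h2.differentiableAt.hasFDerivAt.comp y hf'.differentiableAt.hasFDerivAt).fderiv
  rw [h0, ContinuousLinearMap.zero_comp] at h3
  exact hd ((Filter.EventuallyEq.fderiv_eq (𝕜 := ℂ) h1).symm.trans h3)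

end Pieces

section Equations

theorem le_of_pow_mul_eq {a b : ℕ} {u w : ℂ → ℂ} (hu : ContinuousAt u 0) (hw : ContinuousAt w 0)
    (hu0 : u 0 ≠ 0) (h : ∀ᶠ τ in nhds (0 : ℂ), τ ≠ 0 → τ ^ a * u τ = τ ^ b * w τ) : b ≤ a := by
  by_contra hab
  push Not at hab
  have h1 : ∀ᶠ τ in nhdsWithin (0 : ℂ) {0}ᶜ, u τ = τ ^ (b - a) * w τ := by
    filter_upwards [h.filter_mono nhdsWithin_le_nhds, self_mem_nhdsWithin] with τ hτ h0
    apply mul_left_cancel₀ (pow_ne_zero a h0)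
    rw [hτ h0, ← mul_assoc, ← pow_add, Nat.add_sub_cancel' hab.le]
  have h2 : Filter.Tendsto (fun τ : ℂ => τ ^ (b - a) * w τ) (nhds 0) (nhds 0) := by
    have : ContinuousAt (fun τ : ℂ => τ ^ (b - a) * w τ) 0 := (continuousAt_id.pow _).mul hw
    simpa [ContinuousAt, zero_pow (Nat.sub_ne_zero_of_lt hab)] using this
  refine hu0 (tendsto_nhds_unique (hu.tendsto.mono_left
    (nhdsWithin_le_nhds (s := {0}ᶜ))) ?_)
  exact (h2.mono_left nhdsWithin_le_nhds).congr' (h1.mono fun _ hτ => hτ.symm)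

theorem eq_of_pow_mul_eq {a b : ℕ} {u w : ℂ → ℂ} (hu : ContinuousAt u 0) (hw : ContinuousAt w 0)
    (hu0 : u 0 ≠ 0) (hw0 : w 0 ≠ 0)
    (h : ∀ᶠ τ in nhds (0 : ℂ), τ ≠ 0 → τ ^ a * u τ = τ ^ b * w τ) : a = b :=
  le_antisymm (le_of_pow_mul_eq hw hu hw0 (h.mono fun τ hτ h0 => (hτ h0).symm))
    (le_of_pow_mul_eq hu hw hu0 h)

theorem eq_of_pow_mul_eq_pow_mul {m : ℕ} {u w : ℂ → ℂ} (hu : ContinuousAt u 0)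
    (hw : ContinuousAt w 0) (h : ∀ᶠ τ in nhds (0 : ℂ), τ ^ m * u τ = τ ^ m * w τ) : u 0 = w 0 := by
  refine tendsto_nhds_unique (hu.tendsto.mono_left (nhdsWithin_le_nhds (s := {0}ᶜ))) ?_
  refine (hw.tendsto.mono_left nhdsWithin_le_nhds).congr' ?_
  filter_upwards [h.filter_mono nhdsWithin_le_nhds, self_mem_nhdsWithin] with τ hτ h0
  exact (mul_left_cancel₀ (pow_ne_zero m h0) hτ).symm

variable {E : Type*} [NormedAddCommGroup E] [NormedSpace ℂ E]

theorem exists_perm_of_conjugates {N d : ℕ} (hN : 0 < N) {ξ : Fin d → E × ℂ → ℂ}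
    (hne : ∀ i j, i ≠ j → ∀ᶠ p in nhds (0 : E × ℂ), p.2 ≠ 0 → ξ i p ≠ ξ j p) {ω : ℂ}
    (hω1 : ω ^ N = 1) (hω : ∀ i, ∃ j, ∀ᶠ p in nhds (0 : E × ℂ), ξ i (p.1, ω * p.2) = ξ j p) :
    ∃ σ : Equiv.Perm (Fin d), ∀ᶠ p in nhds (0 : E × ℂ), ∀ i, ξ i (p.1, ω * p.2) = ξ (σ i) p := by
  have hω0 : ω ≠ 0 := by rintro rfl; simp [hN.ne'] at hω1
  choose σ hσ using hω
  have hinj : Function.Injective σ := by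
    intro i j hij
    by_contra hcon
    obtain ⟨p, hp, hp0⟩ := exists_snd_ne_zero (((hσ i).and (hσ j)).and
      ((tendsto_fst_mul ω).eventually (hne i j hcon)))
    refine hp.2 (mul_ne_zero hω0 hp0) ?_
    rw [hp.1.1, hp.1.2, hij]
  exact ⟨Equiv.ofBijective σ (Finite.injective_iff_bijective.1 hinj), Filter.eventually_all.2 hσ⟩

theorem exists_equation {N d : ℕ} (hN : 0 < N) {ξ : Fin d → E × ℂ → ℂ}
    (hξ : ∀ i, AnalyticAt ℂ (ξ i) 0)
    (hne : ∀ i j, i ≠ j → ∀ᶠ p in nhds (0 : E × ℂ), p.2 ≠ 0 → ξ i p ≠ ξ j p)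
    (hω : ∀ ω : ℂ, ω ^ N = 1 → ∀ i, ∃ j, ∀ᶠ p in nhds (0 : E × ℂ), ξ i (p.1, ω * p.2) = ξ j p) :
    ∃ G : E × (ℂ × ℂ) → ℂ, AnalyticAt ℂ G 0 ∧
      (∀ᶠ p in nhds (0 : (E × ℂ) × ℂ), G (p.1.1, (p.2 ^ N, p.1.2)) =
        ∏ i, (p.1.2 - ξ i (p.1.1, p.2))) ∧
      ∀ᶠ z in nhds (0 : E × (ℂ × ℂ)), (G z = 0 ↔
        ∃ i, ∃ τ : ℂ, τ ^ N = z.2.1 ∧ ξ i (z.1, τ) = z.2.2) := by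
  have ht : Filter.Tendsto (fun p : (E × ℂ) × ℂ => (p.1.1, p.2)) (nhds 0) (nhds 0) :=
    Continuous.tendsto' (by fun_prop) 0 0 rfl
  have han : AnalyticAt ℂ (fun p : (E × ℂ) × ℂ => ∏ i, (p.1.2 - ξ i (p.1.1, p.2))) 0 := by
    refine Finset.analyticAt_fun_prod _ fun i _ => ?_
    have : AnalyticAt ℂ (fun p : (E × ℂ) × ℂ => ξ i (p.1.1, p.2)) 0 :=
      AnalyticAt.comp_of_eq (f := fun p : (E × ℂ) × ℂ => (p.1.1, p.2)) (hξ i) (by fun_prop) rfl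
    fun_prop
  obtain ⟨a, ha, h⟩ := han.exists_descent hN (by
    intro ω hω1
    obtain ⟨σ, hσ⟩ := exists_perm_of_conjugates hN hne hω1 (hω ω hω1)
    filter_upwards [ht.eventually hσ] with p hp
    simp only [hp]
    exact Equiv.prod_comp σ fun i => p.1.2 - ξ i (p.1.1, p.2))
  refine ⟨fun z => a ((z.1, z.2.2), z.2.1), ?_, h, ?_⟩
  · exact AnalyticAt.comp_of_eq (f := fun z : E × (ℂ × ℂ) => ((z.1, z.2.2), z.2.1)) ha
      (by fun_prop) rfl
  · have ht' : Filter.Tendsto (fun z : E × (ℂ × ℂ) => ((z.1, z.2.2), z.2.1)) (nhds 0) (nhds 0) :=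
      Continuous.tendsto' (by fun_prop) 0 0 rfl
    filter_upwards [ht'.eventually (eventually_forall_pow_eq (N := N) h)] with z hz
    constructor
    · intro h0
      obtain ⟨τ, hτ⟩ := IsAlgClosed.exists_pow_nat_eq z.2.1 hN
      have h1 := hz τ hτ
      simp only [hτ] at h1
      rw [h0, eq_comm, Finset.prod_eq_zero_iff] at h1
      obtain ⟨i, -, hi⟩ := h1
      exact ⟨i, τ, hτ, (sub_eq_zero.1 hi).symm⟩
    · rintro ⟨i, τ, hτ, hi⟩
      have h1 := hz τ hτ
      simp only [hτ] at h1
      rw [h1]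
      exact Finset.prod_eq_zero (Finset.mem_univ i) (sub_eq_zero.2 hi.symm)

theorem fderiv_ne_zero_of_single_branch {N : ℕ} (hN : 0 < N) {ξ : Fin 1 → E × ℂ → ℂ}
    {G : E × (ℂ × ℂ) → ℂ} (hG : AnalyticAt ℂ G 0)
    (h : ∀ᶠ p in nhds (0 : (E × ℂ) × ℂ), G (p.1.1, (p.2 ^ N, p.1.2)) =
        ∏ i, (p.1.2 - ξ i (p.1.1, p.2))) : fderiv ℂ G 0 ≠ 0 := by
  intro h0
  have h1 : HasDerivAt (fun y : ℂ => G (0, (0, y))) (fderiv ℂ G 0 (0, (0, 1))) 0 :=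
    HasFDerivAt.comp_hasDerivAt (l := G) (f := fun y : ℂ => ((0 : E), ((0 : ℂ), y))) 0
      hG.differentiableAt.hasFDerivAt
      ((hasDerivAt_const _ _).prodMk ((hasDerivAt_const _ _).prodMk (hasDerivAt_id _)))
  have ht : Filter.Tendsto (fun y : ℂ => (((0 : E), y), (0 : ℂ))) (nhds 0) (nhds 0) :=
    Continuous.tendsto' (by fun_prop) 0 0 rfl
  have h2 : (fun y : ℂ => G (0, (0, y))) =ᶠ[nhds 0] fun y => y - ξ 0 0 := by
    filter_upwards [ht.eventually h] with y hy
    simpa [zero_pow hN.ne', Prod.mk_zero_zero] using hy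
  have h3 : HasDerivAt (fun y : ℂ => y - ξ 0 0) 1 0 := (hasDerivAt_id _).sub_const _
  have := (h1.congr_of_eventuallyEq h2.symm).unique h3
  rw [h0] at this
  simp at this

end Equations

section Slices

theorem eq_of_pow_eq_one_of_tendsto {e : ℕ} (he : 0 < e) {f g : ℂ → ℂ} (hf : ContinuousAt f 0)
    (hg : ContinuousAt g 0) (hfg : f 0 = g 0) (hfe : ∀ᶠ τ in nhds (0 : ℂ), f τ ^ e = 1)
    (hge : ∀ᶠ τ in nhds (0 : ℂ), g τ ^ e = 1) : ∀ᶠ τ in nhds (0 : ℂ), f τ = g τ := by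
  have h0 : f 0 ≠ 0 := by
    intro h
    have := hfe.self_of_nhds
    rw [h, zero_pow he.ne'] at this
    exact zero_ne_one this
  have hd := hasStrictDerivAt_pow e (f 0)
  have hl := hd.eventually_left_inverse
    (mul_ne_zero (Nat.cast_ne_zero.2 he.ne') (pow_ne_zero _ h0))
  have hgt : Filter.Tendsto g (nhds 0) (nhds (f 0)) := hfg ▸ hg.tendsto
  filter_upwards [hf.eventually hl, hgt.eventually hl, hfe, hge] with τ h1 h2 h3 h4
  rw [← h1, ← h2, h3, h4]

theorem card_le_of_pow_eq_one {d e : ℕ} (he : 0 < e) {c : Fin d → ℂ}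
    (hc : Function.Injective c) (h : ∀ i, c i ^ e = 1) : d ≤ e := by
  have h1 : (Finset.univ.image c) ⊆ (nthRoots e (1 : ℂ)).toFinset := by
    intro z hz
    obtain ⟨i, -, rfl⟩ := Finset.mem_image.1 hz
    rw [Multiset.mem_toFinset, mem_nthRoots he]
    exact h i
  have h2 := Finset.card_le_card h1
  rw [Finset.card_image_of_injective _ hc, Finset.card_univ, Fintype.card_fin] at h2
  exact h2.trans ((Multiset.toFinset_card_le _).trans (card_nthRoots e 1))

theorem exists_exponent_of_slice {N d : ℕ} (hN : 0 < N) (hd : 0 < d) {φ : ℂ → ℂ} {y0 : ℂ}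
    (hφ : AnalyticAt ℂ φ y0) {ξ : Fin d → ℂ → ℂ} (hξ : ∀ i, AnalyticAt ℂ (ξ i) 0)
    (hξ0 : ∀ i, ξ i 0 = y0) (h : ∀ i, ∀ᶠ τ in nhds (0 : ℂ), φ (ξ i τ) = τ ^ N)
    (hne : ∀ i j, i ≠ j → ∀ᶠ τ in nhds (0 : ℂ), τ ≠ 0 → ξ i τ ≠ ξ j τ) :
    ∃ m e : ℕ, 0 < m ∧ m * e = N ∧ d ≤ e ∧ ∀ i j, i ≠ j → ∃ w : ℂ → ℂ, ContinuousAt w 0 ∧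
      w 0 ≠ 0 ∧ ∀ᶠ τ in nhds (0 : ℂ), ξ i τ - ξ j τ = τ ^ m * w τ := by
  have hexn : ∀ {P : ℂ → Prop}, (∀ᶠ τ in nhds (0 : ℂ), P τ) → ∃ τ, P τ ∧ τ ≠ 0 := fun hP =>
    ((hP.filter_mono (nhdsWithin_le_nhds (s := {0}ᶜ))).and self_mem_nhdsWithin).exists
  have hφ0 : φ y0 = 0 := by
    have := (h ⟨0, hd⟩).self_of_nhds
    rwa [hξ0, zero_pow hN.ne'] at this
  have hξt : ∀ i, Filter.Tendsto (ξ i) (nhds 0) (nhds y0) := fun i => by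
    have := (hξ i).continuousAt.tendsto
    rwa [hξ0] at this
  obtain ⟨e, U, hU, hU0, hφU⟩ := hφ.exists_eventuallyEq_pow_smul_nonzero_iff.2 fun hz => by
    obtain ⟨τ, ⟨h1, h2⟩, h3⟩ := hexn (((hξt ⟨0, hd⟩).eventually hz).and (h ⟨0, hd⟩))
    exact pow_ne_zero N h3 (h2.symm.trans h1)
  have hv : ∀ i, ∃ m v, AnalyticAt ℂ v 0 ∧ v 0 ≠ 0 ∧
      ∀ᶠ τ in nhds (0 : ℂ), ξ i τ - y0 = τ ^ m * v τ := by
    intro i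
    have ha : AnalyticAt ℂ (fun τ => ξ i τ - y0) 0 := (hξ i).sub analyticAt_const
    obtain ⟨m, v, h1, h2, h3⟩ := ha.exists_eventuallyEq_pow_smul_nonzero_iff.2 fun hz => by
      obtain ⟨τ, ⟨h1, h2⟩, h3⟩ := hexn (hz.and (h i))
      rw [sub_eq_zero.1 h1, hφ0] at h2
      exact pow_ne_zero N h3 h2.symm
    exact ⟨m, v, h1, h2, h3.mono fun τ hτ => by rw [hτ, sub_zero, smul_eq_mul]⟩
  choose m v hv hv0 hξv using hv
  have key : ∀ i, ∀ᶠ τ in nhds (0 : ℂ), τ ^ (m i * e) * (v i τ ^ e * U (ξ i τ)) = τ ^ N * 1 := by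
    intro i
    filter_upwards [h i, (hξt i).eventually hφU, hξv i] with τ h1 h2 h3
    rw [← h1, h2, h3, smul_eq_mul, mul_one, mul_pow, pow_mul]
    ring
  have hUc : ∀ i, ContinuousAt (fun τ => U (ξ i τ)) 0 := fun i =>
    ContinuousAt.comp_of_eq hU.continuousAt (hξ i).continuousAt (hξ0 i)
  have hme : ∀ i, m i * e = N := fun i =>
    eq_of_pow_mul_eq (u := fun τ => v i τ ^ e * U (ξ i τ)) (w := fun _ => 1)
      (((hv i).continuousAt.pow _).mul (hUc i)) continuousAt_const
      (mul_ne_zero (pow_ne_zero _ (hv0 i)) (by rw [hξ0]; exact hU0)) one_ne_zero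
      ((key i).mono fun τ hτ _ => hτ)
  have he : 0 < e := by
    rcases Nat.eq_zero_or_pos e with rfl | he
    · exact absurd (hme ⟨0, hd⟩) (by rw [mul_zero]; exact hN.ne)
    · exact he
  have hm : ∀ i, m i = m ⟨0, hd⟩ := fun i =>
    Nat.eq_of_mul_eq_mul_right he ((hme i).trans (hme ⟨0, hd⟩).symm)
  obtain ⟨R, hR, hR0, hRe⟩ := hU.exists_pow_eq hU0 he
  have hRc : ∀ i, ContinuousAt (fun τ => R (ξ i τ)) 0 := fun i =>
    ContinuousAt.comp_of_eq hR.continuousAt (hξ i).continuousAt (hξ0 i)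
  have hf1 : ∀ i, ∀ᶠ τ in nhds (0 : ℂ), (v i τ * R (ξ i τ)) ^ e = 1 := by
    intro i
    have hoff : ∀ᶠ τ in nhds (0 : ℂ), τ ≠ 0 → (v i τ * R (ξ i τ)) ^ e = 1 := by
      filter_upwards [key i] with τ h1 h2
      rw [hme] at h1
      rw [mul_pow, hRe]
      exact mul_left_cancel₀ (pow_ne_zero N h2) h1
    have h1 : (v i 0 * R (ξ i 0)) ^ e = 1 := by
      rw [mul_pow, hRe]
      refine eq_of_pow_mul_eq_pow_mul (m := N) (u := fun τ => v i τ ^ e * U (ξ i τ))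
        (w := fun _ => 1) (((hv i).continuousAt.pow _).mul (hUc i)) continuousAt_const ?_
      filter_upwards [key i] with τ h1
      rwa [hme] at h1
    filter_upwards [hoff] with τ h2
    by_cases h3 : τ = 0
    · rw [h3, h1]
    · exact h2 h3
  have hinj : ∀ i j, i ≠ j → v i 0 * R y0 ≠ v j 0 * R y0 := by
    intro i j hij heq
    have h1 := eq_of_pow_eq_one_of_tendsto he (f := fun τ => v i τ * R (ξ i τ))
      (g := fun τ => v j τ * R (ξ j τ)) ((hv i).continuousAt.mul (hRc i))
      ((hv j).continuousAt.mul (hRc j)) (by simp only [hξ0]; exact heq) (hf1 i) (hf1 j)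
    have hd : HasStrictDerivAt (fun y => (y - y0) * R y) (R y0) y0 := by
      have h1 : HasStrictDerivAt (fun y : ℂ => y - y0) 1 y0 := (hasStrictDerivAt_id y0).sub_const y0
      have h2 := HasStrictDerivAt.mul h1 hR.hasStrictDerivAt
      rw [sub_self, one_mul, zero_mul, add_zero] at h2
      exact h2
    have hl := hd.eventually_left_inverse hR0
    obtain ⟨τ, ⟨⟨⟨⟨⟨h2, h3⟩, h4⟩, h5⟩, h6⟩, h7⟩, h8⟩ := hexn (((((h1.and (hne i j hij)).and
      ((hξt i).eventually hl)).and ((hξt j).eventually hl)).and (hξv i)).and (hξv j))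
    refine h3 h8 ?_
    rw [← h4, ← h5, h6, h7, hm i, hm j, mul_assoc, mul_assoc, h2]
  refine ⟨m ⟨0, hd⟩, e, Nat.pos_of_ne_zero fun h0 => ?_, hme _,
    card_le_of_pow_eq_one he (c := fun i => v i 0 * R y0)
      (fun i j hij => by_contra fun hc => hinj i j hc hij)
      fun i => by have := (hf1 i).self_of_nhds; rwa [hξ0] at this, fun i j hij => ?_⟩
  · have := hme ⟨0, hd⟩
    rw [h0, zero_mul] at this
    exact hN.ne this
  · refine ⟨fun τ => v i τ - v j τ, (hv i).continuousAt.sub (hv j).continuousAt, fun h0 => ?_, ?_⟩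
    · refine hinj i j hij ?_
      rw [sub_eq_zero.1 h0]
    · filter_upwards [hξv i, hξv j] with τ h1 h2
      rw [hm i] at h1
      rw [hm j] at h2
      rw [mul_sub, ← h1, ← h2]
      ring

variable {E : Type*} [NormedAddCommGroup E] [NormedSpace ℂ E]

theorem fderiv_ne_zero_of_branches {N d m e : ℕ} (hN : 0 < N) (hme : m * e = N) (hde : d ≤ e)
    (hd : 2 ≤ d) {ξ : Fin d → E × ℂ → ℂ} (hξ : ∀ i, AnalyticAt ℂ (ξ i) 0)
    (hne : ∀ i j, i ≠ j → ∀ᶠ p in nhds (0 : E × ℂ), p.2 ≠ 0 → ξ i p ≠ ξ j p)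
    (hω : ∀ ω : ℂ, ω ^ N = 1 → ∀ i, ∃ j, ∀ᶠ p in nhds (0 : E × ℂ), ξ i (p.1, ω * p.2) = ξ j p)
    (hu : ∀ i j, i ≠ j → ∃ u : E × ℂ → ℂ, AnalyticAt ℂ u 0 ∧ u 0 ≠ 0 ∧
      ∀ᶠ p in nhds (0 : E × ℂ), ξ i p - ξ j p = p.2 ^ m * u p)
    {G : E × (ℂ × ℂ) → ℂ} (hG : AnalyticAt ℂ G 0) (hξ0 : ∀ i, ξ i 0 = 0)
    (h : ∀ᶠ p in nhds (0 : (E × ℂ) × ℂ), G (p.1.1, (p.2 ^ N, p.1.2)) =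
        ∏ i, (p.1.2 - ξ i (p.1.1, p.2))) : fderiv ℂ G 0 ≠ 0 := by
  have hdC : (d : ℂ) ≠ 0 := Nat.cast_ne_zero.2 (by omega)
  have hτ : Filter.Tendsto (fun τ : ℂ => ((0 : E), τ)) (nhds 0) (nhds 0) :=
    Continuous.tendsto' (by fun_prop) 0 0 rfl
  have hτN : Filter.Tendsto (fun τ : ℂ => τ ^ N) (nhds 0) (nhds 0) :=
    Continuous.tendsto' (by fun_prop) 0 0 (zero_pow hN.ne')
  have hmean : AnalyticAt ℂ (fun p => (d : ℂ)⁻¹ * ∑ i, ξ i p) 0 :=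
    analyticAt_const.mul (Finset.analyticAt_fun_sum _ fun i _ => hξ i)
  obtain ⟨a, ha, haξ⟩ := hmean.exists_descent hN (by
    intro ω hω1
    obtain ⟨σ, hσ⟩ := exists_perm_of_conjugates hN hne hω1 (hω ω hω1)
    filter_upwards [hσ] with p hp
    simp only [hp]
    rw [Equiv.sum_comp σ fun i => ξ i p])
  have hu' : ∀ i j, ∃ u : E × ℂ → ℂ, AnalyticAt ℂ u 0 ∧ (i ≠ j → u 0 ≠ 0) ∧
      ∀ᶠ p in nhds (0 : E × ℂ), ξ i p - ξ j p = p.2 ^ m * u p := by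
    intro i j
    by_cases hij : i = j
    · subst hij
      exact ⟨fun _ => 0, analyticAt_const, fun h => absurd rfl h, .of_forall fun p => by simp⟩
    · obtain ⟨u, h1, h2, h3⟩ := hu i j hij
      exact ⟨u, h1, fun _ => h2, h3⟩
  choose u hua hu0 huξ using hu'
  let v : Fin d → E × ℂ → ℂ := fun i p => (d : ℂ)⁻¹ * ∑ j, u j i p
  have hva : ∀ i, AnalyticAt ℂ (v i) 0 := fun i =>
    analyticAt_const.mul (Finset.analyticAt_fun_sum _ fun j _ => hua j i)
  have hvξ : ∀ i, ∀ᶠ p in nhds (0 : E × ℂ), a (p.1, p.2 ^ N) - ξ i p = p.2 ^ m * v i p := by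
    intro i
    filter_upwards [haξ, Filter.eventually_all.2 fun j => huξ j i] with p h1 h2
    have h3 : ∑ j, (ξ j p - ξ i p) = p.2 ^ m * ∑ j, u j i p := by
      rw [Finset.mul_sum]
      exact Finset.sum_congr rfl fun j _ => h2 j
    rw [Finset.sum_sub_distrib, Finset.sum_const, Finset.card_univ, Fintype.card_fin,
      nsmul_eq_mul] at h3
    rw [h1]
    simp only [v]
    rw [mul_left_comm, ← h3, mul_sub, inv_mul_cancel_left₀ hdC]
  have hvc : ∀ i, ContinuousAt (fun τ : ℂ => v i (0, τ)) 0 := fun i =>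
    ContinuousAt.comp_of_eq (f := fun τ : ℂ => ((0 : E), τ)) (hva i).continuousAt
      (by fun_prop) rfl
  have hv_inj : Function.Injective fun i => v i 0 := by
    intro i j hij
    by_contra hc
    refine hu0 i j hc ?_
    have huc : ContinuousAt (fun τ : ℂ => u i j (0, τ)) 0 :=
      ContinuousAt.comp_of_eq (f := fun τ : ℂ => ((0 : E), τ)) (hua i j).continuousAt
        (by fun_prop) rfl
    have := eq_of_pow_mul_eq_pow_mul (m := m) huc ((hvc j).sub (hvc i)) (by
      filter_upwards [hτ.eventually ((huξ i j).and ((hvξ i).and (hvξ j)))] with τ ⟨h1, h2, h3⟩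
      simp only [Pi.sub_apply] at *
      rw [← h1, mul_sub, ← h2, ← h3]
      ring)
    refine this.trans ?_
    exact sub_eq_zero.2 hij.symm
  have hprim := Complex.isPrimitiveRoot_exp N hN.ne'
  set ω := Complex.exp (2 * Real.pi * Complex.I / N) with hω_def
  have hζ : IsPrimitiveRoot (ω ^ m) e := hprim.pow hN hme.symm
  have he : 0 < e := by omega
  obtain ⟨σ, hσ⟩ := exists_perm_of_conjugates hN hne hprim.pow_eq_one (hω ω hprim.pow_eq_one)
  have hσv : ∀ i, ω ^ m * v i 0 = v (σ i) 0 := by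
    intro i
    have hωτ : Filter.Tendsto (fun τ : ℂ => ω * τ) (nhds 0) (nhds 0) :=
      Continuous.tendsto' (by fun_prop) 0 0 (mul_zero ω)
    have h1 : ContinuousAt (fun τ : ℂ => ω ^ m * v i (0, ω * τ)) 0 :=
      continuousAt_const.mul (ContinuousAt.comp_of_eq (f := fun τ : ℂ => ((0 : E), ω * τ))
        (hva i).continuousAt (by fun_prop) (by simp))
    have := eq_of_pow_mul_eq_pow_mul (m := m) h1 (hvc (σ i)) (by
      filter_upwards [hτ.eventually hσ, hτ.eventually (hvξ (σ i)),
        hωτ.eventually (hτ.eventually (hvξ i))] with τ h1 h2 h3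
      rw [← h2, ← h1 i, ← mul_assoc, ← mul_pow, mul_comm τ ω, ← h3, mul_pow,
        hprim.pow_eq_one, one_mul])
    simpa [Prod.mk_zero_zero] using this
  have hσk : ∀ (k : ℕ) i, (ω ^ m) ^ k * v i 0 = v ((σ ^ k) i) 0 := by
    intro k
    induction k with
    | zero => simp
    | succ k ih =>
      intro i
      rw [pow_succ', mul_assoc, ih, hσv, pow_succ', Equiv.Perm.mul_apply]
  obtain ⟨i0, hi0⟩ : ∃ i, v i 0 ≠ 0 := by
    by_contra hcon
    push Not at hcon
    have := @hv_inj ⟨0, by omega⟩ ⟨1, by omega⟩ ((hcon _).trans (hcon _).symm)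
    simp at this
  have hinj : Function.Injective fun k : Fin e => (σ ^ (k : ℕ)) i0 := by
    intro k l hkl
    have h1 := hσk k i0
    simp only at hkl
    rw [hkl, ← hσk] at h1
    exact Fin.ext (hζ.pow_inj k.2 l.2 (mul_right_cancel₀ hi0 h1))
  have hed : d = e := le_antisymm hde (by simpa using Fintype.card_le_of_injective _ hinj)
  have hv0 : ∀ i, v i 0 ≠ 0 := by
    have hbij := (Fintype.bijective_iff_injective_and_card _).2 ⟨hinj, by simp [hed]⟩
    intro i
    obtain ⟨k, rfl⟩ := hbij.2 i
    simp only [← hσk]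
    exact mul_ne_zero (pow_ne_zero _ (hζ.ne_zero he.ne')) hi0
  intro hG0
  have ha0 : a 0 = 0 := by
    have := haξ.self_of_nhds
    simp only [hξ0, Prod.snd_zero, zero_pow hN.ne', Prod.fst_zero, Prod.mk_zero_zero] at this
    simpa using this
  have haτ : AnalyticAt ℂ (fun x : ℂ => a (0, x)) 0 :=
    AnalyticAt.comp_of_eq (f := fun x : ℂ => ((0 : E), x)) ha (by fun_prop) rfl
  have hγ : HasDerivAt (fun x : ℂ => G (0, (x, a (0, x))))
      (fderiv ℂ G 0 (0, (1, deriv (fun x : ℂ => a (0, x)) 0))) 0 := by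
    refine HasFDerivAt.comp_hasDerivAt (l := G)
      (f := fun x : ℂ => ((0 : E), (x, a (0, x)))) 0 ?_
      ((hasDerivAt_const _ _).prodMk ((hasDerivAt_id _).prodMk haτ.differentiableAt.hasDerivAt))
    rw [Prod.mk_zero_zero, ha0]
    exact hG.differentiableAt.hasFDerivAt
  set γ : ℂ → ℂ := fun x => G (0, (x, a (0, x))) with hγ_def
  have hγ0 : γ 0 = 0 := by
    have := h.self_of_nhds
    simp only [hξ0, Prod.snd_zero, zero_pow hN.ne', Prod.fst_zero, Prod.mk_zero_zero,
      sub_zero] at this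
    rw [Finset.prod_const, Finset.card_univ, Fintype.card_fin, zero_pow (by omega)] at this
    simpa [hγ_def, ha0, Prod.mk_zero_zero] using this
  have hs : ContinuousAt (dslope γ 0) 0 := continuousAt_dslope_same.2 hγ.differentiableAt
  have hs0 : dslope γ 0 0 = 0 := by rw [dslope_same, hγ.deriv, hG0]; rfl
  have hvp : ContinuousAt (fun τ : ℂ => ∏ i, v i (0, τ)) 0 :=
    tendsto_finsetProd _ fun i _ => hvc i
  have := eq_of_pow_mul_eq_pow_mul (m := N) (u := fun τ => dslope γ 0 (τ ^ N))
    (ContinuousAt.comp_of_eq hs (by fun_prop) (zero_pow hN.ne')) hvp (by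
      have ht : Filter.Tendsto (fun τ : ℂ => (((0 : E), a (0, τ ^ N)), τ)) (nhds 0) (nhds 0) := by
        have : ContinuousAt (fun τ : ℂ => (((0 : E), a (0, τ ^ N)), τ)) 0 := by
          refine (continuousAt_const.prodMk ?_).prodMk continuousAt_id
          exact ContinuousAt.comp_of_eq (g := fun x : ℂ => a (0, x)) haτ.continuousAt
            (by fun_prop) (zero_pow hN.ne')
        have h2 := this.tendsto
        simpa [zero_pow hN.ne', ha0, Prod.mk_zero_zero] using h2
      filter_upwards [ht.eventually h, hτ.eventually (Filter.eventually_all.2 hvξ)] with τ h1 h2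
      have h3 := sub_smul_dslope γ 0 (τ ^ N)
      rw [hγ0, sub_zero, sub_zero, smul_eq_mul] at h3
      rw [h3]
      simp only [hγ_def]
      rw [h1]
      simp only [h2]
      rw [Finset.prod_mul_distrib, Finset.prod_const, Finset.card_univ, Fintype.card_fin,
        ← pow_mul, show m * d = N by rw [hed, hme]])
  rw [zero_pow hN.ne', hs0] at this
  exact Finset.prod_ne_zero_iff.2 (fun i _ => hv0 i) this.symm

end Slices

section SmoothFamilies

variable {E : Type*} [NormedAddCommGroup E] [NormedSpace ℂ E]

theorem eventually_branches_eq_on_axis {d : ℕ} {ξ : Fin d → E × ℂ → ℂ}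
    (hξ : ∀ i, AnalyticAt ℂ (ξ i) 0 ∧ ξ i 0 = 0)
    (hne : ∀ i j, i ≠ j → ∀ᶠ p in nhds (0 : E × ℂ), p.2 ≠ 0 → ξ i p ≠ ξ j p) (i j : Fin d) :
    ∀ᶠ t in nhds (0 : E), ξ i (t, 0) = ξ j (t, 0) := by
  rcases eq_or_ne i j with rfl | hij
  · simp
  obtain ⟨e, u, hu, hu0, h⟩ := ((hξ i).1.fun_sub (hξ j).1).exists_eq_pow_mul_unit
    ((hne i j hij).mono fun p hp h2 => sub_ne_zero.2 (hp h2))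
  have he : e ≠ 0 := by
    rintro rfl
    have := h.self_of_nhds
    simp [(hξ i).2, (hξ j).2] at this
    exact hu0 this.symm
  exact (tendsto_prodMk_zero.eventually h).mono fun t ht => sub_eq_zero.1 (by simpa [he] using ht)

theorem tendsto_slice_zero (t : E) :
    Filter.Tendsto (fun τ : ℂ => (t, τ)) (nhds 0) (nhds (t, 0)) :=
  Continuous.tendsto' (by fun_prop) 0 _ rfl

/-- At a smooth point of the total space with `x = 0` where several branches meet, the family
is a graph over the `y`-axis. -/
theorem exists_graph_of_smooth [FiniteDimensional ℂ E] {S : Set (E × (ℂ × ℂ))} {N d : ℕ}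
    (hN : 0 < N) {ξ : Fin d → E × ℂ → ℂ} {i j : Fin d} {t₀ : E}
    (hξ : ∀ i, AnalyticAt ℂ (ξ i) (t₀, 0))
    (hij : ∀ᶠ p in nhds (t₀, (0 : ℂ)), p.2 ≠ 0 → ξ i p ≠ ξ j p)
    (hξ0 : ξ i (t₀, 0) = ξ j (t₀, 0))
    (hS : ∀ᶠ z in nhds (t₀, ((0 : ℂ), ξ i (t₀, 0))), z ∈ S ↔
      ∃ i, ∃ τ : ℂ, τ ^ N = z.2.1 ∧ ξ i (z.1, τ) = z.2.2)
    {g : E × (ℂ × ℂ) → ℂ} (hg : AnalyticAt ℂ g (t₀, (0, ξ i (t₀, 0))))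
    (hgS : ∀ᶠ z in nhds (t₀, ((0 : ℂ), ξ i (t₀, 0))), z ∈ S ↔ g z = 0)
    (hd : fderiv ℂ g (t₀, (0, ξ i (t₀, 0))) ≠ 0) :
    ∃ φ : E × ℂ → ℂ, AnalyticAt ℂ φ (t₀, ξ i (t₀, 0)) ∧
      ∀ᶠ z in nhds (t₀, ((0 : ℂ), ξ i (t₀, 0))), z ∈ S ↔ z.2.1 = φ (z.1, z.2.2) := by
  have hbr : ∀ k, Filter.Tendsto (fun p : E × ℂ => (p.1, (p.2 ^ N, ξ k p))) (nhds (t₀, 0))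
      (nhds (t₀, (0, ξ k (t₀, 0)))) := by
    intro k
    have : ContinuousAt (fun p : E × ℂ => (p.1, (p.2 ^ N, ξ k p))) (t₀, 0) :=
      continuousAt_fst.prodMk ((continuousAt_snd.pow N).prodMk (hξ k).continuousAt)
    have := this.tendsto
    simpa only [zero_pow hN.ne'] using this
  have hg0 : g (t₀, (0, ξ i (t₀, 0))) = 0 :=
    hgS.self_of_nhds.1 (hS.self_of_nhds.2 ⟨i, 0, zero_pow hN.ne', rfl⟩)
  have hmem : ∀ k, ξ k (t₀, 0) = ξ i (t₀, 0) →
      ∀ᶠ p in nhds (t₀, (0 : ℂ)), (p.1, (p.2 ^ N, ξ k p)) ∈ S := by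
    intro k hk
    have h1 := hbr k
    rw [hk] at h1
    filter_upwards [h1.eventually hS] with p hp
    exact hp.2 ⟨k, p.2, rfl, rfl⟩
  have hy : fderiv ℂ g (t₀, (0, ξ i (t₀, 0))) (0, (0, 1)) = 0 := by
    by_contra hy
    obtain ⟨φ, -, -, h⟩ := hg.exists_implicit_snd hy
    simp only [hg0] at h
    have hbj := hbr j
    rw [← hξ0] at hbj
    have h1 : ∀ᶠ p in nhds (t₀, (0 : ℂ)), ξ i p = ξ j p := by
      filter_upwards [(hbr i).eventually (hgS.and h), hbj.eventually (hgS.and h), hmem i rfl,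
        hmem j hξ0.symm] with p h1 h2 h3 h4
      rw [h1.2.1 (h1.1.1 h3), h2.2.1 (h2.1.1 h4)]
    have h2 := (tendsto_slice_zero t₀).eventually (hij.and h1)
    obtain ⟨τ, h3, h4⟩ := ((h2.filter_mono (nhdsWithin_le_nhds (s := {0}ᶜ))).and
      self_mem_nhdsWithin).exists
    exact h3.1 h4 h3.2
  have ht : ∀ v : E, fderiv ℂ g (t₀, (0, ξ i (t₀, 0))) (v, 0) = 0 := by
    intro v
    have hc : AnalyticAt ℂ (fun t : E => ξ i (t, 0)) t₀ :=
      AnalyticAt.comp_of_eq (f := fun t : E => (t, (0 : ℂ))) (hξ i) (by fun_prop) rfl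
    have h1 : HasFDerivAt (fun t : E => (t, ((0 : ℂ), ξ i (t, 0)))) _ t₀ :=
      (hasFDerivAt_id t₀).prodMk ((hasFDerivAt_const (0 : ℂ) t₀).prodMk
        hc.differentiableAt.hasFDerivAt)
    have h2 := HasFDerivAt.comp (g := g) t₀ hg.differentiableAt.hasFDerivAt h1
    have h3 : (g ∘ fun t : E => (t, ((0 : ℂ), ξ i (t, 0)))) =ᶠ[nhds t₀] fun _ => 0 := by
      have h4 : Filter.Tendsto (fun t : E => (t, (0 : ℂ))) (nhds t₀) (nhds (t₀, 0)) :=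
        Continuous.tendsto' (by fun_prop) _ _ rfl
      filter_upwards [h4.eventually ((hbr i).eventually hgS), h4.eventually (hmem i rfl)]
        with t h5 h6
      have := h5.1 h6
      simp only [zero_pow hN.ne'] at this
      exact this
    have h4 := h2.fderiv
    rw [h3.fderiv_eq, fderiv_fun_const] at h4
    have h5 := congrArg (fun L => L v) h4
    simp only [Pi.zero_apply, _root_.zero_apply, ContinuousLinearMap.comp_apply,
      ContinuousLinearMap.prod_apply, ContinuousLinearMap.id_apply] at h5
    have h6 : (v, ((0 : ℂ), fderiv ℂ (fun t : E => ξ i (t, 0)) t₀ v)) =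
        (v, (0 : ℂ × ℂ)) + fderiv ℂ (fun t : E => ξ i (t, 0)) t₀ v •
          ((0 : E), ((0 : ℂ), (1 : ℂ))) := by simp
    rw [h6, map_add, map_smul, hy, smul_zero, add_zero] at h5
    exact h5.symm
  have hx : fderiv ℂ g (t₀, (0, ξ i (t₀, 0))) (0, (1, 0)) ≠ 0 := by
    intro hx
    refine hd (ContinuousLinearMap.ext fun w => ?_)
    have : w = (w.1, 0) + (w.2.1 • ((0 : E), ((1 : ℂ), (0 : ℂ))) +
        w.2.2 • ((0 : E), ((0 : ℂ), (1 : ℂ)))) := by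
      simp
    rw [this, map_add, map_add, map_smul, map_smul, hy, hx, ht]
    simp
  obtain ⟨φ, hφ, -, h⟩ := hg.exists_implicit_fst hx
  simp only [hg0] at h
  exact ⟨φ, hφ, by filter_upwards [hgS, h] with z h1 h2; rw [h1, h2]⟩

theorem exists_smooth_equation [FiniteDimensional ℂ E] {S : Set (E × (ℂ × ℂ))} {N d : ℕ}
    (hN : 0 < N) (hd : 0 < d) {ξ : Fin d → E × ℂ → ℂ}
    (hξ : ∀ i, AnalyticAt ℂ (ξ i) 0 ∧ ξ i 0 = 0)
    (hne : ∀ i j, i ≠ j → ∀ᶠ p in nhds (0 : E × ℂ), p.2 ≠ 0 → ξ i p ≠ ξ j p)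
    (hω : ∀ ω : ℂ, ω ^ N = 1 → ∀ i, ∃ j, ∀ᶠ p in nhds (0 : E × ℂ), ξ i (p.1, ω * p.2) = ξ j p)
    (hS : ∀ᶠ z in nhds (0 : E × (ℂ × ℂ)), z ∈ S ↔
      ∃ i, ∃ τ : ℂ, τ ^ N = z.2.1 ∧ ξ i (z.1, τ) = z.2.2)
    (hsm : ∃ᶠ t in nhds (0 : E), ∀ i, ∃ g : E × (ℂ × ℂ) → ℂ, AnalyticAt ℂ g (t, (0, ξ i (t, 0))) ∧
      (∀ᶠ z in nhds (t, ((0 : ℂ), ξ i (t, 0))), z ∈ S ↔ g z = 0) ∧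
      fderiv ℂ g (t, (0, ξ i (t, 0))) ≠ 0) :
    ∃ G : E × (ℂ × ℂ) → ℂ, AnalyticAt ℂ G 0 ∧ (∀ᶠ z in nhds 0, z ∈ S ↔ G z = 0) ∧
      fderiv ℂ G 0 ≠ 0 := by
  obtain ⟨G, hG, hGξ, hG0⟩ := exists_equation hN (fun i => (hξ i).1) hne hω
  refine ⟨G, hG, by filter_upwards [hS, hG0] with z h1 h2; rw [h1, h2], ?_⟩
  rcases Nat.lt_or_ge d 2 with h2 | h2
  · obtain rfl : d = 1 := by omega
    exact fderiv_ne_zero_of_single_branch hN hG hGξ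
  have hk : ∀ i j, ∃ (k : ℕ) (u : E × ℂ → ℂ), i ≠ j → AnalyticAt ℂ u 0 ∧ u 0 ≠ 0 ∧
      ∀ᶠ p in nhds (0 : E × ℂ), ξ i p - ξ j p = p.2 ^ k * u p := by
    intro i j
    by_cases hij : i = j
    · exact ⟨0, 0, fun h => absurd hij h⟩
    · obtain ⟨k, u, h⟩ := ((hξ i).1.fun_sub (hξ j).1).exists_eq_pow_mul_unit
        ((hne i j hij).mono fun p hp h2 => sub_ne_zero.2 (hp h2))
      exact ⟨k, u, fun _ => h⟩
  choose k u hu using hk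
  have hbr0 : ∀ i, Filter.Tendsto (fun t : E => (t, ((0 : ℂ), ξ i (t, 0)))) (nhds 0) (nhds 0) :=
    fun i => AnalyticAt.tendsto_mk analyticAt_id rfl
      (analyticAt_const.prod (AnalyticAt.comp_of_eq (f := fun t : E => (t, (0 : ℂ))) (hξ i).1
        (by fun_prop) rfl)) (by simp [Prod.mk_zero_zero, (hξ i).2])
  have ev : ∀ᶠ t in nhds (0 : E), (∀ i, AnalyticAt ℂ (ξ i) (t, 0)) ∧
      (∀ i j, ξ i (t, 0) = ξ j (t, 0)) ∧
      (∀ i j, i ≠ j → ∀ᶠ p in nhds (t, (0 : ℂ)), p.2 ≠ 0 → ξ i p ≠ ξ j p) ∧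
      (∀ i, ∀ᶠ z in nhds (t, ((0 : ℂ), ξ i (t, 0))), z ∈ S ↔
        ∃ i, ∃ τ : ℂ, τ ^ N = z.2.1 ∧ ξ i (z.1, τ) = z.2.2) ∧
      ∀ i j, i ≠ j → AnalyticAt ℂ (u i j) (t, 0) ∧ u i j (t, 0) ≠ 0 ∧
        ∀ᶠ p in nhds (t, (0 : ℂ)), ξ i p - ξ j p = p.2 ^ k i j * u i j p := by
    refine Filter.Eventually.and ?_ (Filter.Eventually.and ?_ (Filter.Eventually.and ?_
      (Filter.Eventually.and ?_ ?_)))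
    · exact Filter.eventually_all.2 fun i =>
        tendsto_prodMk_zero.eventually (hξ i).1.eventually_analyticAt
    · exact Filter.eventually_all.2 fun i => Filter.eventually_all.2 fun j =>
        eventually_branches_eq_on_axis hξ hne i j
    · exact Filter.eventually_all.2 fun i => Filter.eventually_all.2 fun j =>
        Filter.eventually_all.2 fun hij =>
          tendsto_prodMk_zero.eventually (hne i j hij).eventually_nhds
    · exact Filter.eventually_all.2 fun i => (hbr0 i).eventually hS.eventually_nhds
    · refine Filter.eventually_all.2 fun i => Filter.eventually_all.2 fun j =>
        Filter.eventually_all.2 fun hij => ?_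
      obtain ⟨h1, h3, h4⟩ := hu i j hij
      exact (tendsto_prodMk_zero.eventually h1.eventually_analyticAt).and
        ((tendsto_prodMk_zero.eventually (h1.continuousAt.eventually_ne h3)).and
          (tendsto_prodMk_zero.eventually h4.eventually_nhds))
  obtain ⟨t, hg, hξt, heq, hnet, hSt, hut⟩ := (hsm.and_eventually ev).exists
  let i0 : Fin d := ⟨0, hd⟩
  obtain ⟨g, hg, hgS, hgd⟩ := hg i0
  obtain ⟨φ, hφ, hSφ⟩ := exists_graph_of_smooth (i := i0) (j := ⟨1, by omega⟩) hN hξt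
    (hnet _ _ (by simp [i0])) (heq _ _) (hSt i0) hg hgS hgd
  have hξs : ∀ i, AnalyticAt ℂ (fun τ => ξ i (t, τ)) 0 := fun i =>
    AnalyticAt.comp_of_eq (f := fun τ : ℂ => (t, τ)) (hξt i) (by fun_prop) rfl
  obtain ⟨m, e, -, hme, hde, hw⟩ := exists_exponent_of_slice hN hd
    (φ := fun y => φ (t, y)) (y0 := ξ i0 (t, 0)) (ξ := fun i τ => ξ i (t, τ))
    (AnalyticAt.comp_of_eq (f := fun y : ℂ => (t, y)) hφ (by fun_prop) rfl) hξs
    (fun i => heq i i0) (fun i => by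
      have h1 : Filter.Tendsto (fun τ : ℂ => (t, (τ ^ N, ξ i (t, τ)))) (nhds 0)
          (nhds (t, (0, ξ i0 (t, 0)))) := by
        have : ContinuousAt (fun τ : ℂ => (t, (τ ^ N, ξ i (t, τ)))) 0 :=
          continuousAt_const.prodMk ((continuousAt_id.pow N).prodMk (hξs i).continuousAt)
        have := this.tendsto
        simpa only [zero_pow hN.ne', heq i i0] using this
      filter_upwards [h1.eventually (hSφ.and (hSt i0))] with τ h
      exact (h.1.1 (h.2.2 ⟨i, τ, rfl, rfl⟩)).symm)
    (fun i j hij => (tendsto_slice_zero t).eventually (hnet i j hij))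
  refine fderiv_ne_zero_of_branches hN hme hde h2 (fun i => (hξ i).1) hne hω (fun i j hij => ?_)
    hG (fun i => (hξ i).2) hGξ
  obtain ⟨w, hwc, hw0, hwξ⟩ := hw i j hij
  obtain ⟨h1, h3, h4⟩ := hut i j hij
  have hkm : k i j = m := eq_of_pow_mul_eq (u := fun τ => u i j (t, τ)) (w := w)
    (ContinuousAt.comp_of_eq (f := fun τ : ℂ => (t, τ)) h1.continuousAt (by fun_prop) rfl)
    hwc h3 hw0 (by
      filter_upwards [(tendsto_slice_zero t).eventually h4, hwξ] with τ h5 h6 _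
      rw [← h6, ← h5])
  rw [← hkm]
  exact ⟨u i j, hu i j hij⟩

end SmoothFamilies

section PieceOfDimType

variable {q : ℕ}

/-- A left inverse of an analytic germ between spaces of the same finite dimension is also a
right inverse. -/
theorem eventually_rightInverse {E : Type*} [NormedAddCommGroup E] [NormedSpace ℂ E]
    [FiniteDimensional ℂ E] {κ R : E → E} (hκ : AnalyticAt ℂ κ 0) (hκ0 : κ 0 = 0)
    (hR : AnalyticAt ℂ R 0) (h : ∀ᶠ t in nhds (0 : E), R (κ t) = t) :
    ∀ᶠ t in nhds (0 : E), κ (R t) = t := by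
  have hi : ∀ v, fderiv ℂ κ 0 v = 0 → v = 0 := by
    intro v hv
    have h1 := HasFDerivAt.comp (g := R) (f := κ) 0
      (by rw [hκ0]; exact hR.differentiableAt.hasFDerivAt) hκ.differentiableAt.hasFDerivAt
    have h2 : (R ∘ κ) =ᶠ[nhds 0] id := h
    have h3 := (h1.congr_of_eventuallyEq h2.symm).unique (hasFDerivAt_id 0)
    have h4 := congrArg (fun L => L v) h3
    simp only [ContinuousLinearMap.comp_apply, hv, map_zero, ContinuousLinearMap.id_apply] at h4
    exact h4.symm
  obtain ⟨g, hg, hg0, h1, h2⟩ := hκ.exists_inverse_of_injective rfl hi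
  rw [hκ0] at hg hg0 h2
  have hgt : Filter.Tendsto g (nhds 0) (nhds 0) := hg.tendsto_of_eq hg0
  filter_upwards [h2, hgt.eventually h] with t h3 h4
  rw [h3] at h4
  rw [h4, h3]

theorem DimType1Along.pieceForm {S W : Set ((Fin q → ℂ) × (ℂ × ℂ))}
    (hS : DimType1Along q S W 0)
    (hE : ∀ᶠ z in nhds (0 : (Fin q → ℂ) × (ℂ × ℂ)), z.2.1 = 0 → (z ∈ S ↔ z.2.2 = 0))
    (hsm : ∀ᶠ z in nhds (0 : (Fin q → ℂ) × (ℂ × ℂ)), z ∈ S → z.2.1 ≠ 0 → NonsingPt q S z) :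
    PieceForm S := by
  obtain ⟨Φ, Ψ, hΦ, hΦ0, hΨ, hΨΦ, hΦΨ, -, S₀, hS₀, hSS₀⟩ := hS
  obtain ⟨N, d, hN, hd, ξ, hξ, hne, hω, hSξ⟩ := hS₀.rForm
  have hΨ0 : Ψ 0 = 0 := by simpa [hΦ0] using hΨΦ.self_of_nhds
  have hΨt := hΨ.tendsto_of_eq hΨ0
  have hΦt := hΦ.tendsto_of_eq hΦ0
  have hΨS : ∀ᶠ w in nhds (0 : (Fin q → ℂ) × (ℂ × ℂ)), Ψ w ∈ S ↔ w ∈ S₀ := by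
    filter_upwards [hΦΨ, hΨt.eventually hSS₀] with w h1 h2
    rw [h2, h1]
  have hdiff := eventually_branches_eq_on_axis hξ hne
  have hγ : ∀ i, AnalyticAt ℂ (fun p : (Fin q → ℂ) × ℂ => (p.1, (p.2 ^ N, ξ i p))) 0 := by
    intro i
    have := (hξ i).1
    fun_prop
  have hγ0 : ∀ i, ((0 : (Fin q → ℂ) × ℂ).1, ((0 : (Fin q → ℂ) × ℂ).2 ^ N, ξ i 0)) = 0 := by
    simp [hN.ne', (hξ _).2, Prod.ext_iff]
  have hγt := fun i => (hγ i).tendsto_of_eq (hγ0 i)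
  have hbr : ∀ i, Filter.Tendsto (fun t : Fin q → ℂ => (t, ((0 : ℂ), ξ i (t, 0)))) (nhds 0)
      (nhds 0) := by
    intro i
    have := (hγt i).comp tendsto_prodMk_zero
    simpa only [Function.comp_def, zero_pow hN.ne'] using this
  have hγS : ∀ i, ∀ᶠ p in nhds (0 : (Fin q → ℂ) × ℂ), Ψ (p.1, (p.2 ^ N, ξ i p)) ∈ S := by
    intro i
    filter_upwards [(hγt i).eventually hSξ, (hγt i).eventually hΨS] with p h1 h2
    exact h2.2 (h1.2 ⟨i, p.2, rfl, rfl⟩)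
  let i0 : Fin d := ⟨0, hd⟩
  by_cases hfreq : ∃ᶠ t in nhds (0 : Fin q → ℂ), (Ψ (t, (0, ξ i0 (t, 0)))).2.1 ≠ 0
  · have hev : ∀ᶠ w in nhds (0 : (Fin q → ℂ) × (ℂ × ℂ)), Ψ w ∈ S → (Ψ w).2.1 ≠ 0 →
        ∃ g : (Fin q → ℂ) × (ℂ × ℂ) → ℂ, AnalyticAt ℂ g w ∧
          (∀ᶠ z in nhds w, z ∈ S₀ ↔ g z = 0) ∧ fderiv ℂ g w ≠ 0 := by
      filter_upwards [hΨt.eventually hsm, hΨ.eventually_analyticAt, hΨS.eventually_nhds,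
        hΨt.eventually hΨΦ.eventually_nhds, hΨt.eventually hΦ.eventually_analyticAt, hΦΨ]
        with w h1 h2 h3 h4 h5 h6 h7 h8
      obtain ⟨g, hg, hgS, hgd⟩ := h1 h7 h8
      refine ⟨fun z => g (Ψ z), hg.comp h2, ?_, fderiv_comp_ne_zero hg h2 h5 h6 h4 hgd⟩
      filter_upwards [h3, h2.continuousAt.eventually hgS] with z h9 h10
      rw [← h9, h10]
    obtain ⟨G, hG, hGS, hGd⟩ := exists_smooth_equation hN hd hξ hne hω hSξ (by
      refine (hfreq.and_eventually ((Filter.eventually_all.2 fun i =>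
        ((hbr i).eventually hev).and ((hdiff i0 i).and
          (tendsto_prodMk_zero.eventually (hγS i)))))).mono ?_
      rintro t ⟨h1, h2⟩ i
      obtain ⟨h3, h4, h5⟩ := h2 i
      simp only [zero_pow hN.ne'] at h5
      rw [h4] at h1
      exact h3 h5 h1)
    refine pieceForm_of_fderiv_ne_zero (g := fun z => G (Φ z)) (hG.comp_of_eq hΦ hΦ0) ?_
      (fderiv_comp_ne_zero (y := (0 : (Fin q → ℂ) × (ℂ × ℂ))) hG hΦ hΨ hΨ0 hΦΨ hGd) hE
    filter_upwards [hSS₀, hΦt.eventually hGS] with z h1 h2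
    rw [h1, h2]
  have hzero : ∀ i, ∀ᶠ t in nhds (0 : Fin q → ℂ), (Ψ (t, (0, ξ i (t, 0)))).2 = 0 := by
    intro i
    filter_upwards [Filter.not_frequently.1 hfreq, hdiff i0 i,
      tendsto_prodMk_zero.eventually (hγS i), (hbr i).eventually (hΨt.eventually hE)]
      with t h1 h2 h3 h4
    simp only [zero_pow hN.ne'] at h3
    rw [not_not, h2] at h1
    exact Prod.ext h1 ((h4 h1).1 h3)
  have hκ : ∀ i, AnalyticAt ℂ (fun t : Fin q → ℂ => (Ψ (t, (0, ξ i (t, 0)))).1) 0 := by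
    intro i
    have h1 : AnalyticAt ℂ (fun t : Fin q → ℂ => (t, ((0 : ℂ), ξ i (t, 0)))) 0 :=
      analyticAt_id.prod (analyticAt_const.prod (AnalyticAt.comp_of_eq
        (f := fun t : Fin q → ℂ => (t, (0 : ℂ))) (hξ i).1 (by fun_prop) rfl))
    exact hΨ.fun_fst.comp_of_eq h1 (by simp [Prod.mk_zero_zero, (hξ i).2])
  have hκ0 : ∀ i, (Ψ ((0 : Fin q → ℂ), ((0 : ℂ), ξ i (0, 0)))).1 = 0 := by
    intro i
    rw [Prod.mk_zero_zero, (hξ i).2, Prod.mk_zero_zero, Prod.mk_zero_zero, hΨ0]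
    rfl
  have hR : AnalyticAt ℂ (fun t : Fin q → ℂ => (Φ (t, 0)).1) 0 :=
    hΦ.fun_fst.comp_of_eq (f := fun t : Fin q → ℂ => (t, (0 : ℂ × ℂ))) (by fun_prop) rfl
  have hRκ : ∀ i, ∀ᶠ t in nhds (0 : Fin q → ℂ),
      (Φ ((Ψ (t, (0, ξ i (t, 0)))).1, 0)).1 = t := by
    intro i
    filter_upwards [hzero i, (hbr i).eventually hΦΨ] with t h1 h2
    rw [show ((Ψ (t, (0, ξ i (t, 0)))).1, (0 : ℂ × ℂ)) = Ψ (t, (0, ξ i (t, 0))) from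
      Prod.ext rfl h1.symm, h2]
  have hκR := fun i => eventually_rightInverse (hκ i) (hκ0 i) hR (hRκ i)
  have hRt : Filter.Tendsto (fun t : Fin q → ℂ => (Φ (t, 0)).1) (nhds 0) (nhds 0) :=
    hR.tendsto_of_eq (by rw [Prod.mk_zero_zero, hΦ0]; rfl)
  have haxis : ∀ᶠ t in nhds (0 : Fin q → ℂ), (Φ (t, 0)).2.1 = 0 := by
    filter_upwards [hκR i0, hRt.eventually (hzero i0),
      hRt.eventually ((hbr i0).eventually hΦΨ)] with t h1 h2 h3
    rw [show (t, (0 : ℂ × ℂ)) = Ψ ((Φ (t, 0)).1, (0, ξ i0 ((Φ (t, 0)).1, 0))) from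
      Prod.ext h1.symm h2.symm, h3]
  have key : ∀ i, ∃ (k : ℕ) (u σ : (Fin q → ℂ) × ℂ → ℂ),
      (0 < k ∧ AnalyticAt ℂ u 0 ∧ u 0 ≠ 0 ∧ AnalyticAt ℂ σ 0 ∧ σ 0 = 0) ∧
      (∀ᶠ p in nhds (0 : (Fin q → ℂ) × ℂ), (p.1, (p.2 ^ k * u p, σ p)) ∈ S) ∧
      ∀ᶠ p in nhds (0 : (Fin q → ℂ) × ℂ), (Ψ (p.1, (p.2 ^ N, ξ i p))).2 =
        (p.2 ^ k * u ((Ψ (p.1, (p.2 ^ N, ξ i p))).1, p.2),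
          σ ((Ψ (p.1, (p.2 ^ N, ξ i p))).1, p.2)) := by
    intro i
    have hx : AnalyticAt ℂ (fun p : (Fin q → ℂ) × ℂ => (Ψ (p.1, (p.2 ^ N, ξ i p))).2.1) 0 :=
      hΨ.fun_snd.fun_fst.comp_of_eq (hγ i) (hγ0 i)
    have hs : AnalyticAt ℂ (fun p : (Fin q → ℂ) × ℂ => (Ψ (p.1, (p.2 ^ N, ξ i p))).2.2) 0 :=
      hΨ.fun_snd.fun_snd.comp_of_eq (hγ i) (hγ0 i)
    have hT : AnalyticAt ℂ (fun p : (Fin q → ℂ) × ℂ => (Ψ (p.1, (p.2 ^ N, ξ i p))).1) 0 :=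
      hΨ.fun_fst.comp_of_eq (hγ i) (hγ0 i)
    have hT0 : (fun p : (Fin q → ℂ) × ℂ => (Ψ (p.1, (p.2 ^ N, ξ i p))).1) 0 = 0 := by
      simp only [hγ0, hΨ0]; rfl
    obtain ⟨k, u, hu, hu0, hku⟩ := hx.exists_eq_pow_mul_unit (by
      filter_upwards [hγS i, (hγt i).eventually (hΨt.eventually hE), (hγt i).eventually hΦΨ,
        (hT.tendsto_of_eq hT0).eventually haxis] with p h1 h2 h3 h4 h5 h6
      have h7 : Ψ (p.1, (p.2 ^ N, ξ i p)) = ((Ψ (p.1, (p.2 ^ N, ξ i p))).1, 0) :=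
        Prod.ext rfl (Prod.ext h6 ((h2 h6).1 h1))
      rw [← h7, h3] at h4
      exact h5 (eq_zero_of_pow_eq_zero h4))
    have hk : 0 < k := by
      rcases Nat.eq_zero_or_pos k with rfl | hk
      · have := hku.self_of_nhds
        rw [hγ0, hΨ0, pow_zero, one_mul] at this
        exact absurd this.symm hu0
      · exact hk
    obtain ⟨w', θ, hw', hw0', hθ, hθ0, h1, h2⟩ := exists_reparam hT hT0 hR (by
      filter_upwards [hRκ i] with t h1
      simpa only [zero_pow hN.ne'] using h1) (hu.prod hs)
    have hθ' : AnalyticAt ℂ (fun p => (θ p, p.2)) 0 := hθ.prod analyticAt_snd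
    have hθ0' : (θ 0, (0 : (Fin q → ℂ) × ℂ).2) = 0 := by rw [hθ0]; rfl
    have hθt := hθ'.tendsto_of_eq hθ0'
    refine ⟨k, fun p => (w' p).1, fun p => (w' p).2, ⟨hk, hw'.fun_fst, ?_, hw'.fun_snd, ?_⟩,
      ?_, ?_⟩
    · simp only [hw0']; exact hu0
    · simp only [hw0', hγ0, hΨ0]; rfl
    · filter_upwards [h1, hθt.eventually hku, hθt.eventually (hγS i)] with p h1 h2 h3
      rw [h1.2]
      convert h3
      · exact h1.1.symm
      · exact h2.symm
    · filter_upwards [h2, hku] with p h2 h3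
      rw [h2]
      exact Prod.ext h3 rfl
  choose k u σ hw hwS hwc using key
  refine ⟨Fin d, inferInstance, k, u, σ, hw, hwS, fun U hU => ?_⟩
  have hΦ2 : Filter.Tendsto (fun z => ((Φ z).1, (Φ z).2.1)) (nhds 0) (nhds (0 : (Fin q → ℂ) × ℂ)) :=
    (hΦ.fun_fst.prod hΦ.fun_snd.fun_fst).tendsto_of_eq (by rw [hΦ0]; rfl)
  have hTU : ∀ᶠ p in nhds (0 : (Fin q → ℂ) × ℂ), ∀ i, ((Ψ (p.1, (p.2 ^ N, ξ i p))).1, p.2) ∈ U := by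
    refine Filter.eventually_all.2 fun i => ?_
    have h : AnalyticAt ℂ (fun p : (Fin q → ℂ) × ℂ => ((Ψ (p.1, (p.2 ^ N, ξ i p))).1, p.2)) 0 :=
      (hΨ.fun_fst.comp_of_eq (hγ i) (hγ0 i)).prod analyticAt_snd
    refine (h.tendsto_of_eq ?_).eventually hU
    rw [hγ0 i, hΨ0]; rfl
  filter_upwards [hΨΦ, hSS₀, hΦt.eventually hSξ, hΦ2.eventually (eventually_forall_pow_eq (N := N)
    (hTU.and (Filter.eventually_all.2 hwc)))] with z h1 h2 h3 h4 h5
  obtain ⟨i, τ, hτ, hξτ⟩ := h3.1 (h2.1 h5)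
  obtain ⟨h6, h7⟩ := h4 τ hτ
  have h8 : ((Φ z).1, (τ ^ N, ξ i ((Φ z).1, τ))) = Φ z := by rw [hτ, hξτ]
  have h6 := h6 i
  have h7 := h7 i
  simp only [h8, h1] at h6 h7
  exact ⟨i, τ, h6, h7⟩

end PieceOfDimType

section Transfer

variable {q : ℕ}

theorem NonsingPt.comp {V S : Set ((Fin q → ℂ) × (ℂ × ℂ))}
    {f f' : (Fin q → ℂ) × (ℂ × ℂ) → (Fin q → ℂ) × (ℂ × ℂ)} {x : (Fin q → ℂ) × (ℂ × ℂ)}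
    (hV : NonsingPt q V (f x)) (hf : AnalyticAt ℂ f x) (hf' : AnalyticAt ℂ f' (f x))
    (hx : f' (f x) = x) (h : ∀ᶠ w in nhds (f x), f (f' w) = w)
    (hS : ∀ᶠ z in nhds x, z ∈ S ↔ f z ∈ V) : NonsingPt q S x := by
  obtain ⟨g, hg, hgV, hd⟩ := hV
  refine ⟨fun z => g (f z), hg.comp hf, ?_, fderiv_comp_ne_zero hg hf hf' hx h hd⟩
  filter_upwards [hS, hf.continuousAt.eventually hgV] with z h1 h2
  rw [h1, h2]

theorem DimType1Along.comp {V W S : Set ((Fin q → ℂ) × (ℂ × ℂ))}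
    {f f' : (Fin q → ℂ) × (ℂ × ℂ) → (Fin q → ℂ) × (ℂ × ℂ)} {x : (Fin q → ℂ) × (ℂ × ℂ)}
    (hV : DimType1Along q V W (f x)) (hf : AnalyticAt ℂ f x) (hf' : AnalyticAt ℂ f' (f x))
    (hx : ∀ᶠ z in nhds x, f' (f z) = z) (h : ∀ᶠ w in nhds (f x), f (f' w) = w)
    (hS : ∀ᶠ z in nhds x, z ∈ S ↔ f z ∈ V) : DimType1Along q S (f ⁻¹' W) x := by
  obtain ⟨Φ, Ψ, hΦ, hΦ0, hΨ, hΨΦ, hΦΨ, hW, S₀, hS₀, hVS₀⟩ := hV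
  have hΨ0 : Ψ 0 = f x := by rw [← hΦ0]; exact hΨΦ.self_of_nhds
  refine ⟨fun z => Φ (f z), fun w => f' (Ψ w), hΦ.comp hf, hΦ0, hf'.comp_of_eq hΨ hΨ0, ?_, ?_,
    hf.continuousAt.eventually hW, S₀, hS₀, ?_⟩
  · filter_upwards [hx, hf.continuousAt.eventually hΨΦ] with z h1 h2
    rw [h2, h1]
  · filter_upwards [hΦΨ, (show Filter.Tendsto Ψ (nhds 0) (nhds (f x)) from
      hΨ0 ▸ hΨ.continuousAt).eventually h] with w h1 h2
    rw [h2, h1]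
  · filter_upwards [hS, hf.continuousAt.eventually hVS₀] with z h1 h2
    rw [h1, h2]

theorem EqsFamily.exists_equation {S : Set ((Fin q → ℂ) × (ℂ × ℂ))} (hS : EqsFamily q S) :
    ∃ g : (Fin q → ℂ) × (ℂ × ℂ) → ℂ, AnalyticAt ℂ g 0 ∧ ∀ᶠ z in nhds 0, z ∈ S ↔ g z = 0 := by
  obtain ⟨d, M, hd, a, ha, hSa, -⟩ := hS
  refine ⟨_, ?_, hSa⟩
  have h1 : AnalyticAt ℂ (fun p : (Fin q → ℂ) × (ℂ × ℂ) => ((fun i => a i (p.1, p.2.1)), p.2.2))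
      0 := by
    refine AnalyticAt.prod (AnalyticAt.pi fun i => ?_) (by fun_prop)
    exact (ha i).1.comp_of_eq (by fun_prop) rfl
  exact (analyticAt_eval_mkPoly _).comp_of_eq h1 rfl

theorem exists_equation_of_nonsingPt_or_dimType1Along {V : Set ((Fin q → ℂ) × (ℂ × ℂ))}
    {x : (Fin q → ℂ) × (ℂ × ℂ)} (h : NonsingPt q V x ∨ ∃ W, DimType1Along q V W x) :
    ∃ g : (Fin q → ℂ) × (ℂ × ℂ) → ℂ, AnalyticAt ℂ g x ∧ ∀ᶠ z in nhds x, z ∈ V ↔ g z = 0 := by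
  obtain ⟨g, hg, hgV, -⟩ | ⟨W, Φ, Ψ, hΦ, hΦ0, -, -, -, -, S, hS, hVS⟩ := h
  · exact ⟨g, hg, hgV⟩
  · obtain ⟨g, hg, hgS⟩ := hS.exists_equation
    refine ⟨fun z => g (Φ z), hg.comp_of_eq hΦ hΦ0, ?_⟩
    filter_upwards [hVS, (show Filter.Tendsto Φ (nhds x) (nhds 0) from
      hΦ0 ▸ hΦ.continuousAt).eventually hgS] with z h1 h2
    rw [h1, h2]

/-- Near the point `(0, (0, c₀))` the set `V` is the translate of a set in piece form along an
analytic section `c`. -/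
def TransForm (V : Set ((Fin q → ℂ) × (ℂ × ℂ))) (c₀ : ℂ) : Prop :=
  ∃ c : (Fin q → ℂ) → ℂ, AnalyticAt ℂ c 0 ∧ c 0 = c₀ ∧
    PieceForm {z : (Fin q → ℂ) × (ℂ × ℂ) | (z.1, (z.2.1, z.2.2 + c z.1)) ∈ V}

theorem TransForm.of_notMem {V : Set ((Fin q → ℂ) × (ℂ × ℂ))} (hV : IsClosed V) {c₀ : ℂ}
    (h : ((0 : Fin q → ℂ), ((0 : ℂ), c₀)) ∉ V) : TransForm V c₀ := by
  refine ⟨fun _ => c₀, analyticAt_const, rfl, Empty, inferInstance, Empty.elim, Empty.elim,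
    Empty.elim, fun i => i.elim, fun i => i.elim, fun U hU => ?_⟩
  have hc : Filter.Tendsto (fun z : (Fin q → ℂ) × (ℂ × ℂ) => (z.1, (z.2.1, z.2.2 + c₀))) (nhds 0)
      (nhds ((0 : Fin q → ℂ), ((0 : ℂ), c₀))) := by
    have : Continuous (fun z : (Fin q → ℂ) × (ℂ × ℂ) => (z.1, (z.2.1, z.2.2 + c₀))) := by fun_prop
    exact this.tendsto' _ _ (by simp)
  filter_upwards [hc.eventually (hV.isOpen_compl.mem_nhds h)] with z h1 h2
  exact absurd h2 h1

theorem exists_slice_equation {V : Set ((Fin q → ℂ) × (ℂ × ℂ))} {c₀ : ℂ}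
    (hmem : ((0 : Fin q → ℂ), ((0 : ℂ), c₀)) ∈ V)
    (h : NonsingPt q V ((0 : Fin q → ℂ), ((0 : ℂ), c₀)) ∨
      ∃ W, DimType1Along q V W ((0 : Fin q → ℂ), ((0 : ℂ), c₀)))
    (hfin : {s : ℂ | ((0 : Fin q → ℂ), ((0 : ℂ), s)) ∈ V}.Finite) :
    ∃ g : (Fin q → ℂ) × ℂ → ℂ, AnalyticAt ℂ g 0 ∧ g 0 = 0 ∧
      (¬∀ᶠ s in nhds (0 : ℂ), g (0, s) = 0) ∧
      ∀ᶠ p in nhds (0 : (Fin q → ℂ) × ℂ), (p.1, ((0 : ℂ), c₀ + p.2)) ∈ V ↔ g p = 0 := by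
  obtain ⟨g, hg, hgV⟩ := exists_equation_of_nonsingPt_or_dimType1Along h
  have hι : Filter.Tendsto (fun p : (Fin q → ℂ) × ℂ => (p.1, ((0 : ℂ), c₀ + p.2))) (nhds 0)
      (nhds ((0 : Fin q → ℂ), ((0 : ℂ), c₀))) := by
    have : Continuous (fun p : (Fin q → ℂ) × ℂ => (p.1, ((0 : ℂ), c₀ + p.2))) := by fun_prop
    exact this.tendsto' _ _ (by simp)
  refine ⟨fun p : (Fin q → ℂ) × ℂ => g (p.1, (0, c₀ + p.2)), hg.comp_of_eq
    (f := fun p : (Fin q → ℂ) × ℂ => (p.1, ((0 : ℂ), c₀ + p.2))) (by fun_prop) (by simp),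
    by simpa using hgV.self_of_nhds.1 hmem, fun h2 => ?_, hι.eventually hgV⟩
  have h3 : ∀ᶠ s in nhds (0 : ℂ), ((0 : Fin q → ℂ), ((0 : ℂ), c₀ + s)) ∈ V := by
    filter_upwards [h2, (tendsto_slice_zero (0 : Fin q → ℂ)).eventually (hι.eventually hgV)]
      with s h2 h3
    exact h3.2 h2
  have h4 : ∀ᶠ s in nhds c₀, ((0 : Fin q → ℂ), ((0 : ℂ), s)) ∈ V := by
    have : Filter.Tendsto (fun s : ℂ => s - c₀) (nhds c₀) (nhds 0) :=
      (by fun_prop : Continuous fun s : ℂ => s - c₀).tendsto' _ _ (sub_self _)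
    filter_upwards [this.eventually h3] with s h4
    simpa using h4
  exact (infinite_of_mem_nhds c₀ h4) hfin

theorem TransForm.of_nonsingPt_or_dimType1Along {V : Set ((Fin q → ℂ) × (ℂ × ℂ))} {c₀ : ℂ}
    (hmem : ((0 : Fin q → ℂ), ((0 : ℂ), c₀)) ∈ V)
    (h : NonsingPt q V ((0 : Fin q → ℂ), ((0 : ℂ), c₀)) ∨
      ∃ W, DimType1Along q V W ((0 : Fin q → ℂ), ((0 : ℂ), c₀)))
    (hfin : {s : ℂ | ((0 : Fin q → ℂ), ((0 : ℂ), s)) ∈ V}.Finite)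
    {D : Set (Fin q → ℂ)} (hD : ∀ᶠ t in nhds 0, t ∈ closure D) {r : ℝ} (hr : 0 < r)
    (h1 : ∀ᶠ t in nhds (0 : Fin q → ℂ), t ∈ D → ∀ s s' : ℂ, ‖s‖ < r → ‖s'‖ < r →
      (t, ((0 : ℂ), c₀ + s)) ∈ V → (t, ((0 : ℂ), c₀ + s')) ∈ V → s = s')
    (hsm : ∀ᶠ z in nhds ((0 : Fin q → ℂ), ((0 : ℂ), c₀)), z ∈ V → z.2.1 ≠ 0 → NonsingPt q V z) :
    TransForm V c₀ := by
  obtain ⟨g, hg, hg0, hgne, hVh⟩ := exists_slice_equation hmem h hfin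
  obtain ⟨ρ, hρ, hVρ⟩ := eventually_prod_nhds_zero_iff.1 hVh
  obtain ⟨e, he, he0, hec⟩ := hg.exists_center (r := min r ρ) (D := D) hg0 hgne
    hD (lt_min hr hρ) (by
      filter_upwards [h1, Metric.ball_mem_nhds 0 hρ] with t h1 h2 h3 s s' hs hs' h4 h5
      rw [mem_ball_zero_iff] at h2
      exact h1 h3 s s' (hs.trans_le (min_le_left _ _)) (hs'.trans_le (min_le_left _ _))
        ((hVρ t s h2 (hs.trans_le (min_le_right _ _))).2 h4)
        ((hVρ t s' h2 (hs'.trans_le (min_le_right _ _))).2 h5))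
  let f : (Fin q → ℂ) × (ℂ × ℂ) → (Fin q → ℂ) × (ℂ × ℂ) :=
    fun z => (z.1, (z.2.1, z.2.2 + (c₀ + e z.1)))
  let f' : (Fin q → ℂ) × (ℂ × ℂ) → (Fin q → ℂ) × (ℂ × ℂ) :=
    fun z => (z.1, (z.2.1, z.2.2 - (c₀ + e z.1)))
  have hf0 : f 0 = ((0 : Fin q → ℂ), ((0 : ℂ), c₀)) := by simp [f, he0]
  have hff' : ∀ z, f (f' z) = z := fun z => by simp [f, f']
  have hf'f : ∀ z, f' (f z) = z := fun z => by simp [f, f']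
  have hfa : ∀ z, AnalyticAt ℂ e z.1 → AnalyticAt ℂ f z := by
    intro z hz
    have : AnalyticAt ℂ (fun z : (Fin q → ℂ) × (ℂ × ℂ) => e z.1) z :=
      hz.comp_of_eq (f := fun z : (Fin q → ℂ) × (ℂ × ℂ) => z.1) (by fun_prop) rfl
    fun_prop
  have hfa' : ∀ z, AnalyticAt ℂ e z.1 → AnalyticAt ℂ f' z := by
    intro z hz
    have : AnalyticAt ℂ (fun z : (Fin q → ℂ) × (ℂ × ℂ) => e z.1) z :=
      hz.comp_of_eq (f := fun z : (Fin q → ℂ) × (ℂ × ℂ) => z.1) (by fun_prop) rfl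
    fun_prop
  have hft : Filter.Tendsto f (nhds 0) (nhds ((0 : Fin q → ℂ), ((0 : ℂ), c₀))) :=
    hf0 ▸ (hfa 0 he).continuousAt
  have hea : ∀ᶠ z in nhds (0 : (Fin q → ℂ) × (ℂ × ℂ)), AnalyticAt ℂ e z.1 :=
    (continuous_fst.tendsto' 0 0 rfl).eventually he.eventually_analyticAt
  have hE : ∀ᶠ z in nhds (0 : (Fin q → ℂ) × (ℂ × ℂ)), z.2.1 = 0 →
      (z ∈ f ⁻¹' V ↔ z.2.2 = 0) := by
    have h3 : Filter.Tendsto (fun z : (Fin q → ℂ) × (ℂ × ℂ) => (z.1, z.2.2 + e z.1)) (nhds 0)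
        (nhds 0) := by
      have : AnalyticAt ℂ (fun z : (Fin q → ℂ) × (ℂ × ℂ) => e z.1) 0 :=
        he.comp_of_eq (f := fun z : (Fin q → ℂ) × (ℂ × ℂ) => z.1) (by fun_prop) rfl
      exact (by fun_prop : AnalyticAt ℂ (fun z : (Fin q → ℂ) × (ℂ × ℂ) => (z.1, z.2.2 + e z.1))
        0).tendsto_of_eq (by simp [he0])
    filter_upwards [h3.eventually (hVh.and hec)] with z ⟨h4, h5⟩ h6
    have h7 : f z = (z.1, ((0 : ℂ), c₀ + (z.2.2 + e z.1))) := by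
      simp only [f, h6]; congr 2; ring
    rw [Set.mem_preimage, h7, h4, h5]
    simp
  have hsm' : ∀ᶠ z in nhds (0 : (Fin q → ℂ) × (ℂ × ℂ)), z ∈ f ⁻¹' V → z.2.1 ≠ 0 →
      NonsingPt q (f ⁻¹' V) z := by
    filter_upwards [hft.eventually hsm, hea] with z h2 h3 h4 h5
    exact (h2 h4 h5).comp (hfa z h3) (hfa' _ h3) (hf'f z) (Filter.Eventually.of_forall hff')
      (Filter.Eventually.of_forall fun _ => Iff.rfl)
  refine ⟨fun t => c₀ + e t, analyticAt_const.add he, by simp [he0], ?_⟩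
  change PieceForm (f ⁻¹' V)
  rw [← hf0] at h
  have he' : AnalyticAt ℂ e (f 0).1 := by rw [hf0]; exact he
  obtain h | ⟨W, h⟩ := h
  · obtain ⟨G, hG, hGV, hGd⟩ := h.comp (S := f ⁻¹' V) (hfa 0 he) (hfa' _ he') (hf'f 0)
      (Filter.Eventually.of_forall hff') (Filter.Eventually.of_forall fun _ => Iff.rfl)
    exact pieceForm_of_fderiv_ne_zero hG hGV hGd hE
  · exact (h.comp (S := f ⁻¹' V) (hfa 0 he) (hfa' _ he') (Filter.Eventually.of_forall hf'f)
      (Filter.Eventually.of_forall hff')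
      (Filter.Eventually.of_forall fun _ => Iff.rfl)).pieceForm hE hsm'

end Transfer

section StrictTransform

variable {E : Type*} [NormedAddCommGroup E] [NormedSpace ℂ E]

theorem tendsto_blowup (c₀ : ℂ) : Filter.Tendsto
    (fun z : E × (ℂ × ℂ) => (z.1, (z.2.1, z.2.1 * z.2.2))) (nhds (0, (0, c₀))) (nhds 0) := by
  have : Continuous (fun z : E × (ℂ × ℂ) => (z.1, (z.2.1, z.2.1 * z.2.2))) := by fun_prop
  exact this.tendsto' _ _ (by simp)

theorem eventually_mem_of_mem_strictTransform {V : Set (E × (ℂ × ℂ))} {F : E × (ℂ × ℂ) → ℂ}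
    (hF : AnalyticAt ℂ F 0) (hVF : ∀ᶠ z in nhds 0, z ∈ V ↔ F z = 0) (c₀ : ℂ) :
    ∀ᶠ z in nhds ((0 : E), ((0 : ℂ), c₀)), z ∈ strictTransform V →
      (z.1, (z.2.1, z.2.1 * z.2.2)) ∈ V := by
  filter_upwards [(tendsto_blowup c₀).eventually hF.eventually_analyticAt,
    (tendsto_blowup c₀).eventually hVF.eventually_nhds] with z h1 h2 h3
  have hc : ContinuousAt (fun z : E × (ℂ × ℂ) => (z.1, (z.2.1, z.2.1 * z.2.2))) z := by fun_prop
  have h4 := (mem_closure_iff_frequently.1 h3).and_eventually (hc.eventually h2)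
  rw [h2.self_of_nhds]
  by_contra h5
  have h6 := (ContinuousAt.comp (g := F)
    (f := fun z : E × (ℂ × ℂ) => (z.1, (z.2.1, z.2.1 * z.2.2))) h1.continuousAt hc).eventually_ne h5
  obtain ⟨y, ⟨h7, h8⟩, h9⟩ := (h4.and_eventually h6).exists
  exact h9 (h8.1 h7.1)

theorem eventually_mem_strictTransform_iff {V : Set (E × (ℂ × ℂ))} {F : E × (ℂ × ℂ) → ℂ}
    (hF : AnalyticAt ℂ F 0) (hVF : ∀ᶠ z in nhds 0, z ∈ V ↔ F z = 0) (c₀ : ℂ) :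
    ∀ᶠ z in nhds ((0 : E), ((0 : ℂ), c₀)), z.2.1 ≠ 0 →
      (z ∈ strictTransform V ↔ (z.1, (z.2.1, z.2.1 * z.2.2)) ∈ V) := by
  filter_upwards [eventually_mem_of_mem_strictTransform hF hVF c₀] with z h1 h2
  exact ⟨h1, fun h3 => subset_closure ⟨h3, h2⟩⟩

theorem mem_strictTransform_swapSet {V : Set (E × (ℂ × ℂ))} {t : E} {x s : ℂ} (hs : s ≠ 0)
    (h : (t, (x, s)) ∈ strictTransform V) : (t, (x * s, s⁻¹)) ∈ strictTransform (swapSet V) := by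
  have hm : Filter.Tendsto (fun z : E × (ℂ × ℂ) => (z.1, (z.2.1 * z.2.2, z.2.2⁻¹)))
      (nhds (t, (x, s))) (nhds (t, (x * s, s⁻¹))) := by
    have : ContinuousAt (fun z : E × (ℂ × ℂ) => (z.1, (z.2.1 * z.2.2, z.2.2⁻¹))) (t, (x, s)) := by
      have : ContinuousAt (fun z : E × (ℂ × ℂ) => z.2.2⁻¹) (t, (x, s)) :=
        ContinuousAt.inv₀ (by fun_prop) hs
      fun_prop
    exact this
  have hne : ∀ᶠ z in nhds (t, (x, s)), z.2.2 ≠ 0 :=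
    ContinuousAt.eventually_ne (g := fun z : E × (ℂ × ℂ) => z.2.2) (by fun_prop) hs
  refine mem_closure_iff_frequently.2 (hm.frequently
    (((mem_closure_iff_frequently.1 h).and_eventually hne).mono ?_))
  rintro z ⟨⟨h1, h2⟩, h3⟩
  refine ⟨?_, mul_ne_zero h2 h3⟩
  simpa [swapSet, h3] using h1

theorem mem_strictTransform_swapSet_iff {V : Set (E × (ℂ × ℂ))} {t : E} {s : ℂ} (hs : s ≠ 0) :
    (t, ((0 : ℂ), s)) ∈ strictTransform (swapSet V) ↔
      (t, ((0 : ℂ), s⁻¹)) ∈ strictTransform V := by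
  constructor
  · intro h
    have h1 : (t, ((0 : ℂ) * s, s⁻¹)) ∈ strictTransform V := mem_strictTransform_swapSet hs h
    simpa using h1
  · intro h
    simpa using mem_strictTransform_swapSet (inv_ne_zero hs) h

theorem Set.subsingleton_inter_of_ncard_eq {α : Type*} {P Q : Set α} (hQ : Q.Finite)
    (h : P.ncard = Q.ncard) {B : α → Set α}
    (hB : ∀ c ∈ P, ∀ c' ∈ P, c ≠ c' → Disjoint (B c) (B c'))
    (hne : ∀ c ∈ P, (B c ∩ Q).Nonempty) : ∀ c ∈ P, (B c ∩ Q).Subsingleton := by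
  choose! f hf using hne
  have hi : ∀ c ∈ P, ∀ c' ∈ P, f c ∈ B c' → c = c' := by
    intro c hc c' hc' h1
    by_contra h2
    exact Set.disjoint_left.1 (hB c hc c' hc' h2) (hf c hc).1 h1
  have h3 : f '' P = Q := by
    refine Set.eq_of_subset_of_ncard_le (Set.image_subset_iff.2 fun c hc => (hf c hc).2) ?_ hQ
    have hinj : Set.InjOn f P := fun c hc c' hc' h1 => hi c hc c' hc' (h1 ▸ (hf c' hc').1)
    rw [hinj.ncard_image, h]
  rintro c hc x ⟨hx, hxQ⟩ y ⟨hy, hyQ⟩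
  rw [← h3] at hxQ hyQ
  obtain ⟨c1, h1, rfl⟩ := hxQ
  obtain ⟨c2, h2, rfl⟩ := hyQ
  rw [hi c1 h1 c hc hx, hi c2 h2 c hc hy]

end StrictTransform

section Smooth

variable {q : ℕ}

theorem eventually_nonsingPt_strictTransform {V : Set ((Fin q → ℂ) × (ℂ × ℂ))}
    {F : (Fin q → ℂ) × (ℂ × ℂ) → ℂ}
    (hF : AnalyticAt ℂ F 0) (hVF : ∀ᶠ z in nhds 0, z ∈ V ↔ F z = 0)
    (hsm : ∀ᶠ z in nhds (0 : (Fin q → ℂ) × (ℂ × ℂ)), z ∈ V → z.2 ≠ 0 → NonsingPt q V z) (c₀ : ℂ) :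
    ∀ᶠ z in nhds ((0 : Fin q → ℂ), ((0 : ℂ), c₀)), z ∈ strictTransform V → z.2.1 ≠ 0 →
      NonsingPt q (strictTransform V) z := by
  filter_upwards [(tendsto_blowup c₀).eventually hsm,
    (eventually_mem_strictTransform_iff hF hVF c₀).eventually_nhds] with z h1 h2 h3 h4
  have hne : ∀ᶠ z' in nhds z, z'.2.1 ≠ 0 :=
    ContinuousAt.eventually_ne (g := fun z : (Fin q → ℂ) × (ℂ × ℂ) => z.2.1) (by fun_prop) h4
  refine NonsingPt.comp (V := V)
    (f := fun z : (Fin q → ℂ) × (ℂ × ℂ) => (z.1, (z.2.1, z.2.1 * z.2.2)))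
    (f' := fun z : (Fin q → ℂ) × (ℂ × ℂ) => (z.1, (z.2.1, z.2.2 / z.2.1)))
    (h1 ((h2.self_of_nhds h4).1 h3) fun h => h4 (congrArg Prod.fst h)) (by fun_prop) ?_ ?_ ?_ ?_
  · have : AnalyticAt ℂ (fun z : (Fin q → ℂ) × (ℂ × ℂ) => z.2.2 / z.2.1)
      (z.1, (z.2.1, z.2.1 * z.2.2)) := AnalyticAt.div (by fun_prop) (by fun_prop) h4
    fun_prop
  · simp [h4]
  · have : ∀ᶠ w in nhds (z.1, (z.2.1, z.2.1 * z.2.2)), w.2.1 ≠ 0 :=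
      ContinuousAt.eventually_ne (g := fun z : (Fin q → ℂ) × (ℂ × ℂ) => z.2.1) (by fun_prop) h4
    filter_upwards [this] with w hw
    rw [mul_div_cancel₀ _ hw]
  · filter_upwards [h2, hne] with y h5 h6
    exact h5 h6

theorem eventually_nonsingPt_swapSet {V : Set ((Fin q → ℂ) × (ℂ × ℂ))}
    (hsm : ∀ᶠ z in nhds (0 : (Fin q → ℂ) × (ℂ × ℂ)), z ∈ V → z.2 ≠ 0 → NonsingPt q V z) :
    ∀ᶠ z in nhds (0 : (Fin q → ℂ) × (ℂ × ℂ)), z ∈ swapSet V → z.2 ≠ 0 →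
      NonsingPt q (swapSet V) z := by
  have ha : ∀ z, AnalyticAt ℂ (fun z : (Fin q → ℂ) × (ℂ × ℂ) => (z.1, z.2.swap)) z :=
    fun z => analyticAt_fst.prod (analyticAt_snd.fun_snd.prod analyticAt_snd.fun_fst)
  filter_upwards [tendsto_fst_swap.eventually hsm] with z h1 h2 h3
  refine NonsingPt.comp (V := V) (f := fun z : (Fin q → ℂ) × (ℂ × ℂ) => (z.1, z.2.swap))
    (f' := fun z : (Fin q → ℂ) × (ℂ × ℂ) => (z.1, z.2.swap)) (h1 h2 fun h => h3 ?_) (ha _) (ha _)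
    rfl (Filter.Eventually.of_forall fun _ => rfl) (Filter.Eventually.of_forall fun _ => Iff.rfl)
  rw [← Prod.swap_swap z.2]
  exact congrArg Prod.swap h

end Smooth

section Counting

variable {q : ℕ}

theorem eventually_exists_mem_ball {V : Set ((Fin q → ℂ) × (ℂ × ℂ))} {c₀ : ℂ}
    (hmem : ((0 : Fin q → ℂ), ((0 : ℂ), c₀)) ∈ V)
    (h : NonsingPt q V ((0 : Fin q → ℂ), ((0 : ℂ), c₀)) ∨
      ∃ W, DimType1Along q V W ((0 : Fin q → ℂ), ((0 : ℂ), c₀)))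
    (hfin : {s : ℂ | ((0 : Fin q → ℂ), ((0 : ℂ), s)) ∈ V}.Finite) {r : ℝ} (hr : 0 < r) :
    ∀ᶠ t in nhds (0 : Fin q → ℂ), ∃ s : ℂ, ‖s‖ < r ∧ (t, ((0 : ℂ), c₀ + s)) ∈ V := by
  obtain ⟨g, hg, hg0, hgne, hVg⟩ := exists_slice_equation hmem h hfin
  obtain ⟨ρ, hρ, hVρ⟩ := eventually_prod_nhds_zero_iff.1 hVg
  filter_upwards [hg.eventually_exists_zero hg0 hgne (lt_min hr hρ), Metric.ball_mem_nhds 0 hρ]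
    with t ⟨s, hs, hgs⟩ ht
  exact ⟨s, hs.trans_le (min_le_left _ _),
    (hVρ t s (mem_ball_zero_iff.1 ht) (hs.trans_le (min_le_right _ _))).2 hgs⟩

/-- The fibre over `t` of the blowing-up of `V` along the axis, where `none` is the origin of the
second chart. -/
def blowupFibre {E : Type*} [NormedAddCommGroup E] (V : Set (E × (ℂ × ℂ))) (t : E) :
    Set (Option ℂ) :=
  {o | o.elim ((t, ((0 : ℂ), (0 : ℂ))) ∈ strictTransform (swapSet V))
    fun s => (t, ((0 : ℂ), s)) ∈ strictTransform V}

theorem blowupFibre_eq (V : Set ((Fin q → ℂ) × (ℂ × ℂ))) (t : Fin q → ℂ) : blowupFibre V t =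
    some '' {s : ℂ | (t, ((0 : ℂ), s)) ∈ strictTransform V} ∪
      if (t, ((0 : ℂ), (0 : ℂ))) ∈ strictTransform (swapSet V) then {none} else ∅ := by
  ext o
  cases o <;> by_cases h : (t, ((0 : ℂ), (0 : ℂ))) ∈ strictTransform (swapSet V) <;>
    simp [blowupFibre, h]

theorem finite_blowupFibre {V : Set ((Fin q → ℂ) × (ℂ × ℂ))} {t : Fin q → ℂ}
    (h : {s : ℂ | (t, ((0 : ℂ), s)) ∈ strictTransform V}.Finite) : (blowupFibre V t).Finite := by
  rw [blowupFibre_eq]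
  refine (h.image _).union ?_
  split_ifs
  · exact Set.finite_singleton _
  · exact Set.finite_empty

theorem ncard_blowupFibre {V : Set ((Fin q → ℂ) × (ℂ × ℂ))} {t : Fin q → ℂ}
    (h : {s : ℂ | (t, ((0 : ℂ), s)) ∈ strictTransform V}.Finite) : (blowupFibre V t).ncard =
      {s : ℂ | (t, ((0 : ℂ), s)) ∈ strictTransform V}.ncard +
        if (t, ((0 : ℂ), (0 : ℂ))) ∈ strictTransform (swapSet V) then 1 else 0 := by
  rw [blowupFibre_eq, Set.ncard_union_eq ?_ (h.image _) ?_,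
    Set.ncard_image_of_injective _ (Option.some_injective _)]
  · split_ifs <;> simp
  · split_ifs <;> simp
  · split_ifs <;> simp

theorem exists_separating_radius {A : Set ℂ} (hA : A.Finite) : ∃ r : ℝ, 0 < r ∧
    (∀ c ∈ A, (‖c‖ + r) * r < 1) ∧ ∀ c ∈ A, ∀ c' ∈ A, c ≠ c' → 2 * r < ‖c - c'‖ := by
  have h1 : ∀ᶠ r in nhds (0 : ℝ), ∀ c ∈ A, (‖c‖ + r) * r < 1 := by
    refine (Filter.eventually_all_finite hA).2 fun c _ => ?_
    have : Continuous fun r : ℝ => (‖c‖ + r) * r := by fun_prop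
    exact (this.tendsto' 0 0 (by simp)).eventually (gt_mem_nhds one_pos)
  have h2 : ∀ᶠ r in nhds (0 : ℝ), ∀ c ∈ A, ∀ c' ∈ A, c ≠ c' → 2 * r < ‖c - c'‖ := by
    refine (Filter.eventually_all_finite hA).2 fun c _ =>
      (Filter.eventually_all_finite hA).2 fun c' _ => ?_
    by_cases h : c = c'
    · exact Filter.Eventually.of_forall fun _ h' => absurd h h'
    · have : Continuous fun r : ℝ => 2 * r := by fun_prop
      filter_upwards [(this.tendsto' 0 0 (by simp)).eventually
        (gt_mem_nhds (norm_pos_iff.2 (sub_ne_zero.2 h)))] with r h3 _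
      exact h3
  obtain ⟨r, ⟨h3, h4⟩, h5⟩ := (((h1.and h2).filter_mono
    (nhdsWithin_le_nhds (s := Set.Ioi 0))).and self_mem_nhdsWithin).exists
  exact ⟨r, h5, h3, h4⟩

theorem transForm_of_blowup_conditions {V : Set ((Fin q → ℂ) × (ℂ × ℂ))}
    {F : (Fin q → ℂ) × (ℂ × ℂ) → ℂ}
    (hF : AnalyticAt ℂ F 0) (hVF : ∀ᶠ z in nhds 0, z ∈ V ↔ F z = 0)
    (hsm : ∀ᶠ z in nhds (0 : (Fin q → ℂ) × (ℂ × ℂ)), z ∈ V → z.2 ≠ 0 → NonsingPt q V z)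
    (hfin : {s : ℂ | ((0 : Fin q → ℂ), ((0 : ℂ), s)) ∈ strictTransform V}.Finite)
    {D : Set (Fin q → ℂ)} (hD : ∀ᶠ t in nhds 0, t ∈ closure D)
    (hfib : ∀ t ∈ D, (blowupFibre V t).Finite ∧
      (blowupFibre V 0).ncard = (blowupFibre V t).ncard)
    (h1 : ∀ s : ℂ, ((0 : Fin q → ℂ), ((0 : ℂ), s)) ∈ strictTransform V →
      NonsingPt q (strictTransform V) ((0 : Fin q → ℂ), ((0 : ℂ), s)) ∨
        ∃ W', DimType1Along q (strictTransform V) W' ((0 : Fin q → ℂ), ((0 : ℂ), s)))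
    (h2 : ((0 : Fin q → ℂ), ((0 : ℂ), (0 : ℂ))) ∈ strictTransform (swapSet V) →
      NonsingPt q (strictTransform (swapSet V)) ((0 : Fin q → ℂ), ((0 : ℂ), (0 : ℂ))) ∨
        ∃ W', DimType1Along q (strictTransform (swapSet V)) W'
          ((0 : Fin q → ℂ), ((0 : ℂ), (0 : ℂ)))) :
    (∀ c, TransForm (strictTransform V) c) ∧ TransForm (strictTransform (swapSet V)) 0 := by
  have hfin' : {s : ℂ | ((0 : Fin q → ℂ), ((0 : ℂ), s)) ∈ strictTransform (swapSet V)}.Finite := by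
    refine ((hfin.image (·⁻¹)).insert 0).subset fun s hs => ?_
    by_cases h0 : s = 0
    · exact Or.inl h0
    · exact Or.inr ⟨s⁻¹, (mem_strictTransform_swapSet_iff h0).1 hs, inv_inv s⟩
  obtain ⟨r, hr, hr1, hr2⟩ := exists_separating_radius hfin
  let B : Option ℂ → Set (Option ℂ) := fun o =>
    o.elim {p | ∀ s, p = some s → 1 < ‖s‖ * r} fun c => {p | ∃ s, p = some s ∧ ‖s - c‖ < r}
  have hBs : ∀ c ∈ {s : ℂ | ((0 : Fin q → ℂ), ((0 : ℂ), s)) ∈ strictTransform V},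
      Disjoint (B none) (B (some c)) := by
    intro c hc
    refine Set.disjoint_left.2 ?_
    rintro _ h3 ⟨s, rfl, hs⟩
    have h4 : 1 < ‖s‖ * r := h3 s rfl
    have h5 := hr1 c hc
    have h6 : ‖s‖ ≤ ‖c‖ + ‖s - c‖ := by simpa using norm_add_le c (s - c)
    nlinarith
  have hB : ∀ c ∈ blowupFibre V 0, ∀ c' ∈ blowupFibre V 0, c ≠ c' → Disjoint (B c) (B c') := by
    rintro (_ | c) hc (_ | c') hc' hne
    · exact absurd rfl hne
    · exact hBs c' hc'
    · exact (hBs c hc).symm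
    · refine Set.disjoint_left.2 ?_
      rintro _ ⟨s, rfl, hs⟩ ⟨s', h4, hs'⟩
      rw [Option.some_inj] at h4
      subst h4
      have h5 := hr2 c hc c' hc' fun h => hne (congrArg some h)
      have h6 : ‖c - c'‖ ≤ ‖s - c'‖ + ‖s - c‖ := by
        simpa using norm_sub_le (s - c') (s - c)
      linarith
  let o : ℂ → Option ℂ := fun s => if s = 0 then none else some s⁻¹
  have ho : Function.Injective o := by
    intro s s' h
    by_cases h0 : s = 0 <;> by_cases h0' : s' = 0 <;> simp_all [o]
  have hoB : ∀ s : ℂ, ‖s‖ < r → o s ∈ B none := by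
    intro s hs s' hs'
    by_cases h0 : s = 0
    · simp [o, h0] at hs'
    · have h3 : s⁻¹ = s' := by simpa [o, h0] using hs'
      rw [← h3, norm_inv, inv_mul_eq_div, one_lt_div (norm_pos_iff.2 h0)]
      exact hs
  have hoV : ∀ (t : Fin q → ℂ) (s : ℂ), (t, ((0 : ℂ), s)) ∈ strictTransform (swapSet V) →
      o s ∈ blowupFibre V t := by
    intro t s hs
    by_cases h0 : s = 0
    · subst h0
      simpa [o, blowupFibre] using hs
    · simpa [o, blowupFibre, h0] using (mem_strictTransform_swapSet_iff h0).1 hs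
  have hne : ∀ᶠ t in nhds (0 : Fin q → ℂ), ∀ c ∈ blowupFibre V 0,
      (B c ∩ blowupFibre V t).Nonempty := by
    refine (Filter.eventually_all_finite (finite_blowupFibre hfin)).2 ?_
    rintro (_ | c) hc
    · filter_upwards [eventually_exists_mem_ball hc (h2 hc) hfin' hr] with t ⟨s, hs, hsV⟩
      rw [zero_add] at hsV
      exact ⟨o s, hoB s hs, hoV t s hsV⟩
    · filter_upwards [eventually_exists_mem_ball hc (h1 c hc) hfin hr] with t ⟨s, hs, hsV⟩
      exact ⟨some (c + s), ⟨c + s, rfl, by simpa using hs⟩, hsV⟩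
  have hsub : ∀ᶠ t in nhds (0 : Fin q → ℂ), t ∈ D → ∀ c ∈ blowupFibre V 0,
      (B c ∩ blowupFibre V t).Subsingleton := by
    filter_upwards [hne] with t h3 h4
    exact Set.subsingleton_inter_of_ncard_eq (hfib t h4).1 (hfib t h4).2 hB h3
  constructor
  · intro c
    by_cases hc : ((0 : Fin q → ℂ), ((0 : ℂ), c)) ∈ strictTransform V
    · refine TransForm.of_nonsingPt_or_dimType1Along hc (h1 c hc) hfin hD hr ?_
        (eventually_nonsingPt_strictTransform hF hVF hsm c)
      filter_upwards [hsub] with t h3 h4 s s' hs hs' h5 h6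
      have := h3 h4 (some c) hc (x := some (c + s)) ⟨⟨c + s, rfl, by simpa using hs⟩, h5⟩
        (y := some (c + s')) ⟨⟨c + s', rfl, by simpa using hs'⟩, h6⟩
      simpa using this
    · exact TransForm.of_notMem isClosed_closure hc
  · by_cases hc : ((0 : Fin q → ℂ), ((0 : ℂ), (0 : ℂ))) ∈ strictTransform (swapSet V)
    · have hF' : AnalyticAt ℂ (fun z : (Fin q → ℂ) × (ℂ × ℂ) => F (z.1, z.2.swap)) 0 :=
        hF.comp_of_eq (f := fun z : (Fin q → ℂ) × (ℂ × ℂ) => (z.1, z.2.swap))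
          (analyticAt_fst.prod (analyticAt_snd.fun_snd.prod analyticAt_snd.fun_fst)) rfl
      refine TransForm.of_nonsingPt_or_dimType1Along hc (h2 hc) hfin' hD hr ?_
        (eventually_nonsingPt_strictTransform hF' (tendsto_fst_swap.eventually hVF)
          (eventually_nonsingPt_swapSet hsm) 0)
      filter_upwards [hsub] with t h3 h4 s s' hs hs' h5 h6
      rw [zero_add] at h5 h6
      exact ho (h3 h4 none hc ⟨hoB s hs, hoV t s h5⟩ ⟨hoB s' hs', hoV t s' h6⟩)
    · exact TransForm.of_notMem isClosed_closure hc

end Counting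

section Gather

variable {q : ℕ}

theorem TransForm.exists_pieces {V : Set ((Fin q → ℂ) × (ℂ × ℂ))} {c₀ : ℂ} (h : TransForm V c₀) :
    ∃ (ι : Type) (_ : Finite ι) (k : ι → ℕ) (u σ : ι → (Fin q → ℂ) × ℂ → ℂ),
      (∀ i, 0 < k i ∧ AnalyticAt ℂ (u i) 0 ∧ u i 0 ≠ 0 ∧ AnalyticAt ℂ (σ i) 0 ∧ σ i 0 = c₀) ∧
      (∀ i, ∀ᶠ p in nhds (0 : (Fin q → ℂ) × ℂ), (p.1, (p.2 ^ k i * u i p, σ i p)) ∈ V) ∧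
      ∀ U ∈ nhds (0 : (Fin q → ℂ) × ℂ), ∀ᶠ z in nhds ((0 : Fin q → ℂ), ((0 : ℂ), c₀)), z ∈ V →
        ∃ i, ∃ τ : ℂ, (z.1, τ) ∈ U ∧ z.2 = (τ ^ k i * u i (z.1, τ), σ i (z.1, τ)) := by
  obtain ⟨c, hc, rfl, ι, hι, k, u, σ, h1, h2, h3⟩ := h
  refine ⟨ι, hι, k, u, fun i p => σ i p + c p.1, fun i => ?_, h2, fun U hU => ?_⟩
  · obtain ⟨h4, h5, h6, h7, h8⟩ := h1 i
    have : AnalyticAt ℂ (fun p : (Fin q → ℂ) × ℂ => c p.1) 0 :=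
      hc.comp_of_eq (f := fun p : (Fin q → ℂ) × ℂ => p.1) (by fun_prop) rfl
    exact ⟨h4, h5, h6, h7.add this, by simp [h8]⟩
  · have h4 : Filter.Tendsto (fun z : (Fin q → ℂ) × (ℂ × ℂ) => (z.1, (z.2.1, z.2.2 - c z.1)))
        (nhds ((0 : Fin q → ℂ), ((0 : ℂ), c 0))) (nhds 0) := by
      have h5 : AnalyticAt ℂ (fun z : (Fin q → ℂ) × (ℂ × ℂ) => c z.1)
          ((0 : Fin q → ℂ), ((0 : ℂ), c 0)) :=
        hc.comp_of_eq (f := fun z : (Fin q → ℂ) × (ℂ × ℂ) => z.1) (by fun_prop) rfl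
      have h6 : ContinuousAt (fun z : (Fin q → ℂ) × (ℂ × ℂ) => (z.1, (z.2.1, z.2.2 - c z.1)))
          ((0 : Fin q → ℂ), ((0 : ℂ), c 0)) := by
        have := h5.continuousAt
        fun_prop
      have h7 := h6.tendsto
      simp only [sub_self] at h7
      exact h7
    filter_upwards [h4.eventually (h3 U hU)] with z h5 h6
    obtain ⟨i, τ, h7, h8⟩ := h5 (by simpa using h6)
    obtain ⟨h9, h10⟩ := Prod.ext_iff.1 h8
    exact ⟨i, τ, h7, Prod.ext h9 (sub_eq_iff_eq_add.1 h10)⟩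

theorem exists_mem_ne_zero {V : Set ((Fin q → ℂ) × (ℂ × ℂ))}
    {F : (Fin q → ℂ) × (ℂ × ℂ) → ℂ} (hF : AnalyticAt ℂ F 0)
    (hVF : ∀ᶠ z in nhds 0, z ∈ V ↔ F z = 0) (h0 : F 0 = 0) :
    ∃ᶠ z in nhds (0 : (Fin q → ℂ) × (ℂ × ℂ)), z ∈ V ∧ z.2 ≠ 0 := by
  intro hno
  have hι : Filter.Tendsto (fun p : ℂ × ℂ => ((0 : Fin q → ℂ), p)) (nhds 0) (nhds 0) :=
    (by fun_prop : Continuous fun p : ℂ × ℂ => ((0 : Fin q → ℂ), p)).tendsto' _ _ rfl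
  have hh : AnalyticAt ℂ (fun p : ℂ × ℂ => F (0, p)) 0 :=
    hF.comp_of_eq (f := fun p : ℂ × ℂ => ((0 : Fin q → ℂ), p)) (by fun_prop) rfl
  have hne : ∀ᶠ p in nhds (0 : ℂ × ℂ), p ≠ 0 → F (0, p) ≠ 0 := by
    filter_upwards [hι.eventually (hno.and hVF)] with p ⟨h1, h2⟩ h3 h4
    exact h1 ⟨h2.2 h4, h3⟩
  obtain ⟨r, hr, h1⟩ := eventually_prod_nhds_zero_iff.1 hne
  have h2 := hh.eventually_exists_zero h0 (by
    intro h3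
    have h4 := (h3.and (Metric.ball_mem_nhds 0 hr)).filter_mono
      (nhdsWithin_le_nhds (s := ({0}ᶜ : Set ℂ)))
    obtain ⟨s, ⟨h5, h6⟩, h7⟩ := (h4.and self_mem_nhdsWithin).exists
    exact h1 0 s (by simpa using hr) (mem_ball_zero_iff.1 h6) (by simpa using h7) h5) hr
  obtain ⟨x, ⟨⟨s, h3, h4⟩, h5⟩, h6⟩ := (((h2.and (Metric.ball_mem_nhds 0 hr)).filter_mono
    (nhdsWithin_le_nhds (s := ({0}ᶜ : Set ℂ)))).and self_mem_nhdsWithin).exists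
  exact h1 x s (mem_ball_zero_iff.1 h5) h3 (fun h => h6 (congrArg Prod.fst h)) h4

theorem nForm_of_transForm {V : Set ((Fin q → ℂ) × (ℂ × ℂ))}
    {F : (Fin q → ℂ) × (ℂ × ℂ) → ℂ}
    (hF : AnalyticAt ℂ F 0) (hVF : ∀ᶠ z in nhds 0, z ∈ V ↔ F z = 0) (h0 : F 0 = 0)
    (hfin : {s : ℂ | ((0 : Fin q → ℂ), ((0 : ℂ), s)) ∈ strictTransform V}.Finite)
    (h1 : ∀ c, TransForm (strictTransform V) c) (h2 : TransForm (strictTransform (swapSet V)) 0) :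
    NForm V := by
  choose ι₁ hι₁ k₁ u₁ σ₁ hw₁ hV₁ hc₁ using fun c => (h1 c).exists_pieces
  obtain ⟨ι₂, hι₂, k₂, u₂, σ₂, hw₂, hV₂, hc₂⟩ := h2.exists_pieces
  have hF' : AnalyticAt ℂ (fun z : (Fin q → ℂ) × (ℂ × ℂ) => F (z.1, z.2.swap)) 0 :=
    hF.comp_of_eq (f := fun z : (Fin q → ℂ) × (ℂ × ℂ) => (z.1, z.2.swap))
      (analyticAt_fst.prod (analyticAt_snd.fun_snd.prod analyticAt_snd.fun_fst)) rfl
  have hfinA : Finite {s : ℂ | ((0 : Fin q → ℂ), ((0 : ℂ), s)) ∈ strictTransform V} := hfin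
  let J : Type :=
    (Σ a : {s : ℂ | ((0 : Fin q → ℂ), ((0 : ℂ), s)) ∈ strictTransform V}, ι₁ a) ⊕ ι₂
  let k : J → ℕ := Sum.elim (fun a => k₁ a.1 a.2) k₂
  let w : J → (Fin q → ℂ) × ℂ → ℂ × ℂ := Sum.elim
    (fun a p => (u₁ a.1 a.2 p, u₁ a.1 a.2 p * σ₁ a.1 a.2 p)) (fun i p => (u₂ i p * σ₂ i p, u₂ i p))
  have hpt : ∀ {K : ℕ} {u σ : (Fin q → ℂ) × ℂ → ℂ} {c : ℂ}, 0 < K → AnalyticAt ℂ u 0 →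
      AnalyticAt ℂ σ 0 → σ 0 = c → Filter.Tendsto (fun p : (Fin q → ℂ) × ℂ =>
        (p.1, (p.2 ^ K * u p, σ p))) (nhds 0) (nhds ((0 : Fin q → ℂ), ((0 : ℂ), c))) := by
    intro K u σ c hK hu hσ hc
    have h : AnalyticAt ℂ (fun p : (Fin q → ℂ) × ℂ => (p.1, (p.2 ^ K * u p, σ p))) 0 := by fun_prop
    simpa [hK.ne', hc] using h.continuousAt.tendsto
  have hcover : ∀ U ∈ nhds (0 : (Fin q → ℂ) × ℂ), ∀ᶠ z in nhds (0 : (Fin q → ℂ) × (ℂ × ℂ)),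
      z ∈ V → z.2 ≠ 0 → ∃ i, ∃ τ, (z.1, τ) ∈ U ∧ z.2 = τ ^ k i • w i (z.1, τ) := by
    intro U hU
    have ha : ∀ c : ℂ, ∀ᶠ z in nhds ((0 : Fin q → ℂ), ((0 : ℂ), c)),
        (z.1, (z.2.1, z.2.1 * z.2.2)) ∈ V → z.2.1 ≠ 0 →
          ∃ i, ∃ τ, (z.1, τ) ∈ U ∧ (z.2.1, z.2.1 * z.2.2) = τ ^ k i • w i (z.1, τ) := by
      intro c
      by_cases hc : ((0 : Fin q → ℂ), ((0 : ℂ), c)) ∈ strictTransform V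
      · filter_upwards [hc₁ c U hU] with z h3 h4 h5
        obtain ⟨i, τ, h6, h7⟩ := h3 (subset_closure ⟨h4, h5⟩)
        obtain ⟨h8, h9⟩ := Prod.ext_iff.1 h7
        refine ⟨Sum.inl ⟨⟨c, hc⟩, i⟩, τ, h6, ?_⟩
        simp [k, w, h8, h9, mul_assoc]
      · filter_upwards [isClosed_closure.isOpen_compl.mem_nhds hc] with z h3 h4 h5
        exact absurd (show z ∈ strictTransform V from subset_closure ⟨h4, h5⟩) h3
    have hb : ∀ᶠ z in nhds (0 : (Fin q → ℂ) × (ℂ × ℂ)),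
        (z.1, (z.2.1 * z.2.2, z.2.1)) ∈ V → z.2.1 ≠ 0 →
          ∃ i, ∃ τ, (z.1, τ) ∈ U ∧ (z.2.1 * z.2.2, z.2.1) = τ ^ k i • w i (z.1, τ) := by
      filter_upwards [hc₂ U hU] with z h3 h4 h5
      obtain ⟨i, τ, h6, h7⟩ := h3 (subset_closure ⟨h4, h5⟩)
      obtain ⟨h8, h9⟩ := Prod.ext_iff.1 h7
      refine ⟨Sum.inr i, τ, h6, ?_⟩
      simp [k, w, h8, h9, mul_assoc]
    obtain ⟨ρ, hρ, hbρ⟩ := Metric.eventually_nhds_iff_ball.1 hb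
    have hK : ∀ᶠ p in nhds (0 : (Fin q → ℂ) × ℂ), ∀ s ∈ Metric.closedBall (0 : ℂ) ρ⁻¹,
        (p.1, (p.2, p.2 * s)) ∈ V → p.2 ≠ 0 →
          ∃ i, ∃ τ, (p.1, τ) ∈ U ∧ (p.2, p.2 * s) = τ ^ k i • w i (p.1, τ) := by
      refine (isCompact_closedBall (0 : ℂ) ρ⁻¹).eventually_forall_of_forall_eventually
        fun s _ => ?_
      have h3 : Filter.Tendsto (fun x : ((Fin q → ℂ) × ℂ) × ℂ => (x.1.1, (x.1.2, x.2)))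
          (nhds (0, s)) (nhds ((0 : Fin q → ℂ), ((0 : ℂ), s))) :=
        (by fun_prop : Continuous fun x : ((Fin q → ℂ) × ℂ) × ℂ =>
          (x.1.1, (x.1.2, x.2))).tendsto' _ _ rfl
      exact h3.eventually (ha s)
    have h3 : Filter.Tendsto (fun z : (Fin q → ℂ) × (ℂ × ℂ) => (z.1, z.2.1)) (nhds 0) (nhds 0) :=
      (by fun_prop : Continuous fun z : (Fin q → ℂ) × (ℂ × ℂ) => (z.1, z.2.1)).tendsto' _ _ rfl
    filter_upwards [h3.eventually hK, Metric.ball_mem_nhds 0 hρ]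
    rintro ⟨t, x, y⟩ h4 h5 h6 h7
    by_cases hx : x ≠ 0 ∧ ‖y / x‖ ≤ ρ⁻¹
    · simpa [mul_div_cancel₀ _ hx.1] using h4 (y / x) (by simpa using hx.2)
        (by simpa [mul_div_cancel₀ _ hx.1] using h6) hx.1
    · have hy : y ≠ 0 ∧ ‖x / y‖ < ρ := by
        by_cases hx0 : x = 0
        · subst hx0
          exact ⟨fun h => h7 (by simp [h]), by simpa using hρ⟩
        · have h8 : ρ⁻¹ < ‖y / x‖ := not_le.1 fun h => hx ⟨hx0, h⟩
          have hy0 : y ≠ 0 := by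
            rintro rfl
            rw [zero_div, norm_zero] at h8
            exact absurd h8 (not_lt.2 (inv_pos.2 hρ).le)
          refine ⟨hy0, ?_⟩
          rw [← inv_div, norm_inv]
          exact inv_lt_of_inv_lt₀ hρ h8
      rw [mem_ball_zero_iff, Prod.norm_def, max_lt_iff, Prod.norm_def, max_lt_iff] at h5
      have h8 : (t, (y, x / y)) ∈ Metric.ball (0 : (Fin q → ℂ) × (ℂ × ℂ)) ρ := by
        rw [mem_ball_zero_iff, Prod.norm_def, max_lt_iff, Prod.norm_def, max_lt_iff]
        exact ⟨h5.1, h5.2.2, hy.2⟩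
      simpa [mul_div_cancel₀ _ hy.1] using hbρ _ h8
        (by simpa [mul_div_cancel₀ _ hy.1] using h6) hy.1
  obtain ⟨z, ⟨hz, hz2⟩, hzc⟩ := ((exists_mem_ne_zero hF hVF h0).and_eventually
    (hcover Set.univ Filter.univ_mem)).exists
  obtain ⟨j, -⟩ := hzc hz hz2
  refine ⟨J, inferInstance, ⟨j⟩, k, w, ?_, ?_, fun U hU => ?_⟩
  · rintro (⟨a, i⟩ | i)
    · obtain ⟨h3, h4, h5, h6, -⟩ := hw₁ a i
      exact ⟨h3, h4.prod (h4.mul h6), fun h => h5 (congrArg Prod.fst h)⟩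
    · obtain ⟨h3, h4, h5, h6, -⟩ := hw₂ i
      exact ⟨h3, (h4.mul h6).prod h4, fun h => h5 (congrArg Prod.snd h)⟩
  · rintro (⟨a, i⟩ | i)
    · obtain ⟨h3, h4, -, h6, h7⟩ := hw₁ a i
      filter_upwards [hV₁ a i, (hpt h3 h4 h6 h7).eventually
        (eventually_mem_of_mem_strictTransform hF hVF a)] with p h8 h9
      simpa [k, w, mul_assoc] using h9 h8
    · obtain ⟨h3, h4, -, h6, h7⟩ := hw₂ i
      filter_upwards [hV₂ i, (hpt h3 h4 h6 h7).eventually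
        (eventually_mem_of_mem_strictTransform hF' (tendsto_fst_swap.eventually hVF) 0)]
        with p h8 h9
      have h10 : (p.1, (p.2 ^ k₂ i * u₂ i p * σ₂ i p, p.2 ^ k₂ i * u₂ i p)) ∈ V := h9 h8
      simpa [k, w, mul_assoc] using h10
  · have h3 : Filter.Tendsto (fun z : (Fin q → ℂ) × (ℂ × ℂ) => (z.1, (0 : ℂ))) (nhds 0)
        (nhds 0) :=
      (by fun_prop : Continuous fun z : (Fin q → ℂ) × (ℂ × ℂ) => (z.1, (0 : ℂ))).tendsto' _ _ rfl
    filter_upwards [hcover U hU, h3.eventually hU] with z h4 h5 h6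
    by_cases h7 : z.2 = 0
    · have h8 : 0 < k j := by
        rcases j with ⟨a, i⟩ | i
        exacts [(hw₁ a i).1, (hw₂ i).1]
      exact ⟨j, 0, h5, by rw [h7, zero_pow h8.ne', zero_smul]⟩
    · exact h4 h6 h7

end Gather

/-- Let `V` be a hypersurface whose singular locus `W` is nonsingular of
codimension 1 in `V` (in adapted coordinates, `W = {x = y = 0}`), `P = 0 ∈ W`, and let
`π : V' → V` be the blowing-up of `W` (described by its two charts
`β₁(t,x,s) = (t,x,xs)` and `β₂(t,y,s') = (t,s'y,y)`, with `V'` the strict transform).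
Then `V` is of dimensionality type 1 along `W` at `P` if and only if:
(1) `π⁻¹(P)` is a finite set of the same cardinality as `π⁻¹(Q)` for a general point `Q`
of `W`, and (2) each point `P' ∈ π⁻¹(P)` is either a nonsingular point of `V'` or a point of
dimensionality type 1. -/
theorem dim_type_one_iff_blowup_conditions
    (q : ℕ) (F : (Fin q → ℂ) × (ℂ × ℂ) → ℂ)
    (Ω : Set ((Fin q → ℂ) × (ℂ × ℂ))) (hΩ : Ω ∈ nhds (0 : (Fin q → ℂ) × (ℂ × ℂ)))
    (hΩopen : IsOpen Ω) (hFan : AnalyticOnNhd ℂ F Ω) (hF0 : F 0 = 0)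
    (V W : Set ((Fin q → ℂ) × (ℂ × ℂ)))
    (hV : V = {p ∈ Ω | F p = 0})
    (hW : W = {p ∈ Ω | p.2 = 0})
    -- `F` is reduced
    (hred : ∀ h : (Fin q → ℂ) × (ℂ × ℂ) → ℂ, AnalyticAt ℂ h 0 →
      (∀ᶠ p in nhds (0 : (Fin q → ℂ) × (ℂ × ℂ)), F p = 0 → h p = 0) →
      ∃ w, AnalyticAt ℂ w 0 ∧
        ∀ᶠ p in nhds (0 : (Fin q → ℂ) × (ℂ × ℂ)), h p = F p * w p)
    -- the singular locus of `V` is exactly `W` (which has codimension 1 in `V`)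
    (hsing : ∀ p ∈ Ω, ((F p = 0 ∧ fderiv ℂ F p = 0) ↔ p.2 = 0))
    -- the strict transform of `V` in the two charts of the blowing-up of `W`
    (V'₁ V'₂ : Set ((Fin q → ℂ) × (ℂ × ℂ)))
    (hV1 : V'₁ = closure {z : (Fin q → ℂ) × (ℂ × ℂ) |
      (z.1, (z.2.1, z.2.1 * z.2.2)) ∈ V ∧ z.2.1 ≠ 0})
    (hV2 : V'₂ = closure {z : (Fin q → ℂ) × (ℂ × ℂ) |
      (z.1, (z.2.2 * z.2.1, z.2.1)) ∈ V ∧ z.2.1 ≠ 0}) :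
    DimType1Along q V W 0 ↔
      ((∃ T ∈ nhds (0 : Fin q → ℂ), ∃ D ⊆ T, T ⊆ closure D ∧
        ∀ t₀ ∈ D,
          {s : ℂ | ((0 : Fin q → ℂ), ((0 : ℂ), s)) ∈ V'₁}.Finite ∧
          {s : ℂ | (t₀, ((0 : ℂ), s)) ∈ V'₁}.Finite ∧
          {s : ℂ | ((0 : Fin q → ℂ), ((0 : ℂ), s)) ∈ V'₁}.ncard
              + (if ((0 : Fin q → ℂ), ((0 : ℂ), (0 : ℂ))) ∈ V'₂ then 1 else 0)
            = {s : ℂ | (t₀, ((0 : ℂ), s)) ∈ V'₁}.ncard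
              + (if (t₀, ((0 : ℂ), (0 : ℂ))) ∈ V'₂ then 1 else 0)) ∧
      (∀ s : ℂ, ((0 : Fin q → ℂ), ((0 : ℂ), s)) ∈ V'₁ →
        NonsingPt q V'₁ ((0 : Fin q → ℂ), ((0 : ℂ), s)) ∨
          ∃ W', DimType1Along q V'₁ W' ((0 : Fin q → ℂ), ((0 : ℂ), s))) ∧
      (((0 : Fin q → ℂ), ((0 : ℂ), (0 : ℂ))) ∈ V'₂ →
        NonsingPt q V'₂ 0 ∨ ∃ W', DimType1Along q V'₂ W' 0)) := by
  have hmem : ∀ᶠ z in nhds (0 : (Fin q → ℂ) × (ℂ × ℂ)), z ∈ Ω := hΩ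
  have hF : AnalyticAt ℂ F 0 := hFan 0 (mem_of_mem_nhds hΩ)
  have hVF : ∀ᶠ z in nhds (0 : (Fin q → ℂ) × (ℂ × ℂ)), z ∈ V ↔ F z = 0 := by
    filter_upwards [hmem] with z hz
    rw [hV]
    exact and_iff_right hz
  have hWz : ∀ᶠ z in nhds (0 : (Fin q → ℂ) × (ℂ × ℂ)), z ∈ W ↔ z.2 = 0 := by
    filter_upwards [hmem] with z hz
    rw [hW]
    exact and_iff_right hz
  have hWV : ∀ᶠ z in nhds (0 : (Fin q → ℂ) × (ℂ × ℂ)), z.2 = 0 → z ∈ V := by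
    filter_upwards [hmem] with z hz h
    rw [hV]
    exact ⟨hz, ((hsing z hz).2 h).1⟩
  have hd : ∀ᶠ z in nhds (0 : (Fin q → ℂ) × (ℂ × ℂ)), z.2 ≠ 0 → F z = 0 → fderiv ℂ F z ≠ 0 := by
    filter_upwards [hmem] with z hz h h1 h2
    exact h ((hsing z hz).1 ⟨h1, h2⟩)
  have hsm : ∀ᶠ z in nhds (0 : (Fin q → ℂ) × (ℂ × ℂ)), z ∈ V → z.2 ≠ 0 → NonsingPt q V z := by
    filter_upwards [hmem, hVF.eventually_nhds, hd] with z hz h1 h2 h3 h4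
    exact ⟨F, hFan z hz, h1, h2 h4 (h1.self_of_nhds.1 h3)⟩
  have hV1' : V'₁ = strictTransform V := hV1
  have hV2' : V'₂ = strictTransform (swapSet V) := by rw [hV2, strictTransform_swapSet]
  subst hV1' hV2'
  constructor
  · intro h
    obtain ⟨L, N, d, hN, hd0, s, hs⟩ := (h.nForm hWz hWV).tForm hF hVF hd
    exact IsTForm.blowup_conditions ⟨hN, hd0, hs⟩
  · rintro ⟨⟨T, hT, D, hDT, hTD, hfib⟩, h1, h2⟩
    obtain ⟨t, ht⟩ : D.Nonempty := closure_nonempty_iff.1 ⟨0, hTD (mem_of_mem_nhds hT)⟩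
    have hfin := (hfib t ht).1
    obtain ⟨h3, h4⟩ := transForm_of_blowup_conditions hF hVF hsm hfin
      (Filter.mem_of_superset hT hTD)
      (fun t ht => ⟨finite_blowupFibre (hfib t ht).2.1, by
        rw [ncard_blowupFibre hfin, ncard_blowupFibre (hfib t ht).2.1]
        exact (hfib t ht).2.2⟩) h1 h2
    exact ((nForm_of_transForm hF hVF hF0 hfin h3 h4).tForm hF hVF hd).dimType1Along hWz
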